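/- For every sufficiently large x, for every real w ≥ x^{6g} with C/log x ≤ g ≤ 1/10 and 1/(g log x) ≤ ε ≤ 1/4 (where C is a sufficiently large absolute constant), the number of primes p ≤ w such that p−1 has no prime factor in (x^g, x^{g(1+ε)}] is at most (1 − 2ε/3)·w/log w. -/

import Mathlib

namespace PNTBV

open Complex MeasureTheory Set Filter Asymptotics

/-- The remainder `∑_{N < k ≤ t} f k - κ (t - N)`, cut off to `t > N`. -/
noncomputable def tailFun (f : ℕ → ℂ) (κ : ℂ) (N : ℕ) (t : ℝ) : ℂ :=
  (Ioi (N : ℝ)).indicator (fun t => ∑ k ∈ Finset.Ioc N ⌊t⌋₊, f k - κ * ((t : ℂ) - N)) t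

lemma measurable_tailFun (f : ℕ → ℂ) (κ : ℂ) (N : ℕ) : Measurable (tailFun f κ N) := by
  refine Measurable.indicator ?_ measurableSet_Ioi
  refine Measurable.sub ?_ (by fun_prop)
  exact (measurable_from_nat (f := fun m => ∑ k ∈ Finset.Ioc N m, f k)).comp Nat.measurable_floor

lemma norm_tailFun_le {f : ℕ → ℂ} {κ : ℂ} {N : ℕ} {B : ℝ}
    (hB : ∀ t : ℝ, N < t → ‖∑ k ∈ Finset.Ioc N ⌊t⌋₊, f k - κ * ((t : ℂ) - N)‖ ≤ B) (hB0 : 0 ≤ B)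
    (t : ℝ) : ‖tailFun f κ N t‖ ≤ B := by
  unfold tailFun
  by_cases h : t ∈ Ioi (N : ℝ)
  · rw [indicator_of_mem h]; exact hB t h
  · rw [indicator_of_notMem h]; simpa

lemma differentiableAt_mellin_tailFun {f : ℕ → ℂ} {κ : ℂ} {N : ℕ} (hN : 1 ≤ N) {B : ℝ}
    (hB : ∀ t : ℝ, N < t → ‖∑ k ∈ Finset.Ioc N ⌊t⌋₊, f k - κ * ((t : ℂ) - N)‖ ≤ B) (hB0 : 0 ≤ B)
    {s : ℂ} (hs : s.re < 0) : DifferentiableAt ℂ (mellin (tailFun f κ N)) s := by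
  refine mellin_differentiableAt_of_isBigO_rpow (a := 0) (b := s.re - 1) ?_ ?_ hs ?_ (by linarith)
  · refine LocallyIntegrable.locallyIntegrableOn ?_ _
    refine (locallyIntegrable_const B).mono (measurable_tailFun f κ N).aestronglyMeasurable ?_
    refine Eventually.of_forall fun t => (norm_tailFun_le hB hB0 t).trans (Real.le_norm_self _)
  · refine IsBigO.of_bound B (Eventually.of_forall fun t => ?_)
    simpa using norm_tailFun_le hB hB0 t
  · refine IsBigO.of_bound 1 ?_
    have : ∀ᶠ t : ℝ in nhdsWithin 0 (Ioi 0), t < 1 :=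
      nhdsWithin_le_nhds (Iio_mem_nhds one_pos)
    filter_upwards [this] with t ht
    have : tailFun f κ N t = 0 := by
      unfold tailFun
      rw [indicator_of_notMem]
      simp only [mem_Ioi, not_lt]
      have : (1 : ℝ) ≤ N := by exact_mod_cast hN
      linarith
    rw [this, norm_zero]
    positivity

lemma norm_mellin_tailFun_le {f : ℕ → ℂ} {κ : ℂ} {N : ℕ} (hN : 1 ≤ N) {B : ℝ}
    (hB : ∀ t : ℝ, N < t → ‖∑ k ∈ Finset.Ioc N ⌊t⌋₊, f k - κ * ((t : ℂ) - N)‖ ≤ B) (hB0 : 0 ≤ B)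
    {s : ℂ} (hs : 0 < s.re) : ‖mellin (tailFun f κ N) (-s)‖ ≤ B * (N : ℝ) ^ (-s.re) / s.re := by
  have hN0 : (0 : ℝ) < N := by exact_mod_cast hN
  have h1 : mellin (tailFun f κ N) (-s) =
      ∫ t in Ioi (N : ℝ), (t : ℂ) ^ (-s - 1) • tailFun f κ N t := by
    unfold mellin
    refine (setIntegral_eq_of_subset_of_forall_sdiff_eq_zero measurableSet_Ioi
      (Ioi_subset_Ioi hN0.le) ?_)
    intro t ht
    have : tailFun f κ N t = 0 := by
      unfold tailFun
      rw [indicator_of_notMem ht.2]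
    simp [this]
  rw [h1]
  have hInt : IntegrableOn (fun t : ℝ => B * t ^ (-s.re - 1)) (Ioi (N : ℝ)) :=
    (integrableOn_Ioi_rpow_of_lt (by linarith) hN0).const_mul _
  refine (norm_integral_le_of_norm_le hInt ?_).trans ?_
  · refine (ae_restrict_mem measurableSet_Ioi).mono fun t ht => ?_
    have ht0 : 0 < t := hN0.trans ht
    rw [norm_smul, Complex.norm_cpow_eq_rpow_re_of_pos ht0, mul_comm]
    simp only [sub_re, neg_re, one_re]
    exact mul_le_mul_of_nonneg_right (norm_tailFun_le hB hB0 t) (by positivity)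
  · rw [integral_const_mul, integral_Ioi_rpow_of_lt (by linarith) hN0]
    apply le_of_eq
    have : s.re ≠ 0 := hs.ne'
    rw [show -s.re - 1 + 1 = -s.re by ring]
    field_simp

lemma LSeries_eq_sum_add_mellin_tailFun {f : ℕ → ℂ} (hf : ∀ n, ‖f n‖ ≤ 1) {κ : ℂ} {N : ℕ}
    (hN : 1 ≤ N) {B : ℝ}
    (hB : ∀ t : ℝ, N < t → ‖∑ k ∈ Finset.Ioc N ⌊t⌋₊, f k - κ * ((t : ℂ) - N)‖ ≤ B) (hB0 : 0 ≤ B)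
    {s : ℂ} (hs : 1 < s.re) :
    LSeries f s = ∑ n ∈ Finset.Icc 1 N, f n * (n : ℂ) ^ (-s) + κ * (N : ℂ) ^ (1 - s) / (s - 1)
      + s * mellin (tailFun f κ N) (-s) := by
  have hN0 : (0 : ℝ) < N := by exact_mod_cast hN
  have hNc : (N : ℂ) ≠ 0 := by exact_mod_cast hN0.ne'
  have hs0 : s ≠ 0 := fun h => by simp [h] at hs; linarith
  have hs1 : s - 1 ≠ 0 := fun h => by
    have := sub_eq_zero.1 h
    simp [this] at hs
  set g : ℕ → ℂ := fun n => if N < n then f n else 0 with hg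
  set h : ℕ → ℂ := fun n => if N < n then 0 else f n with hh
  have hgn : ∀ n, ‖g n‖ ≤ 1 := fun n => by
    simp only [hg]; split_ifs <;> simp [hf]
  have hsumf : LSeriesSummable f s :=
    LSeriesSummable_of_bounded_of_one_lt_re (m := 1) (fun n _ => hf n) hs
  have hsumg : LSeriesSummable g s :=
    LSeriesSummable_of_bounded_of_one_lt_re (m := 1) (fun n _ => hgn n) hs
  have hsumh : LSeriesSummable h s :=
    LSeriesSummable_of_bounded_of_one_lt_re (m := 1) (fun n _ => by
      simp only [hh]; split_ifs <;> simp [hf]) hs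
  have hfgh : f = h + g := by
    funext n
    simp only [hg, hh, Pi.add_apply]
    split_ifs <;> simp
  have e1 : LSeries h s = ∑ n ∈ Finset.Icc 1 N, f n * (n : ℂ) ^ (-s) := by
    unfold LSeries
    rw [tsum_eq_sum (s := Finset.Icc 1 N)]
    · refine Finset.sum_congr rfl fun n hn => ?_
      rw [Finset.mem_Icc] at hn
      rw [LSeries.term_of_ne_zero (by lia)]
      simp only [hh, if_neg (show ¬ N < n by lia), cpow_neg, div_eq_mul_inv]
    · intro n hn
      rw [Finset.mem_Icc] at hn
      rcases Nat.eq_zero_or_pos n with rfl | h0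
      · simp
      · rw [LSeries.term_of_ne_zero (by lia)]
        simp only [hh, if_pos (show N < n by lia), zero_div]
  have hgS : ∀ m : ℕ, ∑ k ∈ Finset.Icc 1 m, g k = ∑ k ∈ Finset.Ioc N m, f k := by
    intro m
    simp only [hg]
    rw [← Finset.sum_filter]
    refine Finset.sum_congr ?_ fun _ _ => rfl
    ext k
    simp only [Finset.mem_filter, Finset.mem_Icc, Finset.mem_Ioc]
    lia
  have e2 : LSeries g s = s * ∫ t in Ioi (1 : ℝ),
      (∑ k ∈ Finset.Icc 1 ⌊t⌋₊, g k) * t ^ (-(s + 1)) := by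
    refine LSeries_eq_mul_integral' g zero_le_one hs ?_
    refine IsBigO.of_bound 1 (Eventually.of_forall fun n => ?_)
    simp only [Real.rpow_one, Real.norm_natCast, one_mul]
    rw [Real.norm_of_nonneg (Finset.sum_nonneg fun _ _ => norm_nonneg _)]
    refine (Finset.sum_le_card_nsmul _ _ 1 fun k _ => hgn k).trans ?_
    simp
  have e3 : ∫ t in Ioi (1 : ℝ), (∑ k ∈ Finset.Icc 1 ⌊t⌋₊, g k) * (t : ℂ) ^ (-(s + 1)) =
      ∫ t in Ioi (N : ℝ), (∑ k ∈ Finset.Ioc N ⌊t⌋₊, f k) * (t : ℂ) ^ (-(s + 1)) := by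
    simp_rw [hgS]
    refine setIntegral_eq_of_subset_of_forall_sdiff_eq_zero measurableSet_Ioi
      (Ioi_subset_Ioi (by exact_mod_cast hN)) ?_
    intro t ht
    have : ⌊t⌋₊ ≤ N := by
      have h2 : t ≤ N := not_lt.1 ht.2
      exact Nat.floor_le_of_le h2
    rw [Finset.Ioc_eq_empty (by lia)]
    simp
  have e4 : mellin (tailFun f κ N) (-s) =
      ∫ t in Ioi (N : ℝ), (t : ℂ) ^ (-s - 1) • tailFun f κ N t := by
    unfold mellin
    refine (setIntegral_eq_of_subset_of_forall_sdiff_eq_zero measurableSet_Ioi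
      (Ioi_subset_Ioi hN0.le) ?_)
    intro t ht
    have : tailFun f κ N t = 0 := by
      unfold tailFun
      rw [indicator_of_notMem ht.2]
    simp [this]
  have i1 : IntegrableOn (fun t : ℝ => (t : ℂ) ^ (-s - 1) • tailFun f κ N t) (Ioi (N : ℝ)) := by
    have hInt : IntegrableOn (fun t : ℝ => B * t ^ (-s.re - 1)) (Ioi (N : ℝ)) :=
      (integrableOn_Ioi_rpow_of_lt (by linarith) hN0).const_mul _
    refine hInt.mono' ?_ ?_
    · simp only [smul_eq_mul]
      refine AEStronglyMeasurable.mul ?_ (measurable_tailFun f κ N).aestronglyMeasurable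
      refine ContinuousOn.aestronglyMeasurable ?_ measurableSet_Ioi
      intro t ht
      exact (continuousAt_ofReal_cpow_const _ _ (Or.inr (hN0.trans ht).ne')).continuousWithinAt
    · refine (ae_restrict_mem measurableSet_Ioi).mono fun t ht => ?_
      have ht0 : 0 < t := hN0.trans ht
      rw [norm_smul, Complex.norm_cpow_eq_rpow_re_of_pos ht0, mul_comm]
      simp only [sub_re, neg_re, one_re]
      exact mul_le_mul_of_nonneg_right (norm_tailFun_le hB hB0 t) (by positivity)
  have i2 : IntegrableOn (fun t : ℝ => (t : ℂ) ^ (-s)) (Ioi (N : ℝ)) :=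
    integrableOn_Ioi_cpow_of_lt (by simpa using hs) hN0
  have i3 : IntegrableOn (fun t : ℝ => (t : ℂ) ^ (-s - 1)) (Ioi (N : ℝ)) :=
    integrableOn_Ioi_cpow_of_lt (by simp; linarith) hN0
  have e5 : ∫ t in Ioi (N : ℝ), (∑ k ∈ Finset.Ioc N ⌊t⌋₊, f k) * (t : ℂ) ^ (-(s + 1)) =
      (∫ t in Ioi (N : ℝ), (t : ℂ) ^ (-s - 1) • tailFun f κ N t) +
      (κ * (∫ t in Ioi (N : ℝ), (t : ℂ) ^ (-s)) - κ * N * ∫ t in Ioi (N : ℝ),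
          (t : ℂ) ^ (-s - 1)) := by
    have i4 : IntegrableOn (fun t : ℝ => κ * (t : ℂ) ^ (-s) - κ * N * (t : ℂ) ^ (-s - 1))
        (Ioi (N : ℝ)) := (i2.const_mul _).sub (i3.const_mul _)
    rw [← integral_const_mul, ← integral_const_mul, ← integral_sub (i2.const_mul _)
        (i3.const_mul _),
      ← integral_add i1 i4]
    refine setIntegral_congr_fun measurableSet_Ioi fun t ht => ?_
    have ht0 : 0 < t := hN0.trans ht
    have htc : (t : ℂ) ≠ 0 := by exact_mod_cast ht0.ne'
    simp only [tailFun, indicator_of_mem ht, smul_eq_mul]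
    have : (t : ℂ) ^ (-s) = (t : ℂ) ^ (-s - 1) * t := by
      conv_lhs => rw [show -s = (-s - 1) + 1 by ring, cpow_add _ _ htc, cpow_one]
    rw [this, show -(s + 1) = -s - 1 by ring]
    ring
  rw [hfgh, LSeries_add hsumh hsumg, e1, ← hfgh, e2, e3, e4, e5,
    integral_Ioi_cpow_of_lt (by simpa using hs) hN0,
    integral_Ioi_cpow_of_lt (by simp; linarith) hN0]
  rw [show -s - 1 + 1 = -s by ring, show -s + 1 = 1 - s by ring]
  simp only [ofReal_natCast]
  have h3 : 1 - s ≠ 0 := fun h => hs1 (by linear_combination -h)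
  have h4 : (N : ℂ) ^ (1 - s) = N * (N : ℂ) ^ (-s) := by
    rw [sub_eq_add_neg, cpow_add _ _ hNc]; simp
  rw [h4]
  field_simp
  ring

lemma eq_of_eq_right_half_plane {F G : ℂ → ℂ} (hF : DifferentiableOn ℂ F {s | 0 < s.re})
    (hG : DifferentiableOn ℂ G {s | 0 < s.re}) (h : ∀ s : ℂ, 1 < s.re → F s = G s) {s : ℂ}
    (hs : 0 < s.re) : F s = G s := by
  have ho : IsOpen {s : ℂ | 0 < s.re} := isOpen_lt continuous_const continuous_re
  have ho1 : IsOpen {s : ℂ | 1 < s.re} := isOpen_lt continuous_const continuous_re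
  refine (hF.analyticOnNhd ho).eqOn_of_preconnected_of_eventuallyEq (hG.analyticOnNhd ho)
    (convex_halfSpace_re_gt 0).isPreconnected (z₀ := 2) (by simp) ?_ hs
  filter_upwards [ho1.mem_nhds (show (2 : ℂ) ∈ {s : ℂ | 1 < s.re} by simp)] with z hz using h z hz

lemma differentiableOn_mellin_tailFun {f : ℕ → ℂ} {κ : ℂ} {N : ℕ} (hN : 1 ≤ N) {B : ℝ}
    (hB : ∀ t : ℝ, N < t → ‖∑ k ∈ Finset.Ioc N ⌊t⌋₊, f k - κ * ((t : ℂ) - N)‖ ≤ B)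
    (hB0 : 0 ≤ B) :
    DifferentiableOn ℂ (fun s => mellin (tailFun f κ N) (-s)) {s | 0 < s.re} := by
  intro s hs
  have := differentiableAt_mellin_tailFun hN hB hB0 (s := -s) (by simpa using hs)
  exact (DifferentiableAt.comp s (f := fun s => -s) this (by fun_prop)).differentiableWithinAt

lemma differentiable_sum_cpow (f : ℕ → ℂ) (N : ℕ) :
    Differentiable ℂ fun s : ℂ => ∑ n ∈ Finset.Icc 1 N, f n * (n : ℂ) ^ (-s) := by
  refine Differentiable.fun_sum fun n hn => ?_
  have : (n : ℂ) ≠ 0 := by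
    rw [Finset.mem_Icc] at hn
    exact_mod_cast (show n ≠ 0 by lia)
  intro s
  exact ((differentiableAt_id.neg).const_cpow (Or.inl this)).const_mul _

lemma continuation_eq_of_bounded {F : ℂ → ℂ} {a : ℕ → ℂ} (ha : ∀ n, ‖a n‖ ≤ 1) {N : ℕ}
    (hN : 1 ≤ N) {B : ℝ} (hB : ∀ t : ℝ, N < t → ‖∑ k ∈ Finset.Ioc N ⌊t⌋₊, a k‖ ≤ B) (hB0 : 0 ≤ B)
    (hF : Differentiable ℂ F) (h : ∀ s : ℂ, 1 < s.re → F s = LSeries a s) {s : ℂ}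
    (hs : 0 < s.re) :
    F s = ∑ n ∈ Finset.Icc 1 N, a n * (n : ℂ) ^ (-s) + s * mellin (tailFun a 0 N) (-s) := by
  have hB' : ∀ t : ℝ, N < t → ‖∑ k ∈ Finset.Ioc N ⌊t⌋₊, a k - 0 * ((t : ℂ) - N)‖ ≤ B := by
    simpa using hB
  refine eq_of_eq_right_half_plane (F := F)
    (G := fun s => ∑ n ∈ Finset.Icc 1 N, a n * (n : ℂ) ^ (-s) + s * mellin (tailFun a 0 N) (-s))
    hF.differentiableOn ?_ (fun s hs => ?_) hs
  · exact (differentiable_sum_cpow a N).differentiableOn.add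
      (differentiableOn_id.mul (differentiableOn_mellin_tailFun hN hB' hB0))
  · rw [h s hs, LSeries_eq_sum_add_mellin_tailFun ha hN hB' hB0 hs]
    simp

lemma continuation_eq_of_pole {F : ℂ → ℂ} {a : ℕ → ℂ} (ha : ∀ n, ‖a n‖ ≤ 1) {κ : ℂ} {N : ℕ}
    (hN : 1 ≤ N) {B : ℝ}
    (hB : ∀ t : ℝ, N < t → ‖∑ k ∈ Finset.Ioc N ⌊t⌋₊, a k - κ * ((t : ℂ) - N)‖ ≤ B) (hB0 : 0 ≤ B)
    (hF : Differentiable ℂ F) (h : ∀ s : ℂ, 1 < s.re → F s = (s - 1) * LSeries a s) {s : ℂ}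
    (hs : 0 < s.re) :
    F s = (s - 1) * ∑ n ∈ Finset.Icc 1 N, a n * (n : ℂ) ^ (-s) + κ * (N : ℂ) ^ (1 - s) +
      (s - 1) * s * mellin (tailFun a κ N) (-s) := by
  have hNc : (N : ℂ) ≠ 0 := by exact_mod_cast (show N ≠ 0 by lia)
  refine eq_of_eq_right_half_plane (F := F)
    (G := fun s => (s - 1) * ∑ n ∈ Finset.Icc 1 N, a n * (n : ℂ) ^ (-s) + κ * (N : ℂ) ^ (1 - s) +
      (s - 1) * s * mellin (tailFun a κ N) (-s))
    hF.differentiableOn ?_ (fun s hs => ?_) hs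
  · refine DifferentiableOn.add (DifferentiableOn.add ?_ ?_) ?_
    · exact ((differentiable_id.sub_const 1).mul (differentiable_sum_cpow a N)).differentiableOn
    · intro s _
      exact (DifferentiableAt.const_mul (DifferentiableAt.const_cpow (by fun_prop) (Or.inl hNc))
        _).differentiableWithinAt
    · exact DifferentiableOn.mul (by fun_prop) (differentiableOn_mellin_tailFun hN hB hB0)
  · have hs1 : s - 1 ≠ 0 := fun h => by
      have := sub_eq_zero.1 h
      simp [this] at hs
    rw [h s hs, LSeries_eq_sum_add_mellin_tailFun ha hN hB hB0 hs]
    field_simp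

lemma norm_sum_range_le_of_periodic {g : ℕ → ℂ} {q : ℕ} (hq : 0 < q) (hg : ∀ k, g (q + k) = g k)
    (h0 : ∑ k ∈ Finset.range q, g k = 0) {B : ℝ} (hB : ∀ k, ‖g k‖ ≤ B) (m : ℕ) :
    ‖∑ k ∈ Finset.range m, g k‖ ≤ B * q := by
  have hB0 : 0 ≤ B := (norm_nonneg _).trans (hB 0)
  induction m using Nat.strong_induction_on with
  | _ m ih =>
    rcases lt_or_ge m q with h | h
    · refine (norm_sum_le_of_le _ fun k _ => hB k).trans ?_
      rw [Finset.sum_const, Finset.card_range, nsmul_eq_mul, mul_comm]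
      gcongr
    · obtain ⟨j, rfl⟩ := Nat.exists_eq_add_of_le h
      rw [Finset.sum_range_add, h0, zero_add]
      simp_rw [hg]
      exact ih j (by lia)

lemma sum_range_natCast_eq_sum_zmod {q : ℕ} [NeZero q] (g : ZMod q → ℂ) :
    ∑ k ∈ Finset.range q, g k = ∑ a, g a := by
  refine Finset.sum_bij (fun k _ => (k : ZMod q)) (by simp) ?_ ?_ (by simp)
  · intro a ha b hb hab
    rw [Finset.mem_range] at ha hb
    rw [ZMod.natCast_eq_natCast_iff'] at hab
    rwa [Nat.mod_eq_of_lt ha, Nat.mod_eq_of_lt hb] at hab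
  · intro b _
    exact ⟨b.val, by simpa using ZMod.val_lt b, by simp⟩

/-- The mean value of a Dirichlet character. -/
noncomputable def charMean {q : ℕ} (χ : DirichletCharacter ℂ q) : ℂ :=
  (∑ k ∈ Finset.range q, χ k) / q

lemma norm_charMean_le {q : ℕ} (χ : DirichletCharacter ℂ q) : ‖charMean χ‖ ≤ 1 := by
  unfold charMean
  rw [norm_div, Complex.norm_natCast]
  refine div_le_one_of_le₀ ?_ (by positivity)
  refine (norm_sum_le_of_le _ fun k _ => χ.norm_le_one _).trans ?_
  simp

lemma charMean_eq_zero {q : ℕ} [NeZero q] {χ : DirichletCharacter ℂ q} (hχ : χ ≠ 1) :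
    charMean χ = 0 := by
  unfold charMean
  rw [sum_range_natCast_eq_sum_zmod (fun a => χ a), MulChar.sum_eq_zero_of_ne_one hχ, zero_div]

lemma norm_sum_char_sub_le {q : ℕ} [NeZero q] (χ : DirichletCharacter ℂ q) (N : ℕ) (t : ℝ)
    (ht : N < t) :
    ‖∑ k ∈ Finset.Ioc N ⌊t⌋₊, χ k - charMean χ * ((t : ℂ) - N)‖ ≤ 5 * q := by
  have hq : 0 < q := Nat.pos_of_ne_zero (NeZero.ne q)
  have hq1 : (1 : ℝ) ≤ q := by exact_mod_cast hq
  have hN : N ≤ ⌊t⌋₊ := Nat.le_floor ht.le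
  have key : ∀ m, ‖∑ k ∈ Finset.range m, (χ k - charMean χ)‖ ≤ 2 * q := by
    refine norm_sum_range_le_of_periodic hq (fun k => by simp) ?_ fun k => ?_
    · have : (q : ℂ) ≠ 0 := by exact_mod_cast hq.ne'
      simp only [Finset.sum_sub_distrib, Finset.sum_const, Finset.card_range, nsmul_eq_mul]
      unfold charMean
      field_simp
      simp
    · refine (norm_sub_le _ _).trans ?_
      have h1 := χ.norm_le_one (k : ZMod q)
      have h2 := norm_charMean_le χ
      linarith
  have e : ∑ k ∈ Finset.Ioc N ⌊t⌋₊, χ k - charMean χ * ((t : ℂ) - N) =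
      (∑ k ∈ Finset.range (⌊t⌋₊ + 1), (χ k - charMean χ) -
        ∑ k ∈ Finset.range (N + 1), (χ k - charMean χ)) - charMean χ * ((t - ⌊t⌋₊ : ℝ) : ℂ) := by
    have hI : Finset.Ioc N ⌊t⌋₊ = Finset.Ico (N + 1) (⌊t⌋₊ + 1) := by
      ext; simp
    rw [← Finset.sum_Ico_eq_sub _ (by lia), hI]
    simp only [Finset.sum_sub_distrib, Finset.sum_const, Nat.card_Ico, nsmul_eq_mul]
    rw [Nat.cast_sub (by lia)]
    push_cast
    ring
  rw [e]
  refine (norm_sub_le _ _).trans ?_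
  have h1 := (norm_sub_le (∑ k ∈ Finset.range (⌊t⌋₊ + 1), (χ k - charMean χ))
    (∑ k ∈ Finset.range (N + 1), (χ k - charMean χ))).trans (add_le_add (key _) (key _))
  have h2 : ‖charMean χ * ((t - ⌊t⌋₊ : ℝ) : ℂ)‖ ≤ 1 := by
    rw [norm_mul, Complex.norm_real, Real.norm_eq_abs]
    have ht0 : 0 ≤ t := (Nat.cast_nonneg N).trans ht.le
    have := Nat.floor_le ht0
    have := Nat.lt_floor_add_one t
    rw [abs_of_nonneg (by linarith)]
    exact mul_le_one₀ (norm_charMean_le χ) (by linarith) (by linarith)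
  linarith

lemma sum_norm_cpow_le {θ : ℝ} (hθ : 0 < θ) {s : ℂ} (hs : 1 - θ ≤ s.re) (N : ℕ) (hN : 1 ≤ N) :
    ∑ n ∈ Finset.Icc 1 N, ‖(n : ℂ) ^ (-s)‖ ≤ (1 + 1 / θ) * (N : ℝ) ^ (2 * θ) := by
  have hN1 : (1 : ℝ) ≤ N := by exact_mod_cast hN
  have h1 : ∑ n ∈ Finset.Icc 1 N, ‖(n : ℂ) ^ (-s)‖ ≤
      ∑ n ∈ Finset.Icc 1 N, (N : ℝ) ^ θ * (n : ℝ)⁻¹ := by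
    refine Finset.sum_le_sum fun n hn => ?_
    rw [Finset.mem_Icc] at hn
    have hn1 : (1 : ℝ) ≤ n := by exact_mod_cast hn.1
    have hn0 : (0 : ℝ) < n := by linarith
    rw [Complex.norm_natCast_cpow_of_pos (by lia)]
    calc (n : ℝ) ^ (-s).re ≤ (n : ℝ) ^ (θ + (-1)) :=
          Real.rpow_le_rpow_of_exponent_le hn1 (by simp; linarith)
      _ = (n : ℝ) ^ θ * (n : ℝ)⁻¹ := by rw [Real.rpow_add hn0, Real.rpow_neg_one]
      _ ≤ _ := by
        gcongr
        exact_mod_cast hn.2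
  refine h1.trans ?_
  rw [← Finset.mul_sum]
  have h2 : ∑ n ∈ Finset.Icc 1 N, (n : ℝ)⁻¹ ≤ 1 + Real.log N := by
    have := harmonic_le_one_add_log N
    rw [harmonic_eq_sum_Icc] at this
    push_cast at this
    exact this
  have h3 : Real.log N ≤ (N : ℝ) ^ θ / θ := Real.log_le_rpow_div (by positivity) hθ
  have h4 : (1 : ℝ) ≤ (N : ℝ) ^ θ := Real.one_le_rpow hN1 hθ.le
  calc (N : ℝ) ^ θ * ∑ n ∈ Finset.Icc 1 N, (n : ℝ)⁻¹ ≤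
      (N : ℝ) ^ θ * ((N : ℝ) ^ θ + (N : ℝ) ^ θ / θ) := by gcongr; linarith
    _ = (1 + 1 / θ) * (N : ℝ) ^ (2 * θ) := by
      rw [two_mul, Real.rpow_add (by linarith)]; ring

/-- The size parameter attached to a modulus `q` and a point `s`. -/
noncomputable def cond (q : ℝ) (s : ℂ) : ℝ := q * (|s.im| + 2)

lemma exists_nat_cond {q : ℕ} (hq : 0 < q) (s : ℂ) :
    ∃ N : ℕ, 1 ≤ N ∧ cond q s ≤ N ∧ (N : ℝ) ≤ 2 * cond q s := by
  have hq1 : (1 : ℝ) ≤ q := by exact_mod_cast hq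
  have h1 : 1 ≤ cond q s := by
    unfold cond
    nlinarith [abs_nonneg s.im]
  refine ⟨⌈cond q s⌉₊, ?_, Nat.le_ceil _, ?_⟩
  · exact Nat.one_le_ceil_iff.2 (by linarith)
  · have := Nat.ceil_lt_add_one (show 0 ≤ cond q s by linarith)
    linarith

lemma norm_mul_mellin_le {q : ℕ} [NeZero q] (χ : DirichletCharacter ℂ q) {θ : ℝ} (hθ : 0 < θ)
    (hθ2 : θ ≤ 1 / 2) {s : ℂ} (hs : 1 - θ ≤ s.re) (hs3 : s.re ≤ 3) {N : ℕ} (hN1 : 1 ≤ N)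
    (hN : cond q s ≤ N) :
    ‖s * mellin (tailFun (fun n => χ n) (charMean χ) N) (-s)‖ ≤ 20 * (N : ℝ) ^ θ := by
  have hq : 0 < q := Nat.pos_of_ne_zero (NeZero.ne q)
  have hq1 : (1 : ℝ) ≤ q := by exact_mod_cast hq
  have hσ : 1 / 2 ≤ s.re := by linarith
  have h := norm_mellin_tailFun_le hN1 (norm_sum_char_sub_le χ N) (by positivity)
    (show 0 < s.re by linarith)
  have hNr : (1 : ℝ) ≤ N := by exact_mod_cast hN1
  have hs' : ‖s‖ ≤ 2 * (|s.im| + 2) := by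
    have := Complex.norm_le_abs_re_add_abs_im s
    rw [abs_of_nonneg (by linarith : 0 ≤ s.re)] at this
    linarith [abs_nonneg s.im]
  rw [norm_mul]
  have h2 : (N : ℝ) ^ (-s.re) ≤ (N : ℝ) ^ (θ - 1) :=
    Real.rpow_le_rpow_of_exponent_le hNr (by linarith)
  calc ‖s‖ * ‖mellin (tailFun (fun n => χ n) (charMean χ) N) (-s)‖
      ≤ (2 * (|s.im| + 2)) * (5 * q * (N : ℝ) ^ (θ - 1) / (1 / 2)) := by
        gcongr
        refine h.trans ?_
        gcongr
    _ = 20 * (N : ℝ) ^ (θ - 1) * cond q s := by unfold cond; ring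
    _ ≤ 20 * (N : ℝ) ^ (θ - 1) * N := by gcongr
    _ = 20 * (N : ℝ) ^ θ := by
      rw [mul_assoc, ← Real.rpow_add_one (by linarith), sub_add_cancel]

lemma one_le_cond {q : ℕ} [NeZero q] (s : ℂ) : 1 ≤ cond q s := by
  have hq1 : (1 : ℝ) ≤ q := by exact_mod_cast Nat.pos_of_ne_zero (NeZero.ne q)
  unfold cond
  nlinarith [abs_nonneg s.im]

lemma sum_norm_char_mul_cpow_le {q : ℕ} (χ : DirichletCharacter ℂ q) {θ : ℝ} (hθ : 0 < θ) {s : ℂ}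
    (hs : 1 - θ ≤ s.re) {N : ℕ} (hN : 1 ≤ N) :
    ‖∑ n ∈ Finset.Icc 1 N, χ n * (n : ℂ) ^ (-s)‖ ≤ (1 + 1 / θ) * (N : ℝ) ^ (2 * θ) := by
  refine (norm_sum_le _ _).trans ((Finset.sum_le_sum fun n _ => ?_).trans
    (sum_norm_cpow_le hθ hs N hN))
  rw [norm_mul]
  exact mul_le_of_le_one_left (norm_nonneg _) (χ.norm_le_one _)

lemma rpow_two_mul_le {x θ : ℝ} {N : ℝ} (hx : 0 ≤ x) (hN0 : 0 ≤ N) (hN : N ≤ 2 * x) (hθ : 0 < θ)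
    (hθ2 : θ ≤ 1 / 2) : N ^ (2 * θ) ≤ 2 * x ^ (2 * θ) := by
  calc N ^ (2 * θ) ≤ (2 * x) ^ (2 * θ) := by gcongr
    _ = 2 ^ (2 * θ) * x ^ (2 * θ) := Real.mul_rpow (by norm_num) hx
    _ ≤ 2 * x ^ (2 * θ) := by
      gcongr
      calc (2 : ℝ) ^ (2 * θ) ≤ 2 ^ (1 : ℝ) :=
            Real.rpow_le_rpow_of_exponent_le (by norm_num) (by linarith)
        _ = 2 := by simp

theorem norm_LFunction_le {q : ℕ} [NeZero q] {χ : DirichletCharacter ℂ q} (hχ : χ ≠ 1) {θ : ℝ}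
    (hθ : 0 < θ) (hθ2 : θ ≤ 1 / 2) {s : ℂ} (hs : 1 - θ ≤ s.re) (hs3 : s.re ≤ 3) :
    ‖χ.LFunction s‖ ≤ (42 + 2 / θ) * cond q s ^ (2 * θ) := by
  obtain ⟨N, hN1, hN, hN2⟩ := exists_nat_cond (Nat.pos_of_ne_zero (NeZero.ne q)) s
  have hNr : (1 : ℝ) ≤ N := by exact_mod_cast hN1
  have hκ := charMean_eq_zero hχ
  have h1 := norm_sum_char_sub_le χ N
  simp only [hκ, zero_mul, sub_zero] at h1
  rw [continuation_eq_of_bounded (a := fun n => χ n) (fun n => χ.norm_le_one _) hN1 h1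
    (by positivity) (DirichletCharacter.differentiable_LFunction hχ)
    (fun s hs => DirichletCharacter.LFunction_eq_LSeries χ hs) (by linarith), ← hκ]
  refine (norm_add_le _ _).trans ((add_le_add (sum_norm_char_mul_cpow_le χ hθ hs hN1)
    (norm_mul_mellin_le χ hθ hθ2 hs hs3 hN1 hN)).trans ?_)
  have h2 : (N : ℝ) ^ θ ≤ (N : ℝ) ^ (2 * θ) :=
    Real.rpow_le_rpow_of_exponent_le hNr (by linarith)
  have h3 := rpow_two_mul_le (by linarith [one_le_cond (q := q) s]) (by linarith) hN2 hθ hθ2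
  calc (1 + 1 / θ) * (N : ℝ) ^ (2 * θ) + 20 * (N : ℝ) ^ θ ≤
      (1 + 1 / θ) * (2 * cond q s ^ (2 * θ)) + 20 * (2 * cond q s ^ (2 * θ)) := by
        gcongr
        exact h2.trans h3
    _ = _ := by ring

theorem norm_LFunctionTrivChar₁_le {q : ℕ} [NeZero q] {θ : ℝ}
    (hθ : 0 < θ) (hθ2 : θ ≤ 1 / 2) {s : ℂ} (hs : 1 - θ ≤ s.re) (hs3 : s.re ≤ 3) :
    ‖DirichletCharacter.LFunctionTrivChar₁ q s‖ ≤
      (44 + 2 / θ) * (‖s - 1‖ + 1) * cond q s ^ (2 * θ) := by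
  obtain ⟨N, hN1, hN, hN2⟩ := exists_nat_cond (Nat.pos_of_ne_zero (NeZero.ne q)) s
  have hNr : (1 : ℝ) ≤ N := by exact_mod_cast hN1
  set χ : DirichletCharacter ℂ q := 1 with hχ
  rw [continuation_eq_of_pole (F := DirichletCharacter.LFunctionTrivChar₁ q) (a := fun n => χ n)
    (fun n => χ.norm_le_one _) hN1
    (norm_sum_char_sub_le χ N) (by positivity)
    (DirichletCharacter.differentiable_LFunctionTrivChar₁ q)
    (fun s hs => ?_) (by linarith)]
  swap
  · have : s ≠ 1 := fun h => by simp [h] at hs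
    rw [DirichletCharacter.LFunctionTrivChar₁, Function.update_of_ne this,
      DirichletCharacter.LFunctionTrivChar, DirichletCharacter.LFunction_eq_LSeries _ hs]
  have h2 : (N : ℝ) ^ θ ≤ (N : ℝ) ^ (2 * θ) :=
    Real.rpow_le_rpow_of_exponent_le hNr (by linarith)
  have h3 := rpow_two_mul_le (by linarith [one_le_cond (q := q) s]) (by linarith) hN2 hθ hθ2
  have h4 : ‖charMean χ * (N : ℂ) ^ (1 - s)‖ ≤ (N : ℝ) ^ (2 * θ) := by
    rw [norm_mul, Complex.norm_natCast_cpow_of_pos (by lia)]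
    refine (mul_le_of_le_one_left (by positivity) (norm_charMean_le χ)).trans ?_
    exact Real.rpow_le_rpow_of_exponent_le hNr (by simp; linarith)
  have h5 : ‖(s - 1) * ∑ n ∈ Finset.Icc 1 N, χ n * (n : ℂ) ^ (-s)‖ ≤
      ‖s - 1‖ * ((1 + 1 / θ) * (N : ℝ) ^ (2 * θ)) := by
    rw [norm_mul]
    gcongr
    exact sum_norm_char_mul_cpow_le χ hθ hs hN1
  have h6 : ‖(s - 1) * s * mellin (tailFun (fun n => χ n) (charMean χ) N) (-s)‖ ≤
      ‖s - 1‖ * (20 * (N : ℝ) ^ (2 * θ)) := by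
    rw [mul_assoc, norm_mul]
    gcongr
    exact (norm_mul_mellin_le χ hθ hθ2 hs hs3 hN1 hN).trans (by gcongr)
  refine (norm_add₃_le).trans ((add_le_add_three h5 h4 h6).trans ?_)
  have h7 : 0 ≤ ‖s - 1‖ := norm_nonneg _
  calc ‖s - 1‖ * ((1 + 1 / θ) * (N : ℝ) ^ (2 * θ)) + (N : ℝ) ^ (2 * θ) +
        ‖s - 1‖ * (20 * (N : ℝ) ^ (2 * θ)) =
      (‖s - 1‖ * (21 + 1 / θ) + 1) * (N : ℝ) ^ (2 * θ) := by ring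
    _ ≤ ((22 + 1 / θ) * (‖s - 1‖ + 1)) * (2 * cond q s ^ (2 * θ)) := by
      gcongr
      have : 0 < 1 / θ := by positivity
      nlinarith
    _ = _ := by ring

lemma norm_sub_le_of_bounded_ball {f : ℂ → ℂ} {c z : ℂ} {ρ M : ℝ}
    (hf : DifferentiableOn ℂ f (Metric.ball c ρ)) (hM : ∀ w ∈ Metric.ball c ρ, ‖f w‖ ≤ M)
    (hM0 : 0 < M) (hz : z ∈ Metric.ball c ρ) : ‖f z - f c‖ ≤ 3 * M / ρ * ‖z - c‖ := by
  have hρ : 0 < ρ := (dist_nonneg).trans_lt (Metric.mem_ball.1 hz)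
  have := Complex.dist_le_div_mul_dist_of_mapsTo_ball (R₂ := 3 * M) hf ?_ hz
  · simpa [dist_eq_norm] using this
  · intro w hw
    have h1 := hM w hw
    have h2 := hM c (Metric.mem_ball_self hρ)
    rw [Metric.mem_closedBall, dist_eq_norm]
    have := norm_sub_le (f w) (f c)
    linarith

lemma cond_mono {X Y : ℝ} (h : X ≤ Y) (s : ℂ) : cond X s ≤ cond Y s := by
  unfold cond
  gcongr

lemma cond_le_two_mul {X : ℝ} (hX : 0 ≤ X) {s w : ℂ} (h : |w.im| ≤ 2 * |s.im| + 2) :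
    cond X w ≤ 2 * cond X s := by
  unfold cond
  rw [mul_left_comm]
  gcongr
  linarith

lemma abs_im_le_of_mem_ball {s w : ℂ} {θ : ℝ} (hw : w ∈ Metric.ball s θ) :
    |w.im| ≤ |s.im| + θ := by
  have h1 : |(w - s).im| ≤ ‖w - s‖ := Complex.abs_im_le_norm _
  rw [Metric.mem_ball, dist_eq_norm] at hw
  rw [sub_im] at h1
  have := abs_sub_abs_le_abs_sub w.im s.im
  linarith

lemma abs_re_sub_le_of_mem_ball {s w : ℂ} {θ : ℝ} (hw : w ∈ Metric.ball s θ) :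
    |w.re - s.re| ≤ θ := by
  have h1 : |(w - s).re| ≤ ‖w - s‖ := Complex.abs_re_le_norm _
  rw [Metric.mem_ball, dist_eq_norm] at hw
  rw [sub_re] at h1
  linarith

lemma cond_rpow_le {q : ℕ} [NeZero q] {X : ℝ} (hX : q ≤ X) {θ : ℝ} (hθ : 0 < θ)
    (hθ2 : θ ≤ 1 / 2) {s w : ℂ} (h : |w.im| ≤ 2 * |s.im| + 2) :
    cond q w ^ (2 * θ) ≤ 2 * cond X s ^ (2 * θ) := by
  have hX0 : 0 ≤ X := (Nat.cast_nonneg q).trans hX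
  have h0 := one_le_cond (q := q) s
  have h1 := one_le_cond (q := q) w
  exact rpow_two_mul_le (by linarith [cond_mono hX s]) (by linarith)
    ((cond_mono hX w).trans (cond_le_two_mul hX0 h)) hθ hθ2

lemma norm_LFunction_le_ball {q : ℕ} [NeZero q] {χ : DirichletCharacter ℂ q} (hχ : χ ≠ 1)
    {X : ℝ} (hX : q ≤ X) {θ : ℝ} (hθ : 0 < θ) (hθ2 : θ ≤ 1 / 2) {s : ℂ} (hs : 1 ≤ s.re)
    (hs3 : s.re ≤ 5 / 2) {w : ℂ} (hw : w ∈ Metric.ball s θ) :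
    ‖χ.LFunction w‖ ≤ 2 * (42 + 2 / θ) * cond X s ^ (2 * θ) := by
  have h1 := abs_im_le_of_mem_ball hw
  have h2 := abs_le.1 (abs_re_sub_le_of_mem_ball hw)
  have h3 := cond_rpow_le hX hθ hθ2 (s := s) (w := w) (by linarith [abs_nonneg s.im])
  refine (norm_LFunction_le hχ hθ hθ2 (s := w) (by linarith) (by linarith)).trans ?_
  calc _ ≤ (42 + 2 / θ) * (2 * cond X s ^ (2 * θ)) := by gcongr
    _ = _ := by ring

lemma norm_LFunctionTrivChar_le {q : ℕ} [NeZero q] {X : ℝ} (hX : q ≤ X) {θ : ℝ} (hθ : 0 < θ)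
    (hθ2 : θ ≤ 1 / 2) {s w : ℂ} (hw1 : w ≠ 1) (hw : 1 - θ ≤ w.re) (hw3 : w.re ≤ 3)
    (h : |w.im| ≤ 2 * |s.im| + 2) :
    ‖DirichletCharacter.LFunctionTrivChar q w‖ ≤
      2 * (44 + 2 / θ) * (1 + 1 / ‖w - 1‖) * cond X s ^ (2 * θ) := by
  have h3 := cond_rpow_le hX hθ hθ2 h
  have h4 := norm_LFunctionTrivChar₁_le (q := q) hθ hθ2 hw hw3
  rw [DirichletCharacter.LFunctionTrivChar₁, Function.update_of_ne hw1, norm_mul] at h4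
  have h5 : 0 < ‖w - 1‖ := norm_pos_iff.2 (sub_ne_zero.2 hw1)
  rw [← le_div_iff₀' h5] at h4
  refine h4.trans ?_
  rw [div_le_iff₀ h5]
  calc (44 + 2 / θ) * (‖w - 1‖ + 1) * cond q w ^ (2 * θ) ≤
      (44 + 2 / θ) * (‖w - 1‖ + 1) * (2 * cond X s ^ (2 * θ)) := by gcongr
    _ = _ := by field_simp

/-- The `3-4-1` inequality, combined with bounds for the derivative. -/
lemma norm_LFunction_ge_of_bounds {θ a : ℝ} (hθ : 0 < θ) (hθ2 : θ ≤ 1 / 2) (ha : 0 ≤ a) {c₁ : ℝ}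
    (hc₁ : 0 < c₁) : ∃ c : ℝ, 0 < c ∧ ∀ {q : ℕ} [NeZero q] (χ : DirichletCharacter ℂ q) {X : ℝ}
      (_ : q ≤ X) {x t : ℝ} (_ : 0 < x) (_ : x ≤ 1)
      (_ : DifferentiableOn ℂ χ.LFunction (Metric.ball (1 + x + I * t : ℂ) θ))
      (_ : ∀ w ∈ Metric.ball (1 + x + I * t : ℂ) θ,
        ‖χ.LFunction w‖ ≤ c₁ * cond X (1 + x + I * t) ^ (2 * θ))
      (_ : ∀ y : ℝ, x ≤ y → y ≤ 3 / 2 →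
        ‖(χ ^ 2).LFunction (1 + y + 2 * I * t)‖ ≤ c₁ * cond X (1 + x + I * t) ^ a),
      c * cond X (1 + x + I * t) ^ (-(12 * θ + a)) ≤ ‖χ.LFunction (1 + x + I * t)‖ := by
  set K : ℝ := 3 * c₁ / θ with hK
  set C₂ : ℝ := 2 * (44 + 2 / θ) * 3 with hC₂
  have hK0 : 0 < K := by positivity
  have hC₂0 : 0 < C₂ := by positivity
  set d : ℝ := min (θ / 2) (1 / (17 * K ^ 4 * C₂ ^ 3 * c₁)) with hd
  have hd0 : 0 < d := by positivity
  refine ⟨K * d, by positivity, ?_⟩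
  intro q _ χ X hX x t hx hx1 hdiff hbd hbd2
  set s : ℂ := 1 + x + I * t with hs
  have hsim : s.im = t := by simp [hs]
  have hsre : s.re = 1 + x := by simp [hs]
  have hQ1 : 1 ≤ cond X s := (one_le_cond (q := q) s).trans (cond_mono hX s)
  have hQ0 : 0 < cond X s := by linarith
  set Q := cond X s with hQ
  by_contra! hcon
  set δ : ℝ := d * Q ^ (-(14 * θ + a)) with hδ
  have hδ0 : 0 < δ := by positivity
  have hδd : δ ≤ d := mul_le_of_le_one_right hd0.le (Real.rpow_le_one_of_one_le_of_nonpos hQ1 (by linarith))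
  have hδθ : δ < θ := by
    have : d ≤ θ / 2 := min_le_left _ _
    linarith
  have hm : K * d * Q ^ (-(12 * θ + a)) = K * Q ^ (2 * θ) * δ := by
    rw [hδ, show -(12 * θ + a) = 2 * θ + -(14 * θ + a) by ring, Real.rpow_add hQ0]
    ring
  have hmem : s + δ ∈ Metric.ball s θ := by
    rw [Metric.mem_ball, dist_eq_norm, add_sub_cancel_left, Complex.norm_real,
      Real.norm_of_nonneg hδ0.le]
    exact hδθ
  have hdiff2 := norm_sub_le_of_bounded_ball hdiff hbd (by positivity) hmem
  rw [add_sub_cancel_left, Complex.norm_real, Real.norm_of_nonneg hδ0.le] at hdiff2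
  have hL : ‖χ.LFunction (s + δ)‖ ≤ 2 * (K * Q ^ (2 * θ) * δ) := by
    have h1 : ‖χ.LFunction (s + δ)‖ ≤ ‖χ.LFunction (s + δ) - χ.LFunction s‖ + ‖χ.LFunction s‖ := by
      simpa using norm_add_le (χ.LFunction (s + δ) - χ.LFunction s) (χ.LFunction s)
    have h2 : 3 * (c₁ * Q ^ (2 * θ)) / θ * δ = K * Q ^ (2 * θ) * δ := by rw [hK]; ring
    linarith
  set y : ℝ := x + δ with hy
  have hy0 : 0 < y := by positivity
  have hδ12 : δ ≤ 1 / 2 := by linarith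
  have h341 := DirichletCharacter.norm_LFunction_product_ge_one χ hy0 t
  have e1 : (1 + (y : ℂ) + I * t) = s + δ := by rw [hs, hy]; push_cast; ring
  rw [e1, norm_mul, norm_mul, norm_pow, norm_pow] at h341
  have hb2 := hbd2 y (by linarith) (by linarith)
  have h0 : ‖DirichletCharacter.LFunctionTrivChar q (1 + y)‖ ≤ C₂ * Q ^ (2 * θ) / δ := by
    have h1 := norm_LFunctionTrivChar_le (s := s) (w := 1 + y) hX hθ hθ2
      (by simpa using hy0.ne') (by simp; linarith) (by simp; linarith)
      (by simp; positivity)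
    refine h1.trans ?_
    have h2 : ‖(1 + (y : ℂ)) - 1‖ = y := by
      rw [add_sub_cancel_left, Complex.norm_real, Real.norm_of_nonneg hy0.le]
    rw [h2]
    have h3 : 1 + 1 / y ≤ 3 / δ := by
      have h4 : 1 / y ≤ 1 / δ := one_div_le_one_div_of_le hδ0 (by linarith)
      have h5 : 1 ≤ 1 / δ := by rw [le_div_iff₀ hδ0]; linarith
      calc 1 + 1 / y ≤ 3 * (1 / δ) := by linarith
        _ = 3 / δ := by ring
    calc 2 * (44 + 2 / θ) * (1 + 1 / y) * Q ^ (2 * θ) ≤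
        2 * (44 + 2 / θ) * (3 / δ) * Q ^ (2 * θ) := by gcongr
      _ = _ := by rw [hC₂]; ring
  have hfin : (1 : ℝ) ≤ (C₂ * Q ^ (2 * θ) / δ) ^ 3 * (2 * (K * Q ^ (2 * θ) * δ)) ^ 4 *
      (c₁ * Q ^ a) := by
    refine h341.le.trans ?_
    gcongr
  have e2 : (C₂ * Q ^ (2 * θ) / δ) ^ 3 * (2 * (K * Q ^ (2 * θ) * δ)) ^ 4 * (c₁ * Q ^ a) =
      16 * K ^ 4 * C₂ ^ 3 * c₁ * ((Q ^ (2 * θ)) ^ 7 * Q ^ a * δ) := by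
    field_simp
    ring
  have e3 : (Q ^ (2 * θ)) ^ 7 * Q ^ a * δ = d := by
    rw [← Real.rpow_natCast, ← Real.rpow_mul hQ0.le, hδ, ← Real.rpow_add hQ0, mul_left_comm,
      ← Real.rpow_add hQ0, show 2 * θ * ((7 : ℕ) : ℝ) + a + -(14 * θ + a) = 0 by push_cast; ring]
    simp
  rw [e2, e3] at hfin
  have hd2 : d ≤ 1 / (17 * K ^ 4 * C₂ ^ 3 * c₁) := min_le_right _ _
  have hpos : 0 < K ^ 4 * C₂ ^ 3 * c₁ := by positivity
  rw [le_div_iff₀ (by positivity)] at hd2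
  nlinarith

lemma apply_eq_of_sq_eq_one {q : ℕ} {χ : DirichletCharacter ℂ q} (hχ : χ ^ 2 = 1) (a : ZMod q) :
    χ a = 0 ∨ χ a = 1 ∨ χ a = -1 := by
  by_cases ha : IsUnit a
  · right
    have : (χ a) ^ 2 = 1 := by
      rw [← MulChar.pow_apply' χ two_ne_zero, hχ, MulChar.one_apply ha]
    exact sq_eq_one_iff.1 this
  · left
    exact MulChar.map_nonunit χ ha

lemma norm_eulerFactors_le_one {x : ℝ} (hx0 : 0 ≤ x) (hx1 : x ≤ 1) {a b : ℂ}
    (ha : a = 0 ∨ a = 1 ∨ a = -1) (hb : b = 0 ∨ b = 1 ∨ b = -1) :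
    ‖(1 - 1 * (x : ℂ)) * (1 - a * x) * (1 - b * x) * (1 - a * b * x)‖ ≤ 1 := by
  have h1 : |1 - x| ≤ 1 := by rw [abs_le]; constructor <;> linarith
  have h2 : |1 - x ^ 2| ≤ 1 := by rw [abs_le]; constructor <;> nlinarith
  have key : ∀ y : ℝ, ‖(y : ℂ)‖ ≤ 1 ↔ |y| ≤ 1 :=
      fun y => by rw [Complex.norm_real, Real.norm_eq_abs]
  have h3 : |(1 - x) ^ 2| ≤ 1 := by rw [abs_pow]; exact pow_le_one₀ (abs_nonneg _) h1
  have h4 : |(1 - x) ^ 4| ≤ 1 := by rw [abs_pow]; exact pow_le_one₀ (abs_nonneg _) h1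
  have h5 : |(1 - x ^ 2) ^ 2| ≤ 1 := by rw [abs_pow]; exact pow_le_one₀ (abs_nonneg _) h2
  rcases ha with rfl | rfl | rfl <;> rcases hb with rfl | rfl | rfl
  · convert (key _).2 h1 using 2; push_cast; ring
  · convert (key _).2 h3 using 2; push_cast; ring
  · convert (key _).2 h2 using 2; push_cast; ring
  · convert (key _).2 h3 using 2; push_cast; ring
  · convert (key _).2 h4 using 2; push_cast; ring
  · convert (key _).2 h5 using 2; push_cast; ring
  · convert (key _).2 h2 using 2; push_cast; ring
  · convert (key _).2 h5 using 2; push_cast; ring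
  · convert (key _).2 h5 using 2; push_cast; ring

lemma one_le_norm_product {q₁ q₂ q₃ : ℕ} [NeZero q₁] [NeZero q₂] [NeZero q₃]
    {χ₁ : DirichletCharacter ℂ q₁}
    {χ₂ : DirichletCharacter ℂ q₂} {χ₃ : DirichletCharacter ℂ q₃} (h₁ : χ₁ ^ 2 = 1)
        (h₂ : χ₂ ^ 2 = 1)
    (h₃ : ∀ n : ℕ, χ₃ n = χ₁ n * χ₂ n) {σ : ℝ} (hσ : 1 < σ) :
    1 ≤ ‖DirichletCharacter.LFunctionTrivChar 1 σ * χ₁.LFunction σ * χ₂.LFunction σ *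
      χ₃.LFunction σ‖ := by
  have hσ' : 1 < (σ : ℂ).re := by simpa
  rw [DirichletCharacter.LFunctionTrivChar, DirichletCharacter.LFunction_eq_LSeries _ hσ',
    DirichletCharacter.LFunction_eq_LSeries _ hσ', DirichletCharacter.LFunction_eq_LSeries _ hσ',
    DirichletCharacter.LFunction_eq_LSeries _ hσ']
  have T := ((((DirichletCharacter.LSeries_eulerProduct (1 : DirichletCharacter ℂ 1) hσ').mul
    (DirichletCharacter.LSeries_eulerProduct χ₁ hσ')).mul
    (DirichletCharacter.LSeries_eulerProduct χ₂ hσ')).mul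
    (DirichletCharacter.LSeries_eulerProduct χ₃ hσ')).norm
  refine ge_of_tendsto' T fun n => ?_
  rw [← Finset.prod_mul_distrib, ← Finset.prod_mul_distrib, ← Finset.prod_mul_distrib, norm_prod]
  refine Finset.prod_induction _ (fun r : ℝ => 1 ≤ r)
    (fun _ _ h h' => one_le_mul_of_one_le_of_one_le h h')
    le_rfl fun p hp => ?_
  have hp : p.Prime := Nat.prime_of_mem_primesBelow hp
  rw [← mul_inv, ← mul_inv, ← mul_inv, norm_inv]
  have hp1 : (1 : ℝ) < p := by exact_mod_cast hp.one_lt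
  have hx1 : (p : ℝ) ^ (-σ) < 1 := Real.rpow_lt_one_of_one_lt_of_neg hp1 (by linarith)
  have hx0 : 0 < (p : ℝ) ^ (-σ) := by positivity
  have e : (p : ℂ) ^ (-(σ : ℂ)) = (((p : ℝ) ^ (-σ) : ℝ) : ℂ) := by
    rw [Complex.ofReal_cpow (by positivity)]; simp
  have e1 : (1 : DirichletCharacter ℂ 1) (p : ZMod 1) = 1 :=
    MulChar.one_apply (isUnit_of_subsingleton _)
  rw [h₃, e, e1]
  refine (one_le_inv₀ ?_).2 (norm_eulerFactors_le_one hx0.le hx1.le (apply_eq_of_sq_eq_one h₁ _)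
    (apply_eq_of_sq_eq_one h₂ _))
  have key : ∀ a : ℂ, ‖a‖ ≤ 1 → 1 - a * (((p : ℝ) ^ (-σ) : ℝ) : ℂ) ≠ 0 := by
    intro a ha h0
    have : ‖a * (((p : ℝ) ^ (-σ) : ℝ) : ℂ)‖ = 1 := by
      rw [← sub_eq_zero.1 h0, norm_one]
    rw [norm_mul, Complex.norm_real, Real.norm_of_nonneg hx0.le] at this
    nlinarith [norm_nonneg a]
  rw [norm_pos_iff]
  refine mul_ne_zero (mul_ne_zero (mul_ne_zero (key _ (by simp)) (key _ (χ₁.norm_le_one _)))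
    (key _ (χ₂.norm_le_one _))) ?_
  rw [← h₃]
  exact key _ (χ₃.norm_le_one _)

lemma exists_mul_char {q₁ q₂ : ℕ} [NeZero q₁] [NeZero q₂] {χ₁ : DirichletCharacter ℂ q₁}
    {χ₂ : DirichletCharacter ℂ q₂} (h₁ : χ₁ ^ 2 = 1) (h₂ : χ₂ ^ 2 = 1) (p₁ : χ₁.IsPrimitive)
    (p₂ : χ₂.IsPrimitive) (hne : ¬ (q₁ = q₂ ∧ HEq χ₁ χ₂)) :
    ∃ χ₃ : DirichletCharacter ℂ (q₁ * q₂), χ₃ ≠ 1 ∧ ∀ n : ℕ, χ₃ n = χ₁ n * χ₂ n := by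
  have d₁ : q₁ ∣ q₁ * q₂ := dvd_mul_right _ _
  have d₂ : q₂ ∣ q₁ * q₂ := dvd_mul_left _ _
  refine ⟨DirichletCharacter.changeLevel d₁ χ₁ * DirichletCharacter.changeLevel d₂ χ₂, ?_, ?_⟩
  · intro h
    have hinv : (DirichletCharacter.changeLevel d₂ χ₂) ^ 2 = 1 := by
      rw [← map_pow, h₂, map_one]
    have heq : DirichletCharacter.changeLevel d₁ χ₁ = DirichletCharacter.changeLevel d₂ χ₂ := by
      rw [sq] at hinv
      exact mul_right_cancel (h.trans hinv.symm)
    have c₁ := DirichletCharacter.conductor_changeLevel (χ := χ₁) d₁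
    have c₂ := DirichletCharacter.conductor_changeLevel (χ := χ₂) d₂
    rw [heq, c₂, p₁, p₂] at c₁
    subst c₁
    exact hne ⟨rfl, heq_of_eq (DirichletCharacter.changeLevel_injective d₁ heq)⟩
  · intro n
    rw [MulChar.mul_apply]
    by_cases hn : IsUnit (n : ZMod (q₁ * q₂))
    · obtain ⟨u, hu⟩ := hn
      rw [← hu, DirichletCharacter.changeLevel_eq_cast_of_dvd χ₁ d₁ u,
        DirichletCharacter.changeLevel_eq_cast_of_dvd χ₂ d₂ u, hu, ZMod.cast_natCast d₁,
        ZMod.cast_natCast d₂]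
    · rw [MulChar.map_nonunit _ hn, zero_mul]
      rw [ZMod.isUnit_iff_coprime, Nat.coprime_mul_iff_right, not_and_or] at hn
      rcases hn with hn | hn
      · rw [MulChar.map_nonunit χ₁ (by rwa [ZMod.isUnit_iff_coprime]), zero_mul]
      · rw [MulChar.map_nonunit χ₂ (by rwa [ZMod.isUnit_iff_coprime]), mul_zero]

/-- At most one real primitive character has a very small value at `1`. -/
lemma exists_repulsion {θ : ℝ} (hθ : 0 < θ) (hθ2 : θ ≤ 1 / 2) : ∃ c : ℝ, 0 < c ∧
    ∀ {q₁ q₂ : ℕ} [NeZero q₁] [NeZero q₂] {χ₁ : DirichletCharacter ℂ q₁}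
    {χ₂ : DirichletCharacter ℂ q₂} {X : ℝ}, q₁ ≤ X → q₂ ≤ X → χ₁ ≠ 1 → χ₂ ≠ 1 →
    χ₁ ^ 2 = 1 → χ₂ ^ 2 = 1 → χ₁.IsPrimitive → χ₂.IsPrimitive →
    ‖χ₁.LFunction 1‖ < c * cond X 1 ^ (-(8 * θ)) → ‖χ₂.LFunction 1‖ < c * cond X 1 ^ (-(8 * θ)) →
    q₁ = q₂ ∧ HEq χ₁ χ₂ := by
  set C : ℝ := 6 * (44 + 2 / θ) with hC
  have hC0 : 0 < C := by positivity
  set K : ℝ := 3 * C / θ with hK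
  have hK0 : 0 < K := by positivity
  set d : ℝ := min (θ / 2) (1 / (5 * K ^ 2 * C ^ 2)) with hd
  have hd0 : 0 < d := by positivity
  refine ⟨K * d, by positivity, ?_⟩
  intro q₁ q₂ _ _ χ₁ χ₂ X hq₁ hq₂ hne₁ hne₂ h₁ h₂ p₁ p₂ hL₁ hL₂
  by_contra hne
  obtain ⟨χ₃, hne₃, h₃⟩ := exists_mul_char h₁ h₂ p₁ p₂ hne
  have hQ1 : 1 ≤ cond X 1 := (one_le_cond (q := q₁) 1).trans (cond_mono hq₁ 1)
  have hX1 : 1 ≤ X := by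
    have : (1 : ℝ) ≤ q₁ := by exact_mod_cast Nat.pos_of_ne_zero (NeZero.ne q₁)
    linarith
  have hQX : cond X 1 = 2 * X := by simp [cond]; ring
  set Q := cond X 1 with hQ
  have hQ0 : 0 < Q := by linarith
  set δ : ℝ := d * Q ^ (-(10 * θ)) with hδ
  have hδ0 : 0 < δ := by positivity
  have hδd : δ ≤ d :=
    mul_le_of_le_one_right hd0.le (Real.rpow_le_one_of_one_le_of_nonpos hQ1 (by linarith))
  have hδθ : δ < θ := by
    have : d ≤ θ / 2 := min_le_left _ _
    linarith
  have hm : K * d * Q ^ (-(8 * θ)) = K * Q ^ (2 * θ) * δ := by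
    rw [hδ, show -(8 * θ) = 2 * θ + -(10 * θ) by ring, Real.rpow_add hQ0]
    ring
  rw [hm] at hL₁ hL₂
  have hmem : (1 : ℂ) + δ ∈ Metric.ball (1 : ℂ) θ := by
    rw [Metric.mem_ball, dist_eq_norm, add_sub_cancel_left, Complex.norm_real,
      Real.norm_of_nonneg hδ0.le]
    exact hδθ
  have small : ∀ {q : ℕ} [NeZero q] {χ : DirichletCharacter ℂ q}, q ≤ X → χ ≠ 1 →
      ‖χ.LFunction 1‖ < K * Q ^ (2 * θ) * δ → ‖χ.LFunction (1 + δ)‖ ≤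
          2 * (K * Q ^ (2 * θ) * δ) := by
    intro q _ χ hq hχ hL
    have h1 := norm_sub_le_of_bounded_ball (f := χ.LFunction) (c := 1) (z := 1 + δ) (ρ := θ)
      (M := C * Q ^ (2 * θ))
      (DirichletCharacter.differentiable_LFunction hχ).differentiableOn (fun w hw => ?_)
      (by positivity) hmem
    · rw [add_sub_cancel_left, Complex.norm_real, Real.norm_of_nonneg hδ0.le] at h1
      have h2 : ‖χ.LFunction (1 + δ)‖ ≤
          ‖χ.LFunction (1 + δ) - χ.LFunction 1‖ + ‖χ.LFunction 1‖ := by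
        simpa using norm_add_le (χ.LFunction (1 + δ) - χ.LFunction 1) (χ.LFunction 1)
      have h3 : 3 * (C * Q ^ (2 * θ)) / θ * δ = K * Q ^ (2 * θ) * δ := by rw [hK]; ring
      linarith
    · refine (norm_LFunction_le_ball hχ hq hθ hθ2 (s := 1) (by simp) (by norm_num) hw).trans ?_
      have : 0 < 2 / θ := by positivity
      gcongr
      rw [hC]
      linarith
  have b₁ := small hq₁ hne₁ hL₁
  have b₂ := small hq₂ hne₂ hL₂
  have hδ12 : δ ≤ 1 / 2 := by linarith
  have b₃ : ‖χ₃.LFunction (1 + δ)‖ ≤ C * Q ^ (4 * θ) := by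
    have h1 := norm_LFunction_le hne₃ hθ hθ2 (s := 1 + δ) (by simp; linarith) (by simp; linarith)
    refine h1.trans ?_
    have h2 : cond ((q₁ * q₂ : ℕ) : ℝ) (1 + δ) ≤ Q ^ 2 := by
      rw [hQX]
      simp only [cond, add_im, one_im, ofReal_im, add_zero, abs_zero, zero_add]
      push_cast
      have : (q₁ : ℝ) * q₂ ≤ X * X := by gcongr
      nlinarith
    have h3 : cond ((q₁ * q₂ : ℕ) : ℝ) (1 + δ) ^ (2 * θ) ≤ Q ^ (4 * θ) := by
      calc _ ≤ (Q ^ 2) ^ (2 * θ) := by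
            gcongr
            exact zero_le_one.trans (one_le_cond _)
        _ = Q ^ (4 * θ) := by
          rw [← Real.rpow_natCast, ← Real.rpow_mul hQ0.le]; congr 1; push_cast; ring
    have : 0 < 2 / θ := by positivity
    have hcond := (zero_le_one' ℝ).trans (one_le_cond (q := q₁ * q₂) (1 + δ))
    refine mul_le_mul ?_ h3 (by positivity) hC0.le
    rw [hC]
    linarith
  have b₀ : ‖DirichletCharacter.LFunctionTrivChar 1 (1 + δ)‖ ≤ C * Q ^ (2 * θ) / δ := by
    have h1 := norm_LFunctionTrivChar_le (q := 1) (X := X) (s := 1) (w := 1 + δ)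
      (by simpa using hX1) hθ hθ2
      (by simpa using hδ0.ne') (by simp; linarith) (by simp; linarith)
      (by simp)
    refine h1.trans ?_
    have h2 : ‖(1 + (δ : ℂ)) - 1‖ = δ := by
      rw [add_sub_cancel_left, Complex.norm_real, Real.norm_of_nonneg hδ0.le]
    rw [h2]
    have h3 : 1 + 1 / δ ≤ 3 / δ := by
      have h5 : 1 ≤ 1 / δ := by rw [le_div_iff₀ hδ0]; linarith
      calc 1 + 1 / δ ≤ 3 * (1 / δ) := by linarith
        _ = 3 / δ := by ring
    calc 2 * (44 + 2 / θ) * (1 + 1 / δ) * Q ^ (2 * θ) ≤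
        2 * (44 + 2 / θ) * (3 / δ) * Q ^ (2 * θ) := by gcongr
      _ = _ := by rw [hC]; ring
  have hprod := one_le_norm_product h₁ h₂ h₃ (σ := 1 + δ) (by linarith)
  push_cast at hprod
  rw [norm_mul, norm_mul, norm_mul] at hprod
  have hfin : (1 : ℝ) ≤ (C * Q ^ (2 * θ) / δ) * (2 * (K * Q ^ (2 * θ) * δ)) *
      (2 * (K * Q ^ (2 * θ) * δ)) * (C * Q ^ (4 * θ)) := by
    refine hprod.trans ?_
    gcongr
  have e2 : (C * Q ^ (2 * θ) / δ) * (2 * (K * Q ^ (2 * θ) * δ)) *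
      (2 * (K * Q ^ (2 * θ) * δ)) * (C * Q ^ (4 * θ)) =
      4 * K ^ 2 * C ^ 2 * ((Q ^ (2 * θ)) ^ 3 * Q ^ (4 * θ) * δ) := by
    field_simp
    ring
  have e3 : (Q ^ (2 * θ)) ^ 3 * Q ^ (4 * θ) * δ = d := by
    rw [← Real.rpow_natCast, ← Real.rpow_mul hQ0.le, hδ, ← Real.rpow_add hQ0, mul_left_comm,
      ← Real.rpow_add hQ0, show 2 * θ * ((3 : ℕ) : ℝ) + 4 * θ + -(10 * θ) = 0 by push_cast; ring]
    simp
  rw [e2, e3] at hfin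
  have hd2 : d ≤ 1 / (5 * K ^ 2 * C ^ 2) := min_le_right _ _
  have hpos : 0 < K ^ 2 * C ^ 2 := by positivity
  rw [le_div_iff₀ (by positivity)] at hd2
  nlinarith

lemma norm_LFunction_sq_le {θ : ℝ} (hθ : 0 < θ) (hθ2 : θ ≤ 1 / 2) {q : ℕ} [NeZero q]
    {χ : DirichletCharacter ℂ q} {X : ℝ} (hX : q ≤ X) {x t e : ℝ} (hx : 0 < x) (he : 0 < e)
    (he1 : e ≤ 1)
    (h : χ ^ 2 = 1 → e ≤ max x (2 * |t|)) (y : ℝ) (hxy : x ≤ y) (hy : y ≤ 3 / 2) :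
    ‖(χ ^ 2).LFunction (1 + y + 2 * I * t)‖ ≤
      2 * (44 + 2 / θ) * (2 / e) * cond X (1 + x + I * t) ^ (2 * θ) := by
  have h2θ : 0 < 2 / θ := by positivity
  have h1e : 1 ≤ 1 / e := by rw [le_div_iff₀ he]; linarith
  have hcond : cond q (1 + y + 2 * I * t) ^ (2 * θ) ≤ 2 * cond X (1 + x + I * t) ^ (2 * θ) := by
    refine cond_rpow_le hX hθ hθ2 ?_
    simp [abs_mul]
  have hQ1 : 1 ≤ cond X (1 + x + I * t) := (one_le_cond (q := q) _).trans (cond_mono hX _)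
  by_cases hχ : χ ^ 2 = 1
  · rw [hχ]
    have hne : (1 + y + 2 * I * t : ℂ) ≠ 1 := fun h => by
      have := congrArg Complex.re h
      simp at this
      linarith
    refine (norm_LFunctionTrivChar_le (s := 1 + x + I * t) hX hθ hθ2 hne (by simp; linarith)
      (by simp; linarith) (by simp [abs_mul])).trans ?_
    have h3 : e ≤ ‖(1 + y + 2 * I * t : ℂ) - 1‖ := by
      refine (h hχ).trans (max_le ?_ ?_)
      · have := Complex.abs_re_le_norm ((1 + y + 2 * I * t : ℂ) - 1)
        simp at this
        exact (hxy.trans (le_abs_self y)).trans (by simpa using this)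
      · have := Complex.abs_im_le_norm ((1 + y + 2 * I * t : ℂ) - 1)
        simp [abs_mul] at this
        simpa using this
    have h4 : 1 / ‖(1 + y + 2 * I * t : ℂ) - 1‖ ≤ 1 / e := one_div_le_one_div_of_le he h3
    gcongr
    calc _ ≤ 1 / e + 1 / e := by linarith
      _ = 2 / e := by ring
  · refine (norm_LFunction_le hχ hθ hθ2 (by simp; linarith) (by simp; linarith)).trans ?_
    calc (42 + 2 / θ) * cond q (1 + y + 2 * I * t) ^ (2 * θ) ≤
        (44 + 2 / θ) * (2 * cond X (1 + x + I * t) ^ (2 * θ)) := by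
          have := zero_le_one.trans (one_le_cond (q := q) (1 + y + 2 * I * t))
          exact mul_le_mul (by linarith) hcond (by positivity) (by positivity)
      _ = 2 * (44 + 2 / θ) * 1 * cond X (1 + x + I * t) ^ (2 * θ) := by ring
      _ ≤ _ := by
        gcongr
        calc (1 : ℝ) ≤ 2 * (1 / e) := by linarith
          _ = 2 / e := by ring

lemma exists_norm_LFunction_ge {θ : ℝ} (hθ : 0 < θ) (hθ2 : θ ≤ 1 / 2) {c₀ : ℝ} (hc₀ : 0 < c₀) :
    ∃ c : ℝ, 0 < c ∧ ∀ {q : ℕ} [NeZero q] {χ : DirichletCharacter ℂ q} {X : ℝ}, q ≤ X → χ ≠ 1 →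
      ¬ (χ ^ 2 = 1 ∧ ‖χ.LFunction 1‖ < c₀ * cond X 1 ^ (-(8 * θ))) →
      ∀ {x t : ℝ}, 0 < x → x ≤ 1 →
        c * cond X (1 + x + I * t) ^ (-(24 * θ)) ≤ ‖χ.LFunction (1 + x + I * t)‖ := by
  set C : ℝ := 2 * (44 + 2 / θ) with hC
  have hC0 : 0 < C := by positivity
  set K : ℝ := 3 * C / θ with hK
  have hK0 : 0 < K := by positivity
  set c₃ : ℝ := min (c₀ / (2 * K)) θ with hc₃
  have hc₃0 : 0 < c₃ := by positivity
  have hc₃1 : c₃ ≤ θ := min_le_right _ _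
  have h2θ : 0 < 2 / θ := by positivity
  obtain ⟨c, hc, H⟩ := norm_LFunction_ge_of_bounds (θ := θ) (a := 12 * θ) hθ hθ2 (by positivity)
    (c₁ := C * (4 / c₃)) (by positivity)
  refine ⟨min c (c₀ / 2), by positivity, ?_⟩
  intro q _ χ X hX hχ hbad x t hx hx1
  set s : ℂ := 1 + x + I * t with hs
  have hsim : s.im = t := by simp [hs]
  have hsre : s.re = 1 + x := by simp [hs]
  have hX0 : 0 ≤ X := (Nat.cast_nonneg q).trans hX
  have hQ1 : 1 ≤ cond X s := (one_le_cond (q := q) s).trans (cond_mono hX s)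
  have hQ0 : 0 < cond X s := by linarith
  have hcond1 : cond X 1 ≤ cond X s := by
    simp only [cond, one_im, abs_zero, zero_add]
    gcongr
    linarith [abs_nonneg s.im]
  have hcond1' : 1 ≤ cond X 1 := (one_le_cond (q := q) 1).trans (cond_mono hX 1)
  set Q := cond X s with hQ
  by_cases hsmall : χ ^ 2 = 1 ∧ ‖s - 1‖ < c₃ * Q ^ (-(10 * θ))
  · obtain ⟨hχ2, hss⟩ := hsmall
    have hL1 : c₀ * cond X 1 ^ (-(8 * θ)) ≤ ‖χ.LFunction 1‖ := by
      by_contra! h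
      exact hbad ⟨hχ2, h⟩
    have hss' : ‖s - 1‖ < θ := by
      refine hss.trans_le ((mul_le_of_le_one_right hc₃0.le ?_).trans hc₃1)
      exact Real.rpow_le_one_of_one_le_of_nonpos hQ1 (by linarith)
    have h1 := norm_sub_le_of_bounded_ball (f := χ.LFunction) (c := 1) (z := s) (ρ := θ)
      (M := C * Q ^ (2 * θ))
      (DirichletCharacter.differentiable_LFunction hχ).differentiableOn (fun w hw => ?_)
      (by positivity) (by rwa [Metric.mem_ball, dist_eq_norm])
    swap
    · refine (norm_LFunction_le_ball hχ hX hθ hθ2 (s := 1) (by simp) (by norm_num) hw).trans ?_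
      have : cond X 1 ^ (2 * θ) ≤ Q ^ (2 * θ) := by gcongr
      refine mul_le_mul ?_ this (by positivity) hC0.le
      rw [hC]
      linarith
    have h2 : c₀ * Q ^ (-(8 * θ)) ≤ ‖χ.LFunction 1‖ := by
      refine le_trans ?_ hL1
      gcongr ?_ * ?_
      exact Real.rpow_le_rpow_of_nonpos (by linarith) hcond1 (by linarith)
    have h3 : ‖χ.LFunction 1‖ ≤ ‖χ.LFunction s - χ.LFunction 1‖ + ‖χ.LFunction s‖ := by
      rw [norm_sub_rev]
      simpa using norm_add_le (χ.LFunction 1 - χ.LFunction s) (χ.LFunction s)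
    have h4 : 3 * (C * Q ^ (2 * θ)) / θ * ‖s - 1‖ ≤ c₀ / 2 * Q ^ (-(8 * θ)) := by
      calc 3 * (C * Q ^ (2 * θ)) / θ * ‖s - 1‖ ≤
          3 * (C * Q ^ (2 * θ)) / θ * (c₃ * Q ^ (-(10 * θ))) := by gcongr
        _ = K * c₃ * Q ^ (-(8 * θ)) := by
          rw [show -(8 * θ) = 2 * θ + -(10 * θ) by ring, Real.rpow_add hQ0, hK]; ring
        _ ≤ c₀ / 2 * Q ^ (-(8 * θ)) := by
          gcongr
          have : c₃ ≤ c₀ / (2 * K) := min_le_left _ _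
          rw [le_div_iff₀ (by positivity)] at this
          linarith
    calc min c (c₀ / 2) * Q ^ (-(24 * θ)) ≤ c₀ / 2 * Q ^ (-(8 * θ)) := by
          gcongr
          · exact min_le_right _ _
          · norm_num
      _ ≤ _ := by linarith
  · have he1 : c₃ / 2 * Q ^ (-(10 * θ)) ≤ 1 := by
      have : Q ^ (-(10 * θ)) ≤ 1 := Real.rpow_le_one_of_one_le_of_nonpos hQ1 (by linarith)
      have h5 : c₃ / 2 ≤ 1 := by linarith
      exact mul_le_one₀ h5 (by positivity) this
    have hbd2 := norm_LFunction_sq_le (χ := χ) (t := t) (x := x)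
      (e := c₃ / 2 * Q ^ (-(10 * θ))) hθ hθ2 hX hx (by positivity) he1 ?_
    swap
    · intro hχ2
      have h5 : c₃ * Q ^ (-(10 * θ)) ≤ ‖s - 1‖ := by
        by_contra! h
        exact hsmall ⟨hχ2, h⟩
      have h6 : ‖s - 1‖ ≤ x + |t| := by
        have := Complex.norm_le_abs_re_add_abs_im (s - 1)
        simpa [hsre, hsim, abs_of_pos hx] using this
      rcases le_total x |t| with h7 | h7
      · refine le_trans ?_ (le_max_right _ _)
        linarith
      · refine le_trans ?_ (le_max_left _ _)
        linarith
    have := H χ hX hx hx1 (t := t) (DirichletCharacter.differentiable_LFunction hχ).differentiableOn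
      (fun w hw => ?_) (fun y hxy hy => ?_)
    · rw [show -(12 * θ + 12 * θ) = -(24 * θ) by ring] at this
      refine le_trans ?_ this
      gcongr
      exact min_le_left _ _
    · refine (norm_LFunction_le_ball hχ hX hθ hθ2 (s := s) (by rw [hsre]; linarith)
        (by rw [hsre]; linarith) hw).trans ?_
      have h4c : 1 ≤ 4 / c₃ := by
        rw [le_div_iff₀ hc₃0]; linarith
      refine mul_le_mul_of_nonneg_right ?_ (by positivity)
      calc 2 * (42 + 2 / θ) ≤ C * 1 := by rw [hC]; linarith
        _ ≤ _ := mul_le_mul_of_nonneg_left h4c hC0.le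
    · refine (hbd2 y hxy hy).trans (le_of_eq ?_)
      rw [← hs, ← hQ, ← hC, show 12 * θ = 2 * θ + 10 * θ by ring, Real.rpow_add hQ0,
        Real.rpow_neg hQ0.le]
      have : Q ^ (10 * θ) ≠ 0 := by positivity
      field_simp
      ring

lemma exists_norm_zeta_ge {θ : ℝ} (hθ : 0 < θ) (hθ2 : θ ≤ 1 / 2) :
    ∃ c : ℝ, 0 < c ∧ ∀ {x t : ℝ}, 0 < x → x ≤ 1 → 1 ≤ |t| →
        c * cond 1 (1 + x + I * t) ^ (-(14 * θ)) ≤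
          ‖DirichletCharacter.LFunctionTrivChar 1 (1 + x + I * t)‖ := by
  set C : ℝ := 2 * (44 + 2 / θ) with hC
  have hC0 : 0 < C := by positivity
  obtain ⟨c, hc, H⟩ := norm_LFunction_ge_of_bounds (θ := θ) (a := 2 * θ) hθ hθ2 (by positivity)
    (c₁ := C * 3) (by positivity)
  refine ⟨c, hc, ?_⟩
  intro x t hx hx1 ht
  set s : ℂ := 1 + x + I * t with hs
  have hsim : s.im = t := by simp [hs]
  have hsre : s.re = 1 + x := by simp [hs]
  have hQ0 : 0 ≤ cond 1 s := zero_le_one.trans (by simpa using one_le_cond (q := 1) s)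
  have hfar : ∀ w ∈ Metric.ball s θ, 1 / 2 ≤ ‖w - 1‖ := by
    intro w hw
    have h1 := Complex.abs_im_le_norm (w - 1)
    have h2 := Complex.abs_im_le_norm (w - s)
    have h3 : ‖w - s‖ < θ := by rwa [← dist_eq_norm]
    have h4 := abs_sub_abs_le_abs_sub t w.im
    rw [Complex.sub_im, hsim, abs_sub_comm] at h2
    simp at h1
    linarith
  have hfar1 : ∀ w ∈ Metric.ball s θ, w ≠ 1 := by
    intro w hw h
    have := hfar w hw
    rw [h] at this
    norm_num at this
  have := H (1 : DirichletCharacter ℂ 1) (X := 1) (by simp) hx hx1 (t := t) ?_ (fun w hw => ?_)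
      (fun y hxy hy => ?_)
  · rwa [show -(12 * θ + 2 * θ) = -(14 * θ) by ring] at this
  · intro w hw
    exact (DirichletCharacter.differentiableAt_LFunction _ _
      (Or.inl (hfar1 w hw))).differentiableWithinAt
  · have h1 := abs_im_le_of_mem_ball hw
    have h2 := abs_le.1 (abs_re_sub_le_of_mem_ball hw)
    refine (norm_LFunctionTrivChar_le (q := 1) (X := 1) (s := s) (by simp) hθ hθ2
      (hfar1 w hw) (by rw [hsre] at h2; linarith) (by rw [hsre] at h2; linarith)
      (by rw [← hs] at h1; linarith [abs_nonneg s.im])).trans ?_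
    refine mul_le_mul_of_nonneg_right (mul_le_mul_of_nonneg_left ?_ hC0.le)
      (Real.rpow_nonneg hQ0 _)
    have := one_div_le_one_div_of_le (by norm_num) (hfar w hw)
    norm_num at this ⊢
    linarith
  · refine (norm_LFunction_sq_le (χ := (1 : DirichletCharacter ℂ 1)) (t := t) (x := x)
      (e := 1) hθ hθ2 (X := 1) (by simp) hx (by positivity) le_rfl (fun _ => ?_) y hxy hy).trans ?_
    · refine le_trans ?_ (le_max_right _ _)
      linarith
    · refine mul_le_mul_of_nonneg_right (mul_le_mul_of_nonneg_left ?_ hC0.le)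
        (Real.rpow_nonneg hQ0 _)
      norm_num

lemma norm_iteratedDeriv_logDeriv_le {f : ℂ → ℂ} {s : ℂ} {ρ M m : ℝ} (hρ : 0 < ρ)
    (hf : DifferentiableOn ℂ f (Metric.ball s ρ)) (hM : ∀ w ∈ Metric.ball s ρ, ‖f w‖ ≤ M)
    (hm : 0 < m) (hms : m ≤ ‖f s‖) (k : ℕ) :
    ‖iteratedDeriv k (fun z => deriv f z / f z) s‖ ≤
      k.factorial * (12 * M / (ρ * m)) ^ (k + 1) := by
  have hmM : m ≤ M := hms.trans (hM s (Metric.mem_ball_self hρ))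
  have hM0 : 0 < M := by linarith
  set r : ℝ := ρ * m / (12 * M) with hr
  have hr0 : 0 < r := by positivity
  have hrρ : r ≤ ρ / 12 := by
    rw [hr, div_le_div_iff₀ (by positivity) (by positivity)]
    nlinarith
  have hsub : ∀ w ∈ Metric.closedBall s r, w ∈ Metric.ball s ρ := fun w hw =>
    Metric.closedBall_subset_ball (by linarith) hw
  have hlow : ∀ w ∈ Metric.closedBall s r, 3 / 4 * m ≤ ‖f w‖ := by
    intro w hw
    have h1 := norm_sub_le_of_bounded_ball hf hM hM0 (hsub w hw)
    have h2 : ‖w - s‖ ≤ r := by rwa [Metric.mem_closedBall, dist_eq_norm] at hw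
    have h3 : 3 * M / ρ * ‖w - s‖ ≤ 3 * M / ρ * r := by gcongr
    have h4 : 3 * M / ρ * r = m / 4 := by rw [hr]; field_simp; ring
    have h5 : ‖f s‖ ≤ ‖f w - f s‖ + ‖f w‖ := by
      rw [norm_sub_rev]
      simpa using norm_add_le (f s - f w) (f w)
    linarith
  have hne : ∀ w ∈ Metric.closedBall s r, f w ≠ 0 := fun w hw h => by
    have := hlow w hw
    rw [h, norm_zero] at this
    linarith
  have hderiv : ∀ w ∈ Metric.closedBall s r, ‖deriv f w‖ ≤ M / (ρ / 2) := by
    intro w hw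
    have hsub2 : Metric.closedBall w (ρ / 2) ⊆ Metric.ball s ρ := by
      intro z hz
      rw [Metric.mem_closedBall] at hz hw
      rw [Metric.mem_ball]
      linarith [dist_triangle z w s]
    refine norm_deriv_le_of_forall_mem_sphere_norm_le (by positivity) ?_ fun z hz =>
      hM z (hsub2 (Metric.sphere_subset_closedBall hz))
    refine DifferentiableOn.diffContOnCl ?_
    rw [closure_ball _ (by positivity)]
    exact hf.mono hsub2
  have hdiff : DiffContOnCl ℂ (fun z => deriv f z / f z) (Metric.ball s r) := by
    refine DifferentiableOn.diffContOnCl ?_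
    rw [closure_ball _ hr0.ne']
    exact ((hf.deriv Metric.isOpen_ball).mono hsub).div (hf.mono hsub) hne
  have hbd : ∀ z ∈ Metric.sphere s r, ‖deriv f z / f z‖ ≤ 12 * M / (ρ * m) := by
    intro z hz
    have hz' := Metric.sphere_subset_closedBall hz
    rw [norm_div]
    calc ‖deriv f z‖ / ‖f z‖ ≤ M / (ρ / 2) / (3 / 4 * m) := by
          gcongr
          · exact hderiv z hz'
          · exact hlow z hz'
      _ = (8 / 3) * (M / (ρ * m)) := by field_simp; ring
      _ ≤ 12 * (M / (ρ * m)) := by gcongr; norm_num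
      _ = _ := by ring
  refine (norm_iteratedDeriv_le_of_forall_mem_sphere_norm_le k hr0 hdiff hbd).trans (le_of_eq ?_)
  have h12 : 12 * M / (ρ * m) = r⁻¹ := by rw [hr, inv_div]
  rw [h12, mul_div_assoc, pow_succ, div_eq_mul_inv, inv_pow]
  ring

lemma logMul_iterate_apply (f : ℕ → ℂ) (k n : ℕ) :
    LSeries.logMul^[k] f n = f n * (Real.log n : ℂ) ^ k := by
  induction k generalizing f with
  | zero => simp
  | succ k ih =>
    rw [Function.iterate_succ, Function.comp_apply, ih, LSeries.logMul, pow_succ, natCast_log]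
    ring

lemma norm_LSeries_mul_log_pow_eq {f : ℕ → ℂ} (hf : ∀ s : ℂ, 1 < s.re → LSeriesSummable f s)
    {F : ℂ → ℂ} (hF : ∀ s : ℂ, 1 < s.re → LSeries f s = F s) (k : ℕ) {s : ℂ} (hs : 1 < s.re) :
    ‖LSeries (fun n => f n * (Real.log n : ℂ) ^ k) s‖ = ‖iteratedDeriv k F s‖ := by
  have habs : LSeries.abscissaOfAbsConv f ≤ 1 := by
    refine LSeries.abscissaOfAbsConv_le_of_forall_lt_LSeriesSummable (x := 1) fun y hy => ?_
    exact hf y (by simpa using hy)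
  have h1 := LSeries_iteratedDeriv (f := f) k (s := s)
    (habs.trans_lt (by exact_mod_cast hs))
  have h2 : LSeries f =ᶠ[nhds s] F := by
    filter_upwards [(isOpen_lt continuous_const continuous_re).mem_nhds hs] with z hz
    exact hF z hz
  rw [← h2.iteratedDeriv_eq k, h1, norm_mul, norm_pow, norm_neg, norm_one, one_pow, one_mul]
  congr 1
  congr 1
  ext n
  exact (logMul_iterate_apply f k n).symm

lemma LSeries_twist_vonMangoldt_eq_LFunction {q : ℕ} [NeZero q] (χ : DirichletCharacter ℂ q)
    {s : ℂ} (hs : 1 < s.re) :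
    LSeries (fun n => χ n * (ArithmeticFunction.vonMangoldt n : ℂ)) s =
      -(deriv χ.LFunction s / χ.LFunction s) := by
  have h := DirichletCharacter.LSeries_twist_vonMangoldt_eq χ hs
  rw [neg_div] at h
  rw [DirichletCharacter.deriv_LFunction_eq_deriv_LSeries χ hs,
    DirichletCharacter.LFunction_eq_LSeries χ hs]
  exact h

/-- Bounds for twisted prime Dirichlet series to the right of the edge, with at most one
exceptional primitive character. -/
lemma exists_LSeries_twist_le (k : ℕ) {η : ℝ} (hη : 0 < η) : ∃ C : ℝ, 0 < C ∧ ∀ X : ℝ,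
    ∃ b : Σ q : ℕ, DirichletCharacter ℂ q, ∀ {q : ℕ} [NeZero q] {χ : DirichletCharacter ℂ q},
    q ≤ X → χ.IsPrimitive → χ ≠ 1 → (⟨q, χ⟩ : Σ q : ℕ, DirichletCharacter ℂ q) ≠ b →
    ∀ {x t : ℝ}, 0 < x → x ≤ 1 →
      ‖LSeries (fun n => χ n * (ArithmeticFunction.vonMangoldt n : ℂ) * (Real.log n : ℂ) ^ k)
        (1 + x + I * t)‖ ≤ C * cond X (1 + x + I * t) ^ η := by
  set θ : ℝ := min (η / (26 * (k + 1))) (1 / 2) with hθd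
  have hθ : 0 < θ := by positivity
  have hθ2 : θ ≤ 1 / 2 := min_le_right _ _
  have h2θ : 0 < 2 / θ := by positivity
  have hθη : 26 * θ * (k + 1) ≤ η := by
    have : θ ≤ η / (26 * (k + 1)) := min_le_left _ _
    rw [le_div_iff₀ (by positivity)] at this
    linarith
  obtain ⟨c₀, hc₀, hrep⟩ := exists_repulsion hθ hθ2
  obtain ⟨c, hc, hlow⟩ := exists_norm_LFunction_ge hθ hθ2 hc₀
  refine ⟨k.factorial * (12 * (2 * (42 + 2 / θ)) / (θ * c)) ^ (k + 1), by positivity, fun X => ?_⟩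
  set Bad : (Σ q : ℕ, DirichletCharacter ℂ q) → Prop := fun p =>
    ∃ _ : NeZero p.1, p.1 ≤ X ∧ p.2 ≠ 1 ∧
    p.2.IsPrimitive ∧ p.2 ^ 2 = 1 ∧
    ‖p.2.LFunction 1‖ < c₀ * cond X 1 ^ (-(8 * θ)) with hBad
  have main : ∀ {q : ℕ} [NeZero q] {χ : DirichletCharacter ℂ q},
    q ≤ X → χ.IsPrimitive → χ ≠ 1 → ¬ Bad ⟨q, χ⟩ → ∀ {x t : ℝ}, 0 < x → x ≤ 1 →
      ‖LSeries (fun n => χ n * (ArithmeticFunction.vonMangoldt n : ℂ) * (Real.log n : ℂ) ^ k)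
        (1 + x + I * t)‖ ≤ k.factorial * (12 * (2 * (42 + 2 / θ)) / (θ * c)) ^ (k + 1) *
          cond X (1 + x + I * t) ^ η := by
    intro q _ χ hX hprim hχ hbad x t hx hx1
    set s : ℂ := 1 + x + I * t with hs
    have hsre : s.re = 1 + x := by simp [hs]
    have hQ1 : 1 ≤ cond X s := (one_le_cond (q := q) s).trans (cond_mono hX s)
    set Q := cond X s with hQ
    have hQ0 : 0 < Q := by linarith
    have h1 := hlow hX hχ (fun h => hbad ⟨inferInstance, hX, hχ, hprim, h⟩) hx hx1 (t := t)
    rw [← hs, ← hQ] at h1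
    rw [norm_LSeries_mul_log_pow_eq
      (f := fun n => χ n * (ArithmeticFunction.vonMangoldt n : ℂ))
      (fun s hs => DirichletCharacter.LSeriesSummable_twist_vonMangoldt χ hs)
      (fun s hs => LSeries_twist_vonMangoldt_eq_LFunction χ hs) k (by rw [hsre]; linarith)]
    have h2 : ‖iteratedDeriv k (fun s => -(deriv χ.LFunction s / χ.LFunction s)) s‖ =
        ‖iteratedDeriv k (fun s => deriv χ.LFunction s / χ.LFunction s) s‖ := by
      rw [show (fun s => -(deriv χ.LFunction s / χ.LFunction s)) =
        -(fun s => deriv χ.LFunction s / χ.LFunction s) from rfl, iteratedDeriv_neg, norm_neg]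
    rw [h2]
    refine (norm_iteratedDeriv_logDeriv_le hθ
      (DirichletCharacter.differentiable_LFunction hχ).differentiableOn
      (fun w hw => norm_LFunction_le_ball hχ hX hθ hθ2 (s := s) (by rw [hsre]; linarith)
        (by rw [hsre]; linarith) hw) (by positivity) h1 k).trans ?_
    rw [← hQ, show 12 * (2 * (42 + 2 / θ) * Q ^ (2 * θ)) / (θ * (c * Q ^ (-(24 * θ)))) =
      12 * (2 * (42 + 2 / θ)) / (θ * c) * Q ^ (26 * θ) by
        rw [show 26 * θ = 2 * θ + 24 * θ by ring, Real.rpow_add hQ0, Real.rpow_neg hQ0.le]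
        field_simp, mul_pow, ← Real.rpow_natCast (Q ^ (26 * θ)), ← Real.rpow_mul hQ0.le,
            ← mul_assoc]
    gcongr
    push_cast
    exact hθη
  by_cases hex : ∃ p, Bad p
  · obtain ⟨p, hp⟩ := hex
    refine ⟨p, fun {q} _ {χ} hX hprim hχ hne x t hx hx1 => main hX hprim hχ (fun hb => hne ?_)
      hx hx1⟩
    obtain ⟨q', χ'⟩ := p
    obtain ⟨_, hX', hχ', hprim', hsq', hL'⟩ := hp
    obtain ⟨_, _, _, _, hsq, hL⟩ := hb
    obtain ⟨rfl, h⟩ := hrep hX hX' hχ hχ' hsq hsq' hprim hprim' hL hL'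
    rw [eq_of_heq h]
  · push Not at hex
    exact ⟨⟨0, 1⟩, fun {q} _ {χ} hX hprim hχ _ x t hx hx1 => main hX hprim hχ (hex _) hx hx1⟩

/-- The analytic continuation of `-ζ'/ζ - ζ`. -/
noncomputable def zetaRegular (s : ℂ) : ℂ :=
  -(deriv (DirichletCharacter.LFunctionTrivChar₁ 1) s / DirichletCharacter.LFunctionTrivChar₁ 1 s) -
    dslope (DirichletCharacter.LFunctionTrivChar₁ 1) 1 s

lemma LFunctionTrivChar_one_eq : DirichletCharacter.LFunctionTrivChar 1 = riemannZeta :=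
  DirichletCharacter.LFunction_modOne_eq

lemma LFunctionTrivChar₁_one_apply {s : ℂ} (hs : s ≠ 1) :
    DirichletCharacter.LFunctionTrivChar₁ 1 s = (s - 1) * riemannZeta s := by
  rw [DirichletCharacter.LFunctionTrivChar₁, Function.update_of_ne hs,
    LFunctionTrivChar_one_eq]

lemma LFunctionTrivChar₁_one_one : DirichletCharacter.LFunctionTrivChar₁ 1 1 = 1 := by
  rw [DirichletCharacter.LFunctionTrivChar₁, Function.update_self]
  simp

lemma LFunctionTrivChar₁_one_ne_zero {s : ℂ} (hs : 1 ≤ s.re) :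
    DirichletCharacter.LFunctionTrivChar₁ 1 s ≠ 0 := by
  by_cases h : s = 1
  · rw [h, LFunctionTrivChar₁_one_one]
    exact one_ne_zero
  · rw [LFunctionTrivChar₁_one_apply h]
    exact mul_ne_zero (sub_ne_zero.2 h) (riemannZeta_ne_zero_of_one_le_re hs)

lemma zetaRegular_eq {s : ℂ} (hs : s ≠ 1) (hs0 : riemannZeta s ≠ 0) :
    zetaRegular s = -(deriv riemannZeta s / riemannZeta s) - riemannZeta s := by
  have hs1 : s - 1 ≠ 0 := sub_ne_zero.2 hs
  rw [zetaRegular, dslope_of_ne _ hs, slope_def_field, LFunctionTrivChar₁_one_one,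
    DirichletCharacter.deriv_LFunctionTrivChar₁_apply_of_ne_one 1 hs,
    LFunctionTrivChar₁_one_apply hs, LFunctionTrivChar_one_eq]
  field_simp
  ring

lemma differentiable_dslope_LFunctionTrivChar₁ :
    Differentiable ℂ (dslope (DirichletCharacter.LFunctionTrivChar₁ 1) 1) := by
  rw [← differentiableOn_univ, Complex.differentiableOn_dslope (by simp), differentiableOn_univ]
  exact DirichletCharacter.differentiable_LFunctionTrivChar₁ 1

lemma differentiableOn_zetaRegular :
    DifferentiableOn ℂ zetaRegular {s | DirichletCharacter.LFunctionTrivChar₁ 1 s ≠ 0} := by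
  have hZ := DirichletCharacter.differentiable_LFunctionTrivChar₁ 1
  have hZ' : Differentiable ℂ (deriv (DirichletCharacter.LFunctionTrivChar₁ 1)) := by
    rw [← differentiableOn_univ]
    exact hZ.differentiableOn.deriv isOpen_univ
  exact ((hZ'.differentiableOn.div hZ.differentiableOn fun s hs => hs).neg).sub
    differentiable_dslope_LFunctionTrivChar₁.differentiableOn

lemma exists_iteratedDeriv_zetaRegular_le_compact (k : ℕ) : ∃ C : ℝ, 0 < C ∧ ∀ {x t : ℝ}, 0 < x →
    x ≤ 1 → |t| ≤ 1 → ‖iteratedDeriv k zetaRegular (1 + x + I * t)‖ ≤ C := by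
  have hopen : IsOpen {s | DirichletCharacter.LFunctionTrivChar₁ 1 s ≠ 0} :=
    isOpen_ne_fun (DirichletCharacter.differentiable_LFunctionTrivChar₁ 1).continuous
      continuous_const
  have hcont : ContinuousOn (iteratedDeriv k zetaRegular)
      {s | DirichletCharacter.LFunctionTrivChar₁ 1 s ≠ 0} := by
    have h : ∀ k : ℕ, DifferentiableOn ℂ (iteratedDeriv k zetaRegular)
        {s | DirichletCharacter.LFunctionTrivChar₁ 1 s ≠ 0} := by
      intro k
      induction k with
      | zero => simpa using differentiableOn_zetaRegular
      | succ k ih =>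
        rw [iteratedDeriv_succ]
        exact ih.deriv hopen
    exact (h k).continuousOn
  have hcomp : IsCompact (Icc (1 : ℝ) 2 ×ℂ Icc (-1 : ℝ) 1) :=
    isCompact_Icc.reProdIm isCompact_Icc
  obtain ⟨C, hC⟩ := hcomp.exists_bound_of_continuousOn (hcont.mono fun s hs =>
    LFunctionTrivChar₁_one_ne_zero (mem_reProdIm.1 hs).1.1)
  refine ⟨max C 1, by positivity, fun {x t} hx hx1 ht => (hC _ ?_).trans (le_max_left _ _)⟩
  rw [mem_reProdIm]
  have := abs_le.1 ht
  constructor <;> constructor <;> simp <;> linarith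

lemma norm_zeta_le_ball {θ : ℝ} (hθ : 0 < θ) (hθ2 : θ ≤ 1 / 2) {x t : ℝ} (hx : 0 < x)
    (hx1 : x ≤ 1) (ht : 1 ≤ |t|) {w : ℂ} (hw : w ∈ Metric.ball (1 + x + I * t : ℂ) θ) :
    w ≠ 1 ∧ ‖riemannZeta w‖ ≤ 6 * (44 + 2 / θ) * cond 1 (1 + x + I * t) ^ (2 * θ) := by
  set s : ℂ := 1 + x + I * t with hs
  have hsim : s.im = t := by simp [hs]
  have hsre : s.re = 1 + x := by simp [hs]
  have hQ0 : 0 ≤ cond 1 s := zero_le_one.trans (by simpa using one_le_cond (q := 1) s)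
  have hfar : 1 / 2 ≤ ‖w - 1‖ := by
    have h1 := Complex.abs_im_le_norm (w - 1)
    have h2 := Complex.abs_im_le_norm (w - s)
    have h3 : ‖w - s‖ < θ := by rwa [← dist_eq_norm]
    have h4 := abs_sub_abs_le_abs_sub t w.im
    rw [Complex.sub_im, hsim, abs_sub_comm] at h2
    simp at h1
    linarith
  have hw1 : w ≠ 1 := by
    rintro rfl
    norm_num at hfar
  refine ⟨hw1, ?_⟩
  have h1 := abs_im_le_of_mem_ball hw
  have h2 := abs_le.1 (abs_re_sub_le_of_mem_ball hw)
  rw [hsre] at h2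
  rw [← LFunctionTrivChar_one_eq]
  refine (norm_LFunctionTrivChar_le (q := 1) (X := 1) (s := s) (by simp) hθ hθ2
    hw1 (by linarith) (by linarith) (by linarith [abs_nonneg s.im])).trans ?_
  refine mul_le_mul_of_nonneg_right ?_ (Real.rpow_nonneg hQ0 _)
  have := one_div_le_one_div_of_le (by norm_num) hfar
  norm_num at this ⊢
  have h2θ : 0 < 2 / θ := by positivity
  nlinarith

lemma norm_iteratedDeriv_zetaRegular_le (k : ℕ) {θ : ℝ} (hθ : 0 < θ) (hθ2 : θ ≤ 1 / 2) :
    ∃ C : ℝ, 0 < C ∧ ∀ {x t : ℝ}, 0 < x → x ≤ 1 → 1 ≤ |t| →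
      ‖iteratedDeriv k zetaRegular (1 + x + I * t)‖ ≤
        C * cond 1 (1 + x + I * t) ^ (16 * θ * (k + 1)) := by
  have h2θ : 0 < 2 / θ := by positivity
  obtain ⟨c, hc, hlow⟩ := exists_norm_zeta_ge hθ hθ2
  set C₁ : ℝ := 6 * (44 + 2 / θ) with hC₁
  have hC₁0 : 0 < C₁ := by positivity
  refine ⟨k.factorial * (12 * C₁ / (θ * c)) ^ (k + 1) + k.factorial * C₁ / (θ / 2) ^ k,
    by positivity, ?_⟩
  intro x t hx hx1 ht
  set s : ℂ := 1 + x + I * t with hs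
  have hsre : s.re = 1 + x := by simp [hs]
  have hQ1 : 1 ≤ cond 1 s := by simpa using one_le_cond (q := 1) s
  have hlow' := hlow hx hx1 ht
  have hball : ∀ w ∈ Metric.ball s θ, w ≠ 1 ∧ ‖riemannZeta w‖ ≤ C₁ * cond 1 s ^ (2 * θ) :=
    fun w hw => norm_zeta_le_ball hθ hθ2 hx hx1 ht hw
  rw [LFunctionTrivChar_one_eq, ← hs] at hlow'
  set Q := cond 1 s with hQ
  have hQ0 : 0 < Q := by linarith
  have hdiff : DifferentiableOn ℂ riemannZeta (Metric.ball s θ) := fun w hw =>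
    (differentiableAt_riemannZeta (hball w hw).1).differentiableWithinAt
  have hA := norm_iteratedDeriv_logDeriv_le hθ hdiff (fun w hw => (hball w hw).2) (by positivity)
    hlow' k
  have hsub : Metric.closedBall s (θ / 2) ⊆ Metric.ball s θ :=
    Metric.closedBall_subset_ball (by linarith)
  have hB := norm_iteratedDeriv_le_of_forall_mem_sphere_norm_le k (c := s) (R := θ / 2)
    (f := riemannZeta) (C := C₁ * Q ^ (2 * θ)) (by positivity)
    (DifferentiableOn.diffContOnCl (by
      rw [closure_ball _ (by positivity)]
      exact hdiff.mono hsub))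
    (fun z hz => (hball z (hsub (Metric.sphere_subset_closedBall hz))).2)
  have hopen : {z : ℂ | 1 < z.re} ∈ nhds s :=
    (isOpen_lt continuous_const continuous_re).mem_nhds (by rw [mem_ofPred_eq, hsre]; linarith)
  have heq : zetaRegular =ᶠ[nhds s]
      -(fun z => deriv riemannZeta z / riemannZeta z) - riemannZeta := by
    filter_upwards [hopen] with z hz
    have hz1 : z ≠ 1 := by
      rintro rfl
      simp at hz
    exact zetaRegular_eq hz1 (riemannZeta_ne_zero_of_one_le_re (le_of_lt hz))
  have hs1 : s ≠ 1 := (hball s (Metric.mem_ball_self hθ)).1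
  have hs0 : riemannZeta s ≠ 0 := riemannZeta_ne_zero_of_one_le_re (by rw [hsre]; linarith)
  have hanζ : AnalyticAt ℂ riemannZeta s :=
    hdiff.analyticAt (Metric.ball_mem_nhds s hθ)
  have hanq : AnalyticAt ℂ (fun z => deriv riemannZeta z / riemannZeta z) s :=
    hanζ.deriv.div hanζ hs0
  rw [heq.iteratedDeriv_eq k, iteratedDeriv_sub (hanq.neg.contDiffAt) hanζ.contDiffAt,
    iteratedDeriv_neg]
  refine (norm_sub_le _ _).trans ?_
  rw [norm_neg, add_mul]
  refine add_le_add (hA.trans ?_) (hB.trans ?_)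
  · rw [show 12 * (C₁ * Q ^ (2 * θ)) / (θ * (c * Q ^ (-(14 * θ)))) =
      12 * C₁ / (θ * c) * Q ^ (16 * θ) by
        rw [show 16 * θ = 2 * θ + 14 * θ by ring, Real.rpow_add hQ0, Real.rpow_neg hQ0.le]
        field_simp, mul_pow, ← Real.rpow_natCast (Q ^ (16 * θ)), ← Real.rpow_mul hQ0.le,
            ← mul_assoc]
    gcongr
    push_cast
    exact le_rfl
  · have : Q ^ (2 * θ) ≤ Q ^ (16 * θ * (k + 1)) := by
      refine Real.rpow_le_rpow_of_exponent_le hQ1 ?_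
      have : (0 : ℝ) ≤ θ * k := by positivity
      linarith
    calc _ = k.factorial * C₁ / (θ / 2) ^ k * Q ^ (2 * θ) := by ring
      _ ≤ _ := by gcongr

lemma exists_LSeries_vonMangoldt_sub_one_le (k : ℕ) {η : ℝ} (hη : 0 < η) : ∃ C : ℝ, 0 < C ∧
    ∀ {x t : ℝ}, 0 < x → x ≤ 1 →
      ‖LSeries (fun n => ((ArithmeticFunction.vonMangoldt n : ℂ) - 1) * (Real.log n : ℂ) ^ k)
        (1 + x + I * t)‖ ≤ C * cond 1 (1 + x + I * t) ^ η := by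
  set θ : ℝ := min (η / (16 * (k + 1))) (1 / 2) with hθd
  have hθ : 0 < θ := by positivity
  have hθ2 : θ ≤ 1 / 2 := min_le_right _ _
  have hθη : 16 * θ * (k + 1) ≤ η := by
    have : θ ≤ η / (16 * (k + 1)) := min_le_left _ _
    rw [le_div_iff₀ (by positivity)] at this
    linarith
  obtain ⟨C₁, hC₁, h₁⟩ := exists_iteratedDeriv_zetaRegular_le_compact k
  obtain ⟨C₂, hC₂, h₂⟩ := norm_iteratedDeriv_zetaRegular_le k hθ hθ2
  refine ⟨C₁ + C₂, by positivity, ?_⟩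
  intro x t hx hx1
  set s : ℂ := 1 + x + I * t with hs
  have hsre : s.re = 1 + x := by simp [hs]
  have hQ1 : 1 ≤ cond 1 s := by simpa using one_le_cond (q := 1) s
  have hsum1 : ∀ s : ℂ, 1 < s.re → LSeriesSummable (fun _ => (1 : ℂ)) s :=
    fun s hs => LSeriesSummable_one_iff.2 hs
  have hsumΛ : ∀ s : ℂ, 1 < s.re →
      LSeriesSummable (fun n => (ArithmeticFunction.vonMangoldt n : ℂ)) s :=
    fun s hs => ArithmeticFunction.LSeriesSummable_vonMangoldt hs
  rw [norm_LSeries_mul_log_pow_eq (F := zetaRegular)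
    (f := fun n => (ArithmeticFunction.vonMangoldt n : ℂ) - 1)
    (fun s hs => (hsumΛ s hs).sub (hsum1 s hs)) ?_ k (by rw [hsre]; linarith)]
  · have hQη : 1 ≤ cond 1 s ^ η := Real.one_le_rpow hQ1 hη.le
    rcases le_total |t| 1 with ht | ht
    · refine (h₁ hx hx1 ht).trans ?_
      nlinarith
    · refine (h₂ hx hx1 ht).trans ?_
      have : cond 1 s ^ (16 * θ * (k + 1)) ≤ cond 1 s ^ η :=
        Real.rpow_le_rpow_of_exponent_le hQ1 hθη
      rw [← hs]
      nlinarith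
  · intro s hs
    have hs1 : s ≠ 1 := by
      rintro rfl
      simp at hs
    rw [zetaRegular_eq hs1 (riemannZeta_ne_zero_of_one_le_re hs.le)]
    have := LSeries_sub (hsumΛ s hs) (hsum1 s hs)
    rw [show (fun n => (ArithmeticFunction.vonMangoldt n : ℂ) - 1) =
      (fun n => (ArithmeticFunction.vonMangoldt n : ℂ)) - fun _ => (1 : ℂ) from rfl, this,
      ArithmeticFunction.LSeries_vonMangoldt_eq_deriv_riemannZeta_div hs, neg_div]
    congr 1
    exact LSeries_one_eq_riemannZeta hs

/-- The Cesàro weight. -/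
noncomputable def hat (u : ℝ) : ℝ := max (1 - u) 0

lemma hasMellin_hat {s : ℂ} (hs : 0 < s.re) :
    HasMellin (fun u => (hat u : ℂ)) s (1 / (s * (s + 1))) := by
  have h1 := hasMellin_one_Ioc hs
  have h2 := hasMellin_cpow_Ioc 1 (s := s) (by simp; linarith)
  have h3 := hasMellin_sub h1.1 h2.1
  rw [h1.2, h2.2] at h3
  have heq : EqOn (fun u : ℝ => (u : ℂ) ^ (s - 1) • (((Ioc 0 1).indicator (fun _ => (1 : ℂ)) u) -
      (Ioc 0 1).indicator (fun t : ℝ => (t : ℂ) ^ (1 : ℂ)) u))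
      (fun u => (u : ℂ) ^ (s - 1) • (hat u : ℂ)) (Ioi 0) := by
    intro u hu
    simp only
    congr 1
    by_cases h : u ≤ 1
    · have hm : u ∈ Ioc (0 : ℝ) 1 := ⟨hu, h⟩
      rw [indicator_of_mem hm, indicator_of_mem hm, hat, max_eq_left (by linarith)]
      simp
    · have hm : u ∉ Ioc (0 : ℝ) 1 := fun h' => h h'.2
      rw [indicator_of_notMem hm, indicator_of_notMem hm, hat, max_eq_right (by linarith)]
      simp
  have hs0 : s ≠ 0 := fun h => by simp [h] at hs
  have hs1 : s + 1 ≠ 0 := fun h => by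
    have := congrArg Complex.re h
    simp at this
    linarith
  refine ⟨h3.1.congr_fun heq measurableSet_Ioi, ?_⟩
  rw [mellin, ← setIntegral_congr_fun measurableSet_Ioi heq]
  refine h3.2.trans ?_
  field_simp
  ring

lemma continuous_hat : Continuous hat := by
  unfold hat
  fun_prop

lemma norm_one_div_mul_add_one_le {σ : ℝ} (hσ : 1 ≤ σ) (y : ℝ) :
    ‖(1 : ℂ) / ((σ + y * I) * ((σ + y * I) + 1))‖ ≤ (1 + y ^ 2)⁻¹ := by
  have h1 : 1 + y ^ 2 ≤ ‖(σ + y * I : ℂ)‖ ^ 2 := by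
    rw [← normSq_eq_norm_sq, normSq_add_mul_I]
    nlinarith
  have h2 : ‖(σ + y * I : ℂ)‖ ≤ ‖(σ + y * I : ℂ) + 1‖ := by
    rw [← sq_le_sq₀ (norm_nonneg _) (norm_nonneg _), ← normSq_eq_norm_sq, ← normSq_eq_norm_sq,
      normSq_add_mul_I, show (σ + y * I + 1 : ℂ) = ((σ + 1 : ℝ) : ℂ) + y * I by push_cast; ring,
      normSq_add_mul_I]
    nlinarith
  rw [norm_div, norm_one, norm_mul, one_div]
  refine inv_anti₀ (by positivity) (h1.trans ?_)
  rw [pow_two]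
  gcongr

lemma continuous_cesaroKernel {σ : ℝ} (hσ : 1 ≤ σ) :
    Continuous fun y : ℝ => (1 : ℂ) / ((σ + y * I) * ((σ + y * I) + 1)) := by
  refine continuous_const.div (by fun_prop) fun y => mul_ne_zero (fun h => ?_) (fun h => ?_)
  · have := congrArg Complex.re h
    simp at this
    linarith
  · have := congrArg Complex.re h
    simp at this
    linarith

lemma integrable_cesaroKernel {σ : ℝ} (hσ : 1 ≤ σ) :
    Integrable fun y : ℝ => (1 : ℂ) / ((σ + y * I) * ((σ + y * I) + 1)) :=
  integrable_inv_one_add_sq.mono' (continuous_cesaroKernel hσ).aestronglyMeasurable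
    (ae_of_all _ fun y => norm_one_div_mul_add_one_le hσ y)

lemma hat_eq_integral {σ : ℝ} (hσ : 1 ≤ σ) {u : ℝ} (hu : 0 < u) :
    (2 * Real.pi) * (hat u : ℂ) =
      ∫ y : ℝ, (u : ℂ) ^ (-(σ + y * I : ℂ)) * (1 / ((σ + y * I) * ((σ + y * I) + 1))) := by
  have hre : ∀ y : ℝ, 0 < (σ + y * I : ℂ).re := fun y => by simp; linarith
  have h := mellinInv_mellin_eq σ (fun u => (hat u : ℂ)) hu
    (hasMellin_hat (s := σ) (by simp; linarith)).1 ?_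
    (continuous_ofReal.comp continuous_hat).continuousAt
  · rw [← h, mellinInv, Complex.real_smul]
    have : (2 * Real.pi : ℂ) ≠ 0 := by exact_mod_cast Real.two_pi_pos.ne'
    push_cast
    rw [← mul_assoc, mul_one_div_cancel this, one_mul]
    refine integral_congr_ae (ae_of_all _ fun y => ?_)
    simp only [smul_eq_mul]
    rw [(hasMellin_hat (hre y)).2]
  · refine (integrable_cesaroKernel hσ).congr (ae_of_all _ fun y => ?_)
    simp only
    rw [(hasMellin_hat (hre y)).2]

lemma norm_real_cpow_add_mul_I {u : ℝ} (hu : 0 < u) (σ y : ℝ) :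
    ‖(u : ℂ) ^ (σ + y * I : ℂ)‖ = u ^ σ := by
  rw [norm_cpow_eq_rpow_re_of_pos hu]
  simp

/-- The constant in the smoothed Perron bound. -/
noncomputable def perronConst : ℝ := ∫ y : ℝ, (|y| + 2) ^ (1 / 2 : ℝ) * (1 + y ^ 2)⁻¹

lemma integrable_perronConst :
    Integrable fun y : ℝ => (|y| + 2) ^ (1 / 2 : ℝ) * (1 + y ^ 2)⁻¹ := by
  have h := integrable_rpow_neg_one_add_norm_sq (E := ℝ) (μ := volume) (r := 3 / 2) (by norm_num)
  have hc : Continuous fun y : ℝ => (|y| + 2) ^ (1 / 2 : ℝ) * (1 + y ^ 2)⁻¹ :=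
    (Continuous.rpow_const (by fun_prop) fun y => Or.inr (by norm_num)).mul
      (Continuous.inv₀ (by fun_prop) fun y => by positivity)
  refine (h.const_mul ((8 : ℝ) ^ (1 / 4 : ℝ))).mono' hc.aestronglyMeasurable
    (ae_of_all _ fun y => ?_)
  have hy : 0 < 1 + y ^ 2 := by positivity
  rw [Real.norm_of_nonneg (by positivity), Real.norm_eq_abs, sq_abs]
  have h1 : (|y| + 2) ^ (1 / 2 : ℝ) ≤ (8 * (1 + y ^ 2)) ^ (1 / 4 : ℝ) := by
    rw [show (1 / 2 : ℝ) = 2 * (1 / 4) by norm_num, Real.rpow_mul (by positivity)]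
    gcongr
    rw [Real.rpow_two]
    nlinarith [sq_abs y, sq_nonneg (|y| - 1)]
  calc _ ≤ (8 * (1 + y ^ 2)) ^ (1 / 4 : ℝ) * (1 + y ^ 2)⁻¹ := by gcongr
    _ = _ := by
      rw [Real.mul_rpow (by norm_num) hy.le, mul_assoc, ← Real.rpow_neg_one (1 + y ^ 2),
        ← Real.rpow_add hy]
      norm_num

lemma perronConst_nonneg : 0 ≤ perronConst := integral_nonneg fun y => by positivity

/-- Smoothed Perron bound. -/
lemma norm_sum_mul_hat_le {a : ℕ → ℂ} {σ K x : ℝ} (hσ : 1 ≤ σ) (hx : 0 < x)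
    (ha : LSeriesSummable a σ)
    (hK : ∀ y : ℝ, ‖LSeries a (σ + y * I)‖ ≤ K * (|y| + 2) ^ (1 / 2 : ℝ)) :
    ‖∑ n ∈ Finset.Icc 1 ⌊x⌋₊, a n * hat (n / x)‖ ≤ K * perronConst * x ^ σ := by
  set g : ℝ → ℂ := fun y => 1 / ((σ + y * I) * ((σ + y * I) + 1)) with hg
  set F : ℕ → ℝ → ℂ := fun n y => LSeries.term a (σ + y * I) n * ((x : ℂ) ^ (σ + y * I : ℂ) * g y)
    with hF
  have hterm : ∀ (n : ℕ) (y : ℝ), ‖LSeries.term a (σ + y * I) n‖ = ‖LSeries.term a σ n‖ := by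
    intro n y
    rw [LSeries.norm_term_eq, LSeries.norm_term_eq]
    simp
  have hpow : Continuous fun y : ℝ => (x : ℂ) ^ (σ + y * I : ℂ) := by
    refine Continuous.const_cpow (by fun_prop) (Or.inl ?_)
    exact_mod_cast hx.ne'
  have hgc : Continuous g := continuous_cesaroKernel hσ
  have hFint : ∀ n, Integrable (F n) := by
    intro n
    refine (integrable_inv_one_add_sq.const_mul (‖LSeries.term a σ n‖ * x ^ σ)).mono' ?_
      (ae_of_all _ fun y => ?_)
    · refine Continuous.aestronglyMeasurable (Continuous.mul ?_ (hpow.mul hgc))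
      rcases Nat.eq_zero_or_pos n with rfl | hn
      · simpa using continuous_const
      · have hn0 : (n : ℂ) ≠ 0 := by exact_mod_cast hn.ne'
        simp only [LSeries.term_of_ne_zero hn.ne']
        refine continuous_const.div (Continuous.const_cpow (by fun_prop) (Or.inl hn0)) fun y => ?_
        rw [Ne, cpow_eq_zero_iff]
        simp [hn0]
    · rw [hF]
      simp only
      rw [norm_mul, norm_mul, hterm, norm_real_cpow_add_mul_I hx, ← mul_assoc]
      exact mul_le_mul_of_nonneg_left (norm_one_div_mul_add_one_le hσ y) (by positivity)
  have hFnorm : Summable fun n => ∫ y, ‖F n y‖ := by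
    have : (fun n => ∫ y, ‖F n y‖) = fun n => ‖LSeries.term a σ n‖ * (x ^ σ * ∫ y, ‖g y‖) := by
      ext n
      rw [← integral_const_mul, ← integral_const_mul]
      refine integral_congr_ae (ae_of_all _ fun y => ?_)
      simp only [hF]
      rw [norm_mul, norm_mul, hterm, norm_real_cpow_add_mul_I hx]
    rw [this]
    exact ha.norm.mul_right _
  have hsum := hasSum_integral_of_summable_integral_norm hFint hFnorm
  have hInt : ∀ n, 1 ≤ n → ∫ y, F n y = (2 * Real.pi) * (a n * hat (n / x)) := by
    intro n hn
    have hn0 : (0 : ℝ) < n := by exact_mod_cast hn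
    have h := hat_eq_integral hσ (u := n / x) (by positivity)
    rw [mul_left_comm, h, ← integral_const_mul]
    refine integral_congr_ae (ae_of_all _ fun y => ?_)
    simp only [hF, hg]
    rw [LSeries.term_of_ne_zero (by lia), cpow_neg]
    push_cast
    have h2 := div_cpow_ofReal_nonneg hn0.le hx.le (σ + y * I)
    push_cast at h2
    rw [h2]
    have hxne : (x : ℂ) ^ (σ + y * I : ℂ) ≠ 0 := by
      rw [Ne, cpow_eq_zero_iff]
      simp [hx.ne']
    field_simp
  have hfin : HasSum (fun n => ∫ y, F n y)
      (∑ n ∈ Finset.Icc 1 ⌊x⌋₊, ∫ y, F n y) := by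
    refine hasSum_sum_of_ne_finset_zero fun n hn => ?_
    rcases Nat.eq_zero_or_pos n with rfl | hn1
    · simp [hF]
    · rw [hInt n hn1]
      have h3 : ⌊x⌋₊ < n := by
        by_contra! h
        exact hn (Finset.mem_Icc.2 ⟨hn1, h⟩)
      have h4 : x < n := (Nat.floor_lt hx.le).1 h3
      have : hat (n / x) = 0 := by
        rw [hat, max_eq_right]
        rw [sub_nonpos, le_div_iff₀ hx]
        linarith
      simp [this]
  have heq := hfin.unique hsum
  have h5 : (2 * Real.pi) * ∑ n ∈ Finset.Icc 1 ⌊x⌋₊, a n * (hat (n / x) : ℂ) =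
      ∫ y, ∑' n, F n y := by
    rw [← heq, Finset.mul_sum]
    refine Finset.sum_congr rfl fun n hn => (hInt n (Finset.mem_Icc.1 hn).1).symm
  have h6 : ‖∫ y, ∑' n, F n y‖ ≤ ∫ y : ℝ,
      (K * x ^ σ) * ((|y| + 2) ^ (1 / 2 : ℝ) * (1 + y ^ 2)⁻¹) := by
    refine norm_integral_le_of_norm_le (integrable_perronConst.const_mul _)
        (ae_of_all _ fun y => ?_)
    simp only [hF]
    rw [tsum_mul_right, norm_mul, norm_mul, norm_real_cpow_add_mul_I hx]
    have h7 := hK y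
    rw [LSeries] at h7
    have h8 := norm_one_div_mul_add_one_le hσ y
    calc _ ≤ (K * (|y| + 2) ^ (1 / 2 : ℝ)) * (x ^ σ * (1 + y ^ 2)⁻¹) := by
          refine mul_le_mul h7 ?_ (by positivity) ((norm_nonneg _).trans h7)
          gcongr
      _ = _ := by ring
  rw [integral_const_mul, ← perronConst, ← h5, norm_mul] at h6
  have h9 : 1 ≤ ‖(2 * Real.pi : ℂ)‖ := by
    rw [norm_mul, Complex.norm_real, Real.norm_of_nonneg Real.pi_pos.le]
    have := Real.pi_gt_three
    norm_num
    linarith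
  calc _ ≤ ‖(2 * Real.pi : ℂ)‖ * ‖∑ n ∈ Finset.Icc 1 ⌊x⌋₊, a n * (hat (n / x) : ℂ)‖ :=
        le_mul_of_one_le_left (norm_nonneg _) h9
    _ ≤ _ := h6.trans (le_of_eq (by ring))

lemma norm_sum_mul_antitone_le {b : ℕ → ℂ} {w : ℕ → ℝ} {M : ℕ} {D : ℝ}
    (hw : ∀ m n, M < m → m ≤ n → w n ≤ w m) (hw0 : ∀ n, M < n → 0 ≤ w n)
    {N : ℕ} (hMN : M < N) (hD : ∀ n, M ≤ n → n ≤ N → ‖∑ j ∈ Finset.Ioc M n, b j‖ ≤ D) :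
    ‖∑ j ∈ Finset.Ioc M N, b j * w j‖ ≤ w (M + 1) * D := by
  have key : ∀ n, M + 1 ≤ n → n ≤ N →
      ‖∑ j ∈ Finset.Ioc M n, b j * w j - w n * ∑ j ∈ Finset.Ioc M n, b j‖ ≤
        (w (M + 1) - w n) * D := by
    intro n hn
    induction n, hn using Nat.le_induction with
    | base =>
      intro _
      rw [Finset.sum_Ioc_succ_top le_rfl, Finset.sum_Ioc_succ_top le_rfl]
      simp [mul_comm]
    | succ n hn ih =>
      intro hnN
      rw [Finset.sum_Ioc_succ_top (by lia), Finset.sum_Ioc_succ_top (by lia)]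
      have h1 := ih (by lia)
      have h2 := hD n (by lia) (by lia)
      have h3 : w (n + 1) ≤ w n := hw n (n + 1) (by lia) (by lia)
      have h4 : ‖((w n - w (n + 1) : ℝ) : ℂ) * ∑ j ∈ Finset.Ioc M n, b j‖ ≤
          (w n - w (n + 1)) * D := by
        rw [norm_mul, Complex.norm_real, Real.norm_of_nonneg (by linarith)]
        exact mul_le_mul_of_nonneg_left h2 (by linarith)
      calc _ = ‖(∑ j ∈ Finset.Ioc M n, b j * w j - w n * ∑ j ∈ Finset.Ioc M n, b j) +
            ((w n - w (n + 1) : ℝ) : ℂ) * ∑ j ∈ Finset.Ioc M n, b j‖ := by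
              congr 1
              push_cast
              ring
        _ ≤ _ := (norm_add_le _ _).trans (add_le_add h1 h4)
        _ = _ := by ring
  have h1 := key N hMN le_rfl
  have h2 : ‖(w N : ℂ) * ∑ j ∈ Finset.Ioc M N, b j‖ ≤ w N * D := by
    rw [norm_mul, Complex.norm_real, Real.norm_of_nonneg (hw0 N hMN)]
    exact mul_le_mul_of_nonneg_left (hD N hMN.le le_rfl) (hw0 N hMN)
  calc _ = ‖(∑ j ∈ Finset.Ioc M N, b j * w j - w N * ∑ j ∈ Finset.Ioc M N, b j) +
        w N * ∑ j ∈ Finset.Ioc M N, b j‖ := by rw [sub_add_cancel]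
    _ ≤ _ := (norm_add_le _ _).trans (add_le_add h1 h2)
    _ = _ := by ring

lemma one_le_log_of_three_le {x : ℝ} (hx : 3 ≤ x) : 1 ≤ Real.log x := by
  rw [Real.le_log_iff_exp_le (by linarith)]
  exact Real.exp_one_lt_three.le.trans hx

lemma norm_sum_mul_sub_le {a : ℕ → ℂ} {K : ℝ} (hsum : ∀ σ : ℝ, 1 < σ → LSeriesSummable a σ)
    (hK : ∀ x t : ℝ, 0 < x → x ≤ 1 → ‖LSeries a (1 + x + I * t)‖ ≤ K * (|t| + 2) ^ (1 / 2 : ℝ))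
    {y : ℝ} (hy : 3 ≤ y) :
    ‖∑ n ∈ Finset.Icc 1 ⌊y⌋₊, a n * (y - n)‖ ≤ 3 * K * perronConst * y ^ 2 := by
  have hy0 : 0 < y := by linarith
  have hL := one_le_log_of_three_le hy
  have hL0 : 0 < Real.log y := by linarith
  have hinv : 0 < 1 / Real.log y := by positivity
  have hK0 : 0 ≤ K := by
    have h := (norm_nonneg _).trans (hK 1 0 one_pos le_rfl)
    exact nonneg_of_mul_nonneg_left h (by positivity)
  have h := norm_sum_mul_hat_le (σ := 1 + 1 / Real.log y) (K := K) (x := y) (a := a)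
    (by linarith) hy0 (hsum _ (by linarith)) fun t => by
      have := hK (1 / Real.log y) t hinv (by rw [div_le_one hL0]; exact hL)
      rw [mul_comm I] at this
      push_cast at this ⊢
      exact this
  have hpow : y ^ (1 + 1 / Real.log y) ≤ 3 * y := by
    rw [Real.rpow_add hy0, Real.rpow_one, Real.rpow_def_of_pos hy0, mul_one_div_cancel hL0.ne']
    nlinarith [Real.exp_one_lt_three]
  have heq : ∑ n ∈ Finset.Icc 1 ⌊y⌋₊, a n * (y - n) =
      y * ∑ n ∈ Finset.Icc 1 ⌊y⌋₊, a n * (hat (n / y) : ℂ) := by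
    rw [Finset.mul_sum]
    refine Finset.sum_congr rfl fun n hn => ?_
    have h1 : (n : ℝ) ≤ y := (Nat.le_floor_iff hy0.le).1 (Finset.mem_Icc.1 hn).2
    rw [hat, max_eq_left (by rw [sub_nonneg, div_le_one hy0]; exact h1)]
    have : (y : ℂ) ≠ 0 := by exact_mod_cast hy0.ne'
    push_cast
    field_simp
  rw [heq, norm_mul, Complex.norm_real, Real.norm_of_nonneg hy0.le]
  have hJ := perronConst_nonneg
  calc _ ≤ y * (K * perronConst * (3 * y)) := by
        refine mul_le_mul_of_nonneg_left (h.trans ?_) hy0.le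
        gcongr
    _ = _ := by ring

lemma norm_sum_le_of_LSeries_bound {a : ℕ → ℂ} {K : ℝ} {k : ℕ}
    (ha : ∀ n : ℕ, 1 ≤ n → ‖a n‖ ≤ (Real.log n + 1) ^ k)
    (hsum : ∀ σ : ℝ, 1 < σ → LSeriesSummable a σ)
    (hK : ∀ x t : ℝ, 0 < x → x ≤ 1 → ‖LSeries a (1 + x + I * t)‖ ≤ K * (|t| + 2) ^ (1 / 2 : ℝ))
    {N : ℕ} (hN : 3 ≤ N) {h : ℝ} (hh : 0 < h) (hhN : h ≤ N) :
    ‖∑ n ∈ Finset.Icc 1 N, a n‖ ≤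
      15 * K * perronConst * N ^ 2 / h + h * (3 * Real.log N) ^ k := by
  have hN3 : (3 : ℝ) ≤ N := by exact_mod_cast hN
  have hL := one_le_log_of_three_le hN3
  have hJ := perronConst_nonneg
  have hK0 : 0 ≤ K := by
    have h := (norm_nonneg _).trans (hK 1 0 one_pos le_rfl)
    exact nonneg_of_mul_nonneg_left h (by positivity)
  have h1 := norm_sum_mul_sub_le hsum hK hN3
  have h2 := norm_sum_mul_sub_le hsum hK (y := N + h) (by linarith)
  rw [Nat.floor_natCast] at h1
  set M := ⌊(N : ℝ) + h⌋₊ with hM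
  have hNM : N ≤ M := Nat.le_floor (by linarith)
  have hMle : (M : ℝ) ≤ N + h := Nat.floor_le (by linarith)
  have hsplit : ∑ n ∈ Finset.Icc 1 M, a n * ((N + h : ℝ) - n) =
      ∑ n ∈ Finset.Icc 1 N, a n * ((N + h : ℝ) - n) +
      ∑ n ∈ Finset.Ioc N M, a n * ((N + h : ℝ) - n) := by
    rw [← Finset.sum_union]
    · congr 1
      ext n
      simp only [Finset.mem_Icc, Finset.mem_union, Finset.mem_Ioc]
      lia
    · rw [Finset.disjoint_left]
      intro n hn hn'
      rw [Finset.mem_Icc] at hn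
      rw [Finset.mem_Ioc] at hn'
      lia
  have hedge : ‖∑ n ∈ Finset.Ioc N M, a n * ((N + h : ℝ) - n)‖ ≤
      h * (h * (3 * Real.log N) ^ k) := by
    calc _ ≤ ∑ n ∈ Finset.Ioc N M, (3 * Real.log N) ^ k * h := by
          refine norm_sum_le_of_le _ fun n hn => ?_
          rw [Finset.mem_Ioc] at hn
          have hn1 : (N : ℝ) ≤ n := by exact_mod_cast hn.1.le
          have hn2 : (n : ℝ) ≤ N + h := le_trans (by exact_mod_cast hn.2) hMle
          have hlog : Real.log n + 1 ≤ 3 * Real.log N := by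
            have h3 : Real.log n ≤ Real.log (2 * N) :=
              Real.log_le_log (by linarith) (by linarith)
            rw [Real.log_mul (by norm_num) (by linarith)] at h3
            have := Real.log_two_lt_d9
            linarith
          rw [norm_mul, show ((N + h : ℝ) : ℂ) - n = ((N + h - n : ℝ) : ℂ) by push_cast; ring,
            Complex.norm_real, Real.norm_of_nonneg (by linarith)]
          refine mul_le_mul ((ha n (by lia)).trans ?_) (by linarith) (by linarith)
            (by positivity)
          have : 0 ≤ Real.log n := Real.log_nonneg (by linarith)
          gcongr
      _ = (M - N : ℝ) * ((3 * Real.log N) ^ k * h) := by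
          rw [Finset.sum_const, Nat.card_Ioc, nsmul_eq_mul, Nat.cast_sub hNM]
      _ ≤ h * ((3 * Real.log N) ^ k * h) := by
          gcongr
          linarith
      _ = _ := by ring
  have hmain : (h : ℂ) * ∑ n ∈ Finset.Icc 1 N, a n =
      ∑ n ∈ Finset.Icc 1 M, a n * ((N + h : ℝ) - n) -
      ∑ n ∈ Finset.Icc 1 N, a n * ((N : ℝ) - n) -
      ∑ n ∈ Finset.Ioc N M, a n * ((N + h : ℝ) - n) := by
    rw [hsplit, add_sub_right_comm, add_sub_cancel_right, ← Finset.sum_sub_distrib,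
      Finset.mul_sum]
    refine Finset.sum_congr rfl fun n _ => ?_
    push_cast
    ring
  have hfin : h * ‖∑ n ∈ Finset.Icc 1 N, a n‖ ≤
      h * (15 * K * perronConst * N ^ 2 / h + h * (3 * Real.log N) ^ k) := by
    calc h * ‖∑ n ∈ Finset.Icc 1 N, a n‖ = ‖(h : ℂ) * ∑ n ∈ Finset.Icc 1 N, a n‖ := by
          rw [norm_mul, Complex.norm_real, Real.norm_of_nonneg hh.le]
      _ ≤ 3 * K * perronConst * (N + h) ^ 2 + 3 * K * perronConst * N ^ 2 +
          h * (h * (3 * Real.log N) ^ k) := by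
          rw [hmain]
          refine (norm_sub_le _ _).trans (add_le_add ((norm_sub_le _ _).trans ?_) hedge)
          exact add_le_add h2 h1
      _ ≤ 3 * K * perronConst * (2 * N) ^ 2 + 3 * K * perronConst * N ^ 2 +
          h * (h * (3 * Real.log N) ^ k) := by
          gcongr
          linarith
      _ = _ := by field_simp; ring
  exact le_of_mul_le_mul_left hfin hh

lemma log_pow_le_rpow (m : ℕ) {x : ℝ} (hx : 1 ≤ x) {ε : ℝ} (hε : 0 < ε) :
    Real.log x ^ m ≤ ((m + 1) / ε) ^ m * x ^ ε := by
  have h1 : Real.log x ≤ x ^ (ε / (m + 1)) / (ε / (m + 1)) :=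
    Real.log_le_rpow_div (by linarith) (by positivity)
  have h0 : 0 ≤ Real.log x := Real.log_nonneg hx
  calc Real.log x ^ m ≤ (x ^ (ε / (m + 1)) / (ε / (m + 1))) ^ m := by gcongr
    _ = ((m + 1) / ε) ^ m * x ^ (ε / (m + 1) * m) := by
      rw [div_eq_mul_inv, mul_pow, inv_div, ← Real.rpow_natCast (x ^ _),
          ← Real.rpow_mul (by linarith),
        mul_comm]
    _ ≤ _ := by
      refine mul_le_mul_of_nonneg_left (Real.rpow_le_rpow_of_exponent_le hx ?_) (by positivity)
      rw [div_mul_eq_mul_div, div_le_iff₀ (by positivity)]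
      nlinarith

/-- Cancellation in sums from bounds for the Dirichlet series weighted by a high power of `log`. -/
lemma exists_norm_sum_le_of_LSeries_bound (B : ℕ) : ∃ C : ℝ, 0 < C ∧ ∀ {a : ℕ → ℂ} {K : ℝ},
    (∀ n : ℕ, 1 ≤ n → ‖a n‖ ≤ Real.log n + 1) →
    (∀ σ : ℝ, 1 < σ → LSeriesSummable (fun n => a n * (Real.log n : ℂ) ^ (2 * B + 2)) σ) →
    (∀ x t : ℝ, 0 < x → x ≤ 1 →
      ‖LSeries (fun n => a n * (Real.log n : ℂ) ^ (2 * B + 2)) (1 + x + I * t)‖ ≤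
        K * (|t| + 2) ^ (1 / 2 : ℝ)) →
    ∀ {N : ℕ}, 9 ≤ N → ‖∑ n ∈ Finset.Icc 1 N, a n‖ ≤
      C * (1 + K / Real.log N) * (N / Real.log N ^ B) := by
  set k := 2 * B + 2 with hk
  have hJ := perronConst_nonneg
  refine ⟨2 ^ (k + 1) * (15 * perronConst) + 2 ^ (k + 1) * 3 ^ (k + 1) +
    4 * (((B + 1 : ℕ) + 1) / (1 / 2 : ℝ)) ^ (B + 1), by positivity, ?_⟩
  intro a K ha hsum hK N hN
  have hK0 : 0 ≤ K := by
    have h := (norm_nonneg _).trans (hK 1 0 one_pos le_rfl)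
    exact nonneg_of_mul_nonneg_left h (by positivity)
  have hN9 : (9 : ℝ) ≤ N := by exact_mod_cast hN
  have hL := one_le_log_of_three_le (x := N) (by linarith)
  set L := Real.log N with hLdef
  have hL0 : 0 < L := by linarith
  have hak : ∀ n : ℕ, 1 ≤ n → ‖a n * (Real.log n : ℂ) ^ k‖ ≤ (Real.log n + 1) ^ (k + 1) := by
    intro n hn
    have h0 : 0 ≤ Real.log n := Real.log_natCast_nonneg n
    rw [norm_mul, norm_pow, Complex.norm_real, Real.norm_of_nonneg h0,
      pow_succ' (Real.log n + 1)]
    exact mul_le_mul (ha n hn) (pow_le_pow_left₀ h0 (by linarith) k) (by positivity)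
      (by positivity)
  set E : ℝ := N * (15 * K * perronConst * L ^ (B + 1) + 3 ^ (k + 1) * L ^ (k - B)) with hE
  have hT : ∀ n : ℕ, 3 ≤ n → n ≤ N → ‖∑ j ∈ Finset.Icc 1 n, a j * (Real.log j : ℂ) ^ k‖ ≤ E := by
    intro n hn hnN
    have hn0 : (0 : ℝ) < n := by exact_mod_cast (by lia : 0 < n)
    have hn1 : (1 : ℝ) ≤ n := by exact_mod_cast (by lia : 1 ≤ n)
    have hnN' : (n : ℝ) ≤ N := by exact_mod_cast hnN
    have hlog : Real.log n ≤ L := Real.log_le_log hn0 hnN'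
    have hlog0 : 0 ≤ Real.log n := Real.log_natCast_nonneg n
    refine (norm_sum_le_of_LSeries_bound hak hsum hK hn (h := n / L ^ (B + 1)) (by positivity)
      (div_le_self hn0.le (one_le_pow₀ hL))).trans ?_
    have e1 : 15 * K * perronConst * (n : ℝ) ^ 2 / (n / L ^ (B + 1)) =
        n * (15 * K * perronConst * L ^ (B + 1)) := by field_simp
    have e2 : (n : ℝ) / L ^ (B + 1) * (3 * Real.log n) ^ (k + 1) ≤
        n * (3 ^ (k + 1) * L ^ (k - B)) := by
      have : (3 * L) ^ (k + 1) = 3 ^ (k + 1) * L ^ (k - B) * L ^ (B + 1) := by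
        rw [mul_pow, mul_assoc, ← pow_add]
        congr 2
        lia
      calc (n : ℝ) / L ^ (B + 1) * (3 * Real.log n) ^ (k + 1) ≤
          n / L ^ (B + 1) * (3 * L) ^ (k + 1) := by gcongr
        _ = _ := by rw [this]; field_simp
    rw [e1, hE, mul_add]
    refine add_le_add ?_ (e2.trans ?_)
    · gcongr
    · gcongr
  set M := Nat.sqrt N + 1 with hM
  have hsq3 : 3 ≤ Nat.sqrt N := Nat.le_sqrt.2 (by lia)
  have hsqN : Nat.sqrt N * Nat.sqrt N ≤ N := Nat.sqrt_le N
  have hMN : M < N := by nlinarith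
  have hNM : N < M * M := Nat.lt_succ_sqrt N
  have hM2 : (M : ℝ) ≤ 2 * (N : ℝ) ^ (1 / 2 : ℝ) := by
    rw [← Real.sqrt_eq_rpow]
    have h1 := Real.nat_sqrt_le_real_sqrt (a := N)
    have h2 : (3 : ℝ) ≤ Nat.sqrt N := by exact_mod_cast hsq3
    rw [hM]
    push_cast
    linarith
  have hlogM : ∀ j : ℕ, M < j → L / 2 ≤ Real.log j := by
    intro j hj
    have h1 : (N : ℝ) ≤ (j : ℝ) ^ 2 := by
      have : N ≤ j ^ 2 := by nlinarith
      exact_mod_cast this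
    have h2 := Real.log_le_log (by linarith) h1
    rw [Real.log_pow] at h2
    push_cast at h2
    linarith
  have hA := norm_sum_mul_antitone_le (b := fun j => a j * (Real.log j : ℂ) ^ k)
    (w := fun j => (Real.log j ^ k)⁻¹) (M := M) (N := N) (D := 2 * E) ?_ ?_ hMN ?_
  rotate_left
  · intro m n hm hmn
    have h1 := hlogM m hm
    have hm0 : (0 : ℝ) < m := by exact_mod_cast (by lia : 0 < m)
    have h2 : Real.log m ≤ Real.log n := Real.log_le_log hm0 (by exact_mod_cast hmn)
    have h3 : 0 < Real.log m := by linarith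
    gcongr
  · intro n hn
    have := Real.log_natCast_nonneg n
    positivity
  · intro n hn hnN
    have hsplit : ∑ j ∈ Finset.Ioc M n, a j * (Real.log j : ℂ) ^ k =
        ∑ j ∈ Finset.Icc 1 n, a j * (Real.log j : ℂ) ^ k -
        ∑ j ∈ Finset.Icc 1 M, a j * (Real.log j : ℂ) ^ k := by
      have e : ∀ m : ℕ, Finset.Icc 1 m = Finset.Ioc 0 m := fun m => by ext; simp; lia
      rw [e, e, ← Finset.sum_Ioc_consecutive _ (Nat.zero_le M) hn, add_sub_cancel_left]
    rw [hsplit]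
    refine (norm_sub_le _ _).trans ?_
    linarith [hT n (by lia) hnN, hT M (by lia) hMN.le]
  have hw1 : (Real.log (M + 1 : ℕ) ^ k)⁻¹ ≤ 2 ^ k / L ^ k := by
    have := hlogM (M + 1) (by lia)
    rw [← div_pow, ← inv_div, ← inv_pow]
    rw [inv_pow, inv_pow]
    gcongr
  have hE0 : 0 ≤ E := (norm_nonneg _).trans (hT 3 le_rfl (by lia))
  have hlogpow := log_pow_le_rpow (B + 1) (x := N) (by linarith) (ε := 1 / 2) (by norm_num)
  rw [← hLdef] at hlogpow
  set G : ℝ := (((B + 1 : ℕ) + 1) / (1 / 2 : ℝ)) ^ (B + 1) with hG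
  have hfirst : ‖∑ j ∈ Finset.Icc 1 M, a j‖ ≤ 4 * G * (N / L ^ B) := by
    calc _ ≤ ∑ j ∈ Finset.Icc 1 M, 2 * L := by
          refine norm_sum_le_of_le _ fun j hj => (ha j (Finset.mem_Icc.1 hj).1).trans ?_
          have hj1 : (0 : ℝ) < j := by exact_mod_cast (Finset.mem_Icc.1 hj).1
          have : Real.log j ≤ L := Real.log_le_log hj1 (by
            exact_mod_cast (Finset.mem_Icc.1 hj).2.trans hMN.le)
          linarith
      _ = M * (2 * L) := by simp
      _ ≤ (2 * (N : ℝ) ^ (1 / 2 : ℝ)) * (2 * L) := by gcongr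
      _ = 4 * L ^ (B + 1) * (N : ℝ) ^ (1 / 2 : ℝ) / L ^ B := by
          rw [pow_succ]
          field_simp
          ring
      _ ≤ 4 * (G * (N : ℝ) ^ (1 / 2 : ℝ)) * (N : ℝ) ^ (1 / 2 : ℝ) / L ^ B := by gcongr
      _ = 4 * G * (((N : ℝ) ^ (1 / 2 : ℝ) * (N : ℝ) ^ (1 / 2 : ℝ)) / L ^ B) := by ring
      _ = _ := by
          rw [← Real.rpow_add (by linarith)]
          norm_num
  have hsecond : ‖∑ j ∈ Finset.Ioc M N, a j‖ ≤
      (2 ^ (k + 1) * (15 * perronConst) * (K / L) + 2 ^ (k + 1) * 3 ^ (k + 1)) * (N / L ^ B) := by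
    have heq : ∑ j ∈ Finset.Ioc M N, a j = ∑ j ∈ Finset.Ioc M N,
        (a j * (Real.log j : ℂ) ^ k) * (((Real.log j ^ k)⁻¹ : ℝ) : ℂ) := by
      refine Finset.sum_congr rfl fun j hj => ?_
      have h1 := hlogM j (Finset.mem_Ioc.1 hj).1
      have h2 : (Real.log j : ℂ) ^ k ≠ 0 := pow_ne_zero _ (by
        exact_mod_cast (by linarith : (0 : ℝ) < Real.log j).ne')
      rw [ofReal_inv, ofReal_pow, mul_assoc, mul_inv_cancel₀ h2, mul_one]
    rw [heq]
    refine (hA.trans (mul_le_mul_of_nonneg_right hw1 (by positivity))).trans (le_of_eq ?_)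
    rw [hE, show k - B = B + 2 by lia, show L ^ k = L ^ B * L ^ B * L ^ 2 by
      rw [hk, ← pow_add, ← pow_add]; congr 1; lia, pow_succ L B, pow_add L B 2, pow_succ 2 k]
    field_simp
  have hKL : 0 ≤ K / L := by positivity
  have hall : ∑ n ∈ Finset.Icc 1 N, a n =
      ∑ n ∈ Finset.Icc 1 M, a n + ∑ n ∈ Finset.Ioc M N, a n := by
    have e : ∀ m : ℕ, Finset.Icc 1 m = Finset.Ioc 0 m := fun m => by ext; simp; lia
    rw [e, e, ← Finset.sum_Ioc_consecutive _ (Nat.zero_le M) hMN.le]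
  rw [hall]
  refine (norm_add_le _ _).trans ((add_le_add hfirst hsecond).trans ?_)
  rw [← add_mul]
  gcongr
  have hG0 : 0 ≤ G := by positivity
  have : (0 : ℝ) ≤ 2 ^ (k + 1) * (15 * perronConst) := by positivity
  have : (0 : ℝ) ≤ 2 ^ (k + 1) * 3 ^ (k + 1) := by positivity
  nlinarith

lemma LSeriesSummable_mul_log_pow {f : ℕ → ℂ} (hf : ∀ s : ℂ, 1 < s.re → LSeriesSummable f s)
    (k : ℕ) {σ : ℝ} (hσ : 1 < σ) : LSeriesSummable (fun n => f n * (Real.log n : ℂ) ^ k) σ := by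
  have habs : LSeries.abscissaOfAbsConv f ≤ 1 := by
    refine LSeries.abscissaOfAbsConv_le_of_forall_lt_LSeriesSummable (x := 1) fun y hy => ?_
    exact hf y (by simpa using hy)
  rw [show (fun n => f n * (Real.log n : ℂ) ^ k) = LSeries.logMul^[k] f from
    funext fun n => (logMul_iterate_apply f k n).symm]
  refine LSeriesSummable_of_abscissaOfAbsConv_lt_re ?_
  rw [LSeries.absicssaOfAbsConv_logPowMul, ofReal_re]
  exact habs.trans_lt (by exact_mod_cast hσ)

lemma abs_psi_sub_le_nat (B : ℕ) : ∃ C : ℝ, 0 < C ∧ ∀ N : ℕ, 9 ≤ N →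
    |Chebyshev.psi N - N| ≤ C * (N / Real.log N ^ B) := by
  obtain ⟨C, hC, H⟩ := exists_norm_sum_le_of_LSeries_bound B
  obtain ⟨K, hK, HK⟩ := exists_LSeries_vonMangoldt_sub_one_le (2 * B + 2) (η := 1 / 2)
    (by norm_num)
  refine ⟨C * (1 + K), by positivity, fun N hN => ?_⟩
  have hL := one_le_log_of_three_le (x := N) (by exact_mod_cast (by lia : 3 ≤ N))
  have h := H (a := fun n => (ArithmeticFunction.vonMangoldt n : ℂ) - 1) (K := K) ?_ ?_ ?_ hN
  · have heq : ∑ n ∈ Finset.Icc 1 N, ((ArithmeticFunction.vonMangoldt n : ℂ) - 1) =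
        ((Chebyshev.psi N - N : ℝ) : ℂ) := by
      rw [Finset.sum_sub_distrib, Chebyshev.psi, Nat.floor_natCast]
      simp
      rfl
    rw [heq, Complex.norm_real, Real.norm_eq_abs] at h
    refine h.trans ?_
    gcongr
    exact div_le_self hK.le hL
  · intro n hn
    have h1 := ArithmeticFunction.vonMangoldt_le_log (n := n)
    have h2 := ArithmeticFunction.vonMangoldt_nonneg (n := n)
    have h3 := Real.log_natCast_nonneg n
    rw [show (ArithmeticFunction.vonMangoldt n : ℂ) - 1 =
      ((ArithmeticFunction.vonMangoldt n - 1 : ℝ) : ℂ) by push_cast; rfl, Complex.norm_real,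
      Real.norm_eq_abs, abs_le]
    constructor <;> linarith
  · intro σ hσ
    exact LSeriesSummable_mul_log_pow (f := fun n => (ArithmeticFunction.vonMangoldt n : ℂ) - 1)
      (fun s hs => (ArithmeticFunction.LSeriesSummable_vonMangoldt hs).sub
        (LSeriesSummable_one_iff.2 hs)) _ hσ
  · intro x t hx hx1
    refine (HK hx hx1).trans (le_of_eq ?_)
    simp [cond]

/-- The prime number theorem with an arbitrary power of `log` saved. -/
lemma abs_psi_sub_le (B : ℕ) : ∃ C : ℝ, 0 < C ∧ ∀ x : ℝ, 9 ≤ x →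
    |Chebyshev.psi x - x| ≤ C * (x / Real.log x ^ B) := by
  obtain ⟨C, hC, H⟩ := abs_psi_sub_le_nat B
  refine ⟨C * 2 ^ B + (B + 1) ^ B, by positivity, fun x hx => ?_⟩
  have hN : 9 ≤ ⌊x⌋₊ := Nat.le_floor (by exact_mod_cast hx)
  have h := H ⌊x⌋₊ hN
  have hfl : (⌊x⌋₊ : ℝ) ≤ x := Nat.floor_le (by linarith)
  have hfl' : x < ⌊x⌋₊ + 1 := Nat.lt_floor_add_one x
  have hN9 : (9 : ℝ) ≤ ⌊x⌋₊ := by exact_mod_cast hN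
  have hL := one_le_log_of_three_le (x := x) (by linarith)
  have hL' := one_le_log_of_three_le (x := ⌊x⌋₊) (by linarith)
  rw [Chebyshev.psi_eq_psi_coe_floor]
  have hlog : Real.log x ≤ 2 * Real.log ⌊x⌋₊ := by
    rw [← Real.log_rpow (by linarith)]
    refine Real.log_le_log (by linarith) ?_
    rw [Real.rpow_two]
    nlinarith
  have h1 : (⌊x⌋₊ : ℝ) / Real.log ⌊x⌋₊ ^ B ≤ 2 ^ B * (x / Real.log x ^ B) := by
    calc (⌊x⌋₊ : ℝ) / Real.log ⌊x⌋₊ ^ B ≤ x / (Real.log x / 2) ^ B := by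
          gcongr
          linarith
      _ = _ := by rw [div_pow]; field_simp
  have h2 : 1 ≤ (B + 1) ^ B * (x / Real.log x ^ B) := by
    have := log_pow_le_rpow B (x := x) (by linarith) (ε := 1) one_pos
    rw [Real.rpow_one, div_one] at this
    rw [← mul_div_assoc, le_div_iff₀ (by positivity), one_mul]
    exact this
  have h3 : |Chebyshev.psi ⌊x⌋₊ - x| ≤ |Chebyshev.psi ⌊x⌋₊ - ⌊x⌋₊| + 1 := by
    rw [show Chebyshev.psi ⌊x⌋₊ - x = (Chebyshev.psi ⌊x⌋₊ - ⌊x⌋₊) + (⌊x⌋₊ - x) by ring]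
    refine (abs_add_le _ _).trans ?_
    gcongr
    rw [abs_le]
    constructor <;> linarith
  calc _ ≤ C * (2 ^ B * (x / Real.log x ^ B)) + (B + 1) ^ B * (x / Real.log x ^ B) :=
        h3.trans (add_le_add (h.trans (by gcongr)) h2)
    _ = _ := by ring

/-- The twisted Chebyshev function. -/
noncomputable def psiChar {q : ℕ} (χ : DirichletCharacter ℂ q) (N : ℕ) : ℂ :=
  ∑ n ∈ Finset.Icc 1 N, χ n * (ArithmeticFunction.vonMangoldt n : ℂ)

/-- A Siegel-Walfisz bound with at most one exceptional primitive character. -/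
lemma exists_norm_psiChar_le (A B : ℕ) : ∃ C : ℝ, 0 < C ∧ ∀ N : ℕ, 9 ≤ N →
    ∃ b : Σ q : ℕ, DirichletCharacter ℂ q, ∀ {q : ℕ} [NeZero q] {χ : DirichletCharacter ℂ q},
    q ≤ Real.log N ^ A → χ.IsPrimitive → χ ≠ 1 →
    (⟨q, χ⟩ : Σ q : ℕ, DirichletCharacter ℂ q) ≠ b →
    ‖psiChar χ N‖ ≤ C * (N / Real.log N ^ B) := by
  obtain ⟨C, hC, H⟩ := exists_norm_sum_le_of_LSeries_bound B
  set η : ℝ := 1 / (A + 2) with hη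
  have hη0 : 0 < η := by positivity
  have hη2 : η ≤ 1 / 2 := by
    rw [hη]
    gcongr
    have : (0 : ℝ) ≤ A := Nat.cast_nonneg A
    linarith
  obtain ⟨K, hK, HK⟩ := exists_LSeries_twist_le (2 * B + 2) hη0
  refine ⟨C * (1 + K), by positivity, fun N hN => ?_⟩
  have hL := one_le_log_of_three_le (x := N) (by exact_mod_cast (by lia : 3 ≤ N))
  set L := Real.log N with hLdef
  have hL0 : 0 < L := by linarith
  obtain ⟨b, hb⟩ := HK (L ^ A)
  refine ⟨b, fun {q} _ {χ} hq hprim hχ hne => ?_⟩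
  have h := H (a := fun n => χ n * (ArithmeticFunction.vonMangoldt n : ℂ)) (K := K * L) ?_ ?_ ?_ hN
  · refine h.trans (le_of_eq ?_)
    rw [← hLdef, mul_div_cancel_right₀ _ hL0.ne']
  · intro n hn
    have h1 := ArithmeticFunction.vonMangoldt_le_log (n := n)
    have h2 := ArithmeticFunction.vonMangoldt_nonneg (n := n)
    rw [norm_mul, Complex.norm_real, Real.norm_of_nonneg h2]
    have := mul_le_mul_of_nonneg_right (χ.norm_le_one n) h2
    linarith
  · intro σ hσ
    exact LSeriesSummable_mul_log_pow
      (f := fun n => χ n * (ArithmeticFunction.vonMangoldt n : ℂ))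
      (fun s hs => DirichletCharacter.LSeriesSummable_twist_vonMangoldt χ hs) _ hσ
  · intro x t hx hx1
    refine (hb hq hprim hχ hne hx hx1).trans ?_
    have him : (1 + x + I * t : ℂ).im = t := by simp
    rw [cond, him, Real.mul_rpow (by positivity) (by positivity), ← mul_assoc]
    gcongr
    · rw [← Real.rpow_natCast L A, ← Real.rpow_mul hL0.le]
      calc L ^ ((A : ℝ) * η) ≤ L ^ (1 : ℝ) := by
            refine Real.rpow_le_rpow_of_exponent_le hL ?_
            rw [hη, mul_one_div, div_le_one (by positivity)]
            linarith
        _ = L := Real.rpow_one L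
    · linarith [abs_nonneg t]

/-- The additive character `t ↦ exp (2 π i t)` of the reals. -/
noncomputable def expChar (t : ℝ) : ℂ := Complex.exp (Complex.I * ((2 * Real.pi * t : ℝ) : ℂ))

lemma norm_expChar (t : ℝ) : ‖expChar t‖ = 1 := by
  rw [expChar, mul_comm, Complex.norm_exp_ofReal_mul_I]

lemma expChar_add (s t : ℝ) : expChar (s + t) = expChar s * expChar t := by
  rw [expChar, expChar, expChar, ← Complex.exp_add]
  congr 1
  push_cast
  ring

lemma conj_expChar (t : ℝ) : (starRingEnd ℂ) (expChar t) = expChar (-t) := by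
  rw [expChar, expChar, ← Complex.exp_conj]
  congr 1
  rw [map_mul, Complex.conj_I, Complex.conj_ofReal]
  push_cast
  ring

lemma expChar_intCast (m : ℤ) : expChar m = 1 := by
  rw [expChar, Complex.exp_eq_one_iff]
  exact ⟨m, by push_cast; ring⟩

lemma expChar_natCast_mul (n : ℕ) (t : ℝ) : expChar (n * t) = expChar (Int.fract t) ^ n := by
  have h : expChar t = expChar (Int.fract t) := by
    conv_lhs => rw [← Int.floor_add_fract t, expChar_add, expChar_intCast, one_mul]
  rw [← h, expChar, expChar, ← Complex.exp_nat_mul]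
  congr 1
  push_cast
  ring

lemma norm_expChar_sub_one (t : ℝ) (h0 : 0 ≤ t) (h1 : t ≤ 1) :
    4 * min t (1 - t) ≤ ‖expChar t - 1‖ := by
  rw [expChar, Complex.norm_exp_I_mul_ofReal_sub_one, Real.norm_eq_abs]
  have hpi := Real.pi_pos
  have key : ∀ u : ℝ, 0 ≤ u → u ≤ 1 / 2 → 2 * u ≤ Real.sin (Real.pi * u) := by
    intro u hu0 hu1
    have := Real.mul_le_sin (x := Real.pi * u) (by positivity) (by nlinarith)
    have e : 2 / Real.pi * (Real.pi * u) = 2 * u := by field_simp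
    linarith
  refine le_trans ?_ (le_abs_self _)
  have e : 2 * Real.pi * t / 2 = Real.pi * t := by ring
  rw [e]
  rcases le_total t (1 / 2) with h | h
  · have := key t h0 h
    linarith [min_le_left t (1 - t)]
  · have := key (1 - t) (by linarith) (by linarith)
    have e2 : Real.pi * (1 - t) = Real.pi - Real.pi * t := by ring
    rw [e2, Real.sin_pi_sub] at this
    linarith [min_le_right t (1 - t)]

lemma norm_sum_expChar_le (N : ℕ) (t : ℝ) (ht : 0 < Int.fract t) :
    ‖∑ n ∈ Finset.Icc 1 N, expChar (n * t)‖ ≤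
      1 / 2 * (1 / Int.fract t + 1 / (1 - Int.fract t)) := by
  set u := Int.fract t with hu
  have hu1 : u < 1 := Int.fract_lt_one t
  set z := expChar u with hz
  have hm : 0 < min u (1 - u) := lt_min ht (by linarith)
  have hzz := norm_expChar_sub_one u ht.le hu1.le
  have hz1 : z ≠ 1 := by
    intro h
    rw [← hz, h, sub_self, norm_zero] at hzz
    linarith
  have hs : ∑ n ∈ Finset.Icc 1 N, expChar (n * t) = z * ((z ^ N - 1) / (z - 1)) := by
    rw [← geom_sum_eq hz1, Finset.mul_sum]
    refine Finset.sum_bij' (fun n _ => n - 1) (fun n _ => n + 1) ?_ ?_ ?_ ?_ ?_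
    · intro n hn; rw [Finset.mem_Icc] at hn; rw [Finset.mem_range]; omega
    · intro n hn; rw [Finset.mem_range] at hn; rw [Finset.mem_Icc]; omega
    · intro n hn; rw [Finset.mem_Icc] at hn; omega
    · intro n hn; omega
    · intro n hn
      rw [Finset.mem_Icc] at hn
      rw [expChar_natCast_mul, ← pow_succ', Nat.sub_add_cancel hn.1]
  rw [hs, norm_mul, norm_div, norm_expChar, one_mul]
  have h2 : ‖z ^ N - 1‖ ≤ 2 := by
    refine (norm_sub_le _ _).trans ?_
    rw [norm_pow, norm_expChar]
    norm_num
  calc ‖z ^ N - 1‖ / ‖z - 1‖ ≤ 2 / (4 * min u (1 - u)) := by gcongr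
    _ = 1 / 2 * (1 / min u (1 - u)) := by ring
    _ ≤ _ := by
      have h1u : 0 < 1 - u := by linarith
      gcongr
      rcases min_choice u (1 - u) with h | h <;> rw [h]
      · have : 0 ≤ 1 / (1 - u) := by positivity
        linarith
      · have : 0 ≤ 1 / u := by positivity
        linarith

lemma sum_one_div_le_of_spaced {ι : Type*} (s : Finset ι) (f : ι → ℝ) {δ : ℝ} (hδ : 0 < δ)
    (hδ1 : δ ≤ 1) (hf : ∀ i ∈ s, δ ≤ f i ∧ f i ≤ 1) (hsp : ∀ i ∈ s, ∀ j ∈ s, i ≠ j →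
      δ ≤ |f i - f j|) :
    ∑ i ∈ s, 1 / f i ≤ 1 / δ * (1 + Real.log (1 / δ)) := by
  classical
  set k : ι → ℕ := fun i => ⌊f i / δ⌋₊ with hk
  have hinj : Set.InjOn k s := by
    intro i hi j hj hij
    by_contra hne
    have h1 := hsp i hi j hj hne
    have hi' : 0 ≤ f i / δ := div_nonneg (hδ.le.trans (hf i hi).1) hδ.le
    have hj' : 0 ≤ f j / δ := div_nonneg (hδ.le.trans (hf j hj).1) hδ.le
    have a1 := Nat.floor_le hi'
    have a2 := Nat.lt_floor_add_one (f i / δ)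
    have b1 := Nat.floor_le hj'
    have b2 := Nat.lt_floor_add_one (f j / δ)
    have hij' : (⌊f i / δ⌋₊ : ℝ) = ⌊f j / δ⌋₊ := by exact_mod_cast hij
    have : |f i / δ - f j / δ| < 1 := by rw [abs_lt]; constructor <;> linarith
    rw [← sub_div, abs_div, abs_of_pos hδ, div_lt_one hδ] at this
    linarith
  have hterm : ∀ i ∈ s, 1 / f i ≤ 1 / δ * ((k i : ℕ) : ℝ)⁻¹ := by
    intro i hi
    have h1 := (hf i hi).1
    have hi' : 1 ≤ f i / δ := by rwa [le_div_iff₀ hδ, one_mul]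
    have hk1 : 1 ≤ k i := by rw [hk]; exact Nat.le_floor (by simpa using hi')
    have hk0 : (0 : ℝ) < k i := by exact_mod_cast hk1
    have a1 : (k i : ℝ) ≤ f i / δ := Nat.floor_le (by linarith)
    rw [le_div_iff₀ hδ] at a1
    have e : 1 / δ * ((k i : ℕ) : ℝ)⁻¹ = 1 / (k i * δ) := by field_simp
    rw [e]
    exact one_div_le_one_div_of_le (by positivity) a1
  calc ∑ i ∈ s, 1 / f i ≤ ∑ i ∈ s, 1 / δ * ((k i : ℕ) : ℝ)⁻¹ := Finset.sum_le_sum hterm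
    _ = 1 / δ * ∑ i ∈ s, ((k i : ℕ) : ℝ)⁻¹ := by rw [Finset.mul_sum]
    _ = 1 / δ * ∑ m ∈ s.image k, ((m : ℕ) : ℝ)⁻¹ := by rw [Finset.sum_image hinj]
    _ ≤ 1 / δ * ∑ m ∈ Finset.Icc 1 ⌊1 / δ⌋₊, ((m : ℕ) : ℝ)⁻¹ := by
      gcongr
      intro m hm
      obtain ⟨i, hi, rfl⟩ := Finset.mem_image.1 hm
      have h1 := (hf i hi).1
      have hi' : 1 ≤ f i / δ := by rwa [le_div_iff₀ hδ, one_mul]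
      rw [Finset.mem_Icc]
      exact ⟨Nat.le_floor (by simpa using hi'), Nat.floor_le_floor (by have := (hf i hi).2; gcongr)⟩
    _ ≤ 1 / δ * (1 + Real.log (1 / δ)) := by
      gcongr
      have := harmonic_le_one_add_log ⌊1 / δ⌋₊
      rw [harmonic_eq_sum_Icc] at this
      push_cast at this
      refine this.trans ?_
      gcongr
      · exact_mod_cast Nat.floor_pos.2 (by rw [le_div_iff₀ hδ]; linarith)
      · exact Nat.floor_le (by positivity)

lemma fract_neg_eq {x : ℝ} (hx : 0 < Int.fract x) : Int.fract (-x) = 1 - Int.fract x :=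
  Int.fract_neg hx.ne'

lemma le_abs_fract_sub_fract {a b δ : ℝ} (h1 : δ ≤ Int.fract (a - b))
    (h2 : δ ≤ Int.fract (b - a)) : δ ≤ |Int.fract a - Int.fract b| := by
  have key : ∀ a b : ℝ, Int.fract b ≤ Int.fract a →
      Int.fract (a - b) = Int.fract a - Int.fract b := by
    intro a b hab
    rw [Int.fract_eq_iff]
    refine ⟨by linarith, by linarith [Int.fract_lt_one a, Int.fract_nonneg b], ⌊a⌋ - ⌊b⌋, ?_⟩
    push_cast
    rw [← Int.self_sub_floor, ← Int.self_sub_floor]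
    ring
  rcases le_total (Int.fract b) (Int.fract a) with h | h
  · rw [abs_of_nonneg (by linarith), ← key a b h]
    exact h1
  · rw [abs_of_nonpos (by linarith), neg_sub, ← key b a h]
    exact h2

lemma sum_norm_sum_expChar_le {ι : Type*} (s : Finset ι) (α : ι → ℝ) {δ : ℝ} (hδ : 0 < δ)
    (hδ1 : δ ≤ 1) (hsp : ∀ i ∈ s, ∀ j ∈ s, i ≠ j → δ ≤ Int.fract (α i - α j)) (N : ℕ) {r : ι}
    (hr : r ∈ s) :
    ∑ i ∈ s, ‖∑ n ∈ Finset.Icc 1 N, expChar (n * (α r - α i))‖ ≤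
      N + 1 / δ * (1 + Real.log (1 / δ)) := by
  classical
  rw [← Finset.add_sum_erase s _ hr]
  refine add_le_add ?_ ?_
  · simp only [sub_self, mul_zero]
    have : expChar 0 = 1 := by simp [expChar]
    simp [this]
  have hfr : ∀ i ∈ s.erase r, δ ≤ Int.fract (α r - α i) ∧ δ ≤ 1 - Int.fract (α r - α i) := by
    intro i hi
    rw [Finset.mem_erase] at hi
    have h1 := hsp r hr i hi.2 hi.1.symm
    have h2 := hsp i hi.2 r hr hi.1
    refine ⟨h1, ?_⟩
    rwa [← fract_neg_eq (by linarith), neg_sub]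
  have hd : ∀ i ∈ s.erase r, ∀ j ∈ s.erase r, i ≠ j →
      δ ≤ |Int.fract (α r - α i) - Int.fract (α r - α j)| := by
    intro i hi j hj hij
    have h1 := hsp i (Finset.mem_of_mem_erase hi) j (Finset.mem_of_mem_erase hj) hij
    have h2 := hsp j (Finset.mem_of_mem_erase hj) i (Finset.mem_of_mem_erase hi) hij.symm
    apply le_abs_fract_sub_fract
    · rwa [show α r - α i - (α r - α j) = α j - α i by ring]
    · rwa [show α r - α j - (α r - α i) = α i - α j by ring]
  have s1 := sum_one_div_le_of_spaced (s.erase r) (fun i => Int.fract (α r - α i)) hδ hδ1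
    (fun i hi => ⟨(hfr i hi).1, (Int.fract_lt_one _).le⟩) hd
  have s2 := sum_one_div_le_of_spaced (s.erase r) (fun i => 1 - Int.fract (α r - α i)) hδ hδ1
    (fun i hi => ⟨(hfr i hi).2, by linarith [Int.fract_nonneg (α r - α i)]⟩) (by
      intro i hi j hj hij
      rw [show ∀ a b : ℝ, 1 - a - (1 - b) = -(a - b) by intros; ring, abs_neg]
      exact hd i hi j hj hij)
  calc _ ≤ ∑ i ∈ s.erase r, (1 / 2 * (1 / Int.fract (α r - α i)) +
        1 / 2 * (1 / (1 - Int.fract (α r - α i)))) := by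
        refine Finset.sum_le_sum fun i hi => ?_
        rw [← mul_add]
        exact norm_sum_expChar_le N _ (by linarith [(hfr i hi).1])
    _ ≤ _ := by
      rw [Finset.sum_add_distrib, ← Finset.mul_sum, ← Finset.mul_sum]
      linarith

/-- The dual form of the large sieve inequality. -/
lemma sum_norm_sq_dual_le {ι : Type*} (s : Finset ι) (α : ι → ℝ) {δ : ℝ} (hδ : 0 < δ)
    (hδ1 : δ ≤ 1) (hsp : ∀ i ∈ s, ∀ j ∈ s, i ≠ j → δ ≤ Int.fract (α i - α j)) (N : ℕ)
    (b : ι → ℂ) :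
    ∑ n ∈ Finset.Icc 1 N, ‖∑ i ∈ s, b i * expChar (n * α i)‖ ^ 2 ≤
      (N + 1 / δ * (1 + Real.log (1 / δ))) * ∑ i ∈ s, ‖b i‖ ^ 2 := by
  set Δ := (N : ℝ) + 1 / δ * (1 + Real.log (1 / δ)) with hΔ
  set D : ι → ι → ℂ := fun i j => ∑ n ∈ Finset.Icc 1 N, expChar (n * (α i - α j)) with hD
  have hsym : ∀ i j, ‖D i j‖ = ‖D j i‖ := by
    intro i j
    rw [← Complex.norm_conj (D i j), hD]
    simp only [map_sum, conj_expChar]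
    congr 1
    refine Finset.sum_congr rfl fun n _ => ?_
    congr 1
    ring
  have hexp : ((∑ n ∈ Finset.Icc 1 N, ‖∑ i ∈ s, b i * expChar (n * α i)‖ ^ 2 : ℝ) : ℂ) =
      ∑ i ∈ s, ∑ j ∈ s, b i * (starRingEnd ℂ) (b j) * D i j := by
    push_cast
    have : ∀ n ∈ Finset.Icc 1 N, ((‖∑ i ∈ s, b i * expChar (n * α i)‖ : ℂ)) ^ 2 =
        ∑ i ∈ s, ∑ j ∈ s, b i * (starRingEnd ℂ) (b j) * expChar (n * (α i - α j)) := by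
      intro n _
      rw [← Complex.mul_conj', map_sum, Finset.sum_mul_sum]
      refine Finset.sum_congr rfl fun i _ => Finset.sum_congr rfl fun j _ => ?_
      rw [map_mul, conj_expChar, show (n : ℝ) * (α i - α j) = n * α i + -(n * α j) by ring,
        expChar_add]
      ring
    rw [Finset.sum_congr rfl this, Finset.sum_comm]
    refine Finset.sum_congr rfl fun i _ => ?_
    rw [Finset.sum_comm]
    refine Finset.sum_congr rfl fun j _ => ?_
    rw [hD, Finset.mul_sum]
  have hnn : 0 ≤ ∑ n ∈ Finset.Icc 1 N, ‖∑ i ∈ s, b i * expChar (n * α i)‖ ^ 2 :=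
    Finset.sum_nonneg fun _ _ => by positivity
  rw [← abs_of_nonneg hnn, ← Real.norm_eq_abs, ← Complex.norm_real, hexp]
  calc ‖∑ i ∈ s, ∑ j ∈ s, b i * (starRingEnd ℂ) (b j) * D i j‖
      ≤ ∑ i ∈ s, ∑ j ∈ s, ‖b i * (starRingEnd ℂ) (b j) * D i j‖ :=
        (norm_sum_le _ _).trans (Finset.sum_le_sum fun i _ => norm_sum_le _ _)
    _ ≤ ∑ i ∈ s, ∑ j ∈ s, (1 / 2 * (‖b i‖ ^ 2 * ‖D i j‖) + 1 / 2 * (‖b j‖ ^ 2 * ‖D j i‖)) := by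
        refine Finset.sum_le_sum fun i _ => Finset.sum_le_sum fun j _ => ?_
        rw [norm_mul, norm_mul, Complex.norm_conj, hsym j i]
        nlinarith [mul_nonneg (norm_nonneg (D i j)) (sq_nonneg (‖b i‖ - ‖b j‖))]
    _ = ∑ i ∈ s, ‖b i‖ ^ 2 * ∑ j ∈ s, ‖D i j‖ := by
        simp only [Finset.sum_add_distrib]
        rw [Finset.sum_comm (f := fun i j => 1 / 2 * (‖b j‖ ^ 2 * ‖D j i‖)), ← two_mul,
          Finset.mul_sum]
        refine Finset.sum_congr rfl fun i _ => ?_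
        rw [Finset.mul_sum, Finset.mul_sum]
        refine Finset.sum_congr rfl fun j _ => ?_
        ring
    _ ≤ ∑ i ∈ s, ‖b i‖ ^ 2 * Δ := by
        refine Finset.sum_le_sum fun i hi => ?_
        have := sum_norm_sum_expChar_le s α hδ hδ1 hsp N hi
        gcongr
    _ = Δ * ∑ i ∈ s, ‖b i‖ ^ 2 := by rw [← Finset.sum_mul, mul_comm]

/-- The large sieve inequality (with a logarithmic loss). -/
lemma large_sieve {ι : Type*} (s : Finset ι) (α : ι → ℝ) {δ : ℝ} (hδ : 0 < δ)
    (hδ1 : δ ≤ 1) (hsp : ∀ i ∈ s, ∀ j ∈ s, i ≠ j → δ ≤ Int.fract (α i - α j)) (N : ℕ)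
    (a : ℕ → ℂ) :
    ∑ i ∈ s, ‖∑ n ∈ Finset.Icc 1 N, a n * expChar (n * α i)‖ ^ 2 ≤
      (N + 1 / δ * (1 + Real.log (1 / δ))) * ∑ n ∈ Finset.Icc 1 N, ‖a n‖ ^ 2 := by
  set Δ := (N : ℝ) + 1 / δ * (1 + Real.log (1 / δ)) with hΔ
  set S : ι → ℂ := fun i => ∑ n ∈ Finset.Icc 1 N, a n * expChar (n * α i) with hS
  set X := ∑ i ∈ s, ‖S i‖ ^ 2 with hX
  have hX0 : 0 ≤ X := Finset.sum_nonneg fun _ _ => by positivity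
  set c : ℕ → ℂ := fun n => ∑ i ∈ s, (starRingEnd ℂ) (S i) * expChar (n * α i) with hc
  have hdual : ∑ n ∈ Finset.Icc 1 N, ‖c n‖ ^ 2 ≤ Δ * X := by
    have := sum_norm_sq_dual_le s α hδ hδ1 hsp N fun i => (starRingEnd ℂ) (S i)
    simpa only [Complex.norm_conj] using this
  have hXe : (X : ℂ) = ∑ n ∈ Finset.Icc 1 N, a n * c n := by
    rw [hX]
    push_cast
    simp only [hc, Finset.mul_sum]
    rw [Finset.sum_comm]
    refine Finset.sum_congr rfl fun i _ => ?_
    rw [← Complex.conj_mul', hS, Finset.mul_sum]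
    refine Finset.sum_congr rfl fun n _ => ?_
    ring
  have hXle : X ≤ ∑ n ∈ Finset.Icc 1 N, ‖a n‖ * ‖c n‖ := by
    rw [← abs_of_nonneg hX0, ← Real.norm_eq_abs, ← Complex.norm_real, hXe]
    refine (norm_sum_le _ _).trans_eq (Finset.sum_congr rfl fun n _ => norm_mul _ _)
  have hA0 : 0 ≤ ∑ n ∈ Finset.Icc 1 N, ‖a n‖ ^ 2 := Finset.sum_nonneg fun _ _ => by positivity
  have hsq : X ^ 2 ≤ (∑ n ∈ Finset.Icc 1 N, ‖a n‖ ^ 2) * (Δ * X) := by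
    calc X ^ 2 ≤ (∑ n ∈ Finset.Icc 1 N, ‖a n‖ * ‖c n‖) ^ 2 := by gcongr
      _ ≤ _ := Finset.sum_mul_sq_le_sq_mul_sq _ _ _
      _ ≤ _ := by gcongr
  rcases hX0.eq_or_lt with h | h
  · rw [← h]
    have : 0 ≤ Real.log (1 / δ) := Real.log_nonneg (by rw [le_div_iff₀ hδ]; linarith)
    positivity
  · nlinarith

lemma sum_eq_sum_units {d : ℕ} [NeZero d] {g : ZMod d → ℂ} (hg : ∀ x, ¬IsUnit x → g x = 0) :
    ∑ x, g x = ∑ u : (ZMod d)ˣ, g u := by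
  refine (Fintype.sum_of_injective (fun u : (ZMod d)ˣ => (u : ZMod d)) Units.val_injective _ _
    (fun x hx => hg x fun h => hx ⟨h.unit, rfl⟩) fun u => rfl).symm

lemma norm_gaussSum_sq {d : ℕ} [NeZero d] {χ : DirichletCharacter ℂ d} (hχ : χ.IsPrimitive) :
    ‖gaussSum χ (ZMod.stdAddChar (N := d))‖ ^ 2 = d := by
  set τ := gaussSum χ (ZMod.stdAddChar (N := d)) with hτ
  set e := ZMod.stdAddChar (N := d) with he
  have hconj : ∀ x : ZMod d, (starRingEnd ℂ) (e x) = e (-x) := fun x => by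
    rw [AddChar.map_neg_eq_conj]
  have hunits : ∑ x : ZMod d, ((‖χ x‖ ^ 2 : ℝ) : ℂ) = d.totient := by
    rw [sum_eq_sum_units fun x hx => by rw [MulChar.map_nonunit χ hx]; simp]
    simp_rw [DirichletCharacter.unit_norm_eq_one]
    simp [ZMod.card_units_eq_totient]
  have h1 : ∑ a : ZMod d, ((‖gaussSum χ (e.mulShift a)‖ ^ 2 : ℝ) : ℂ) =
      d.totient * (‖τ‖ ^ 2 : ℝ) := by
    rw [← hunits, Finset.sum_mul]
    refine Finset.sum_congr rfl fun a _ => ?_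
    rw [gaussSum_mulShift_of_isPrimitive e hχ a, norm_mul, mul_pow, ← MulChar.star_apply',
      norm_star]
    push_cast
    ring
  have h2 : ∑ a : ZMod d, ((‖gaussSum χ (e.mulShift a)‖ ^ 2 : ℝ) : ℂ) = d.totient * d := by
    have : ∀ a : ZMod d, ((‖gaussSum χ (e.mulShift a)‖ ^ 2 : ℝ) : ℂ) =
        ∑ b : ZMod d, ∑ c : ZMod d, χ b * (starRingEnd ℂ) (χ c) * e (a * (b - c)) := by
      intro a
      rw [ofReal_pow, ← Complex.mul_conj', gaussSum, map_sum, Finset.sum_mul_sum]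
      refine Finset.sum_congr rfl fun b _ => Finset.sum_congr rfl fun c _ => ?_
      rw [map_mul, AddChar.mulShift_apply, AddChar.mulShift_apply, hconj, mul_sub, sub_eq_add_neg,
        AddChar.map_add_eq_mul]
      ring
    rw [Finset.sum_congr rfl fun a _ => this a, Finset.sum_comm, ← hunits, Finset.sum_mul]
    refine Finset.sum_congr rfl fun b _ => ?_
    rw [Finset.sum_comm]
    have hs : ∀ c : ZMod d, ∑ a : ZMod d, χ b * (starRingEnd ℂ) (χ c) * e (a * (b - c)) =
        χ b * (starRingEnd ℂ) (χ c) * ((if b = c then d else 0 : ℕ) : ℂ) := by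
      intro c
      rw [← Finset.mul_sum, AddChar.sum_mulShift _ (ZMod.isPrimitive_stdAddChar d), ZMod.card]
      simp only [sub_eq_zero]
    rw [Finset.sum_congr rfl fun c _ => hs c]
    rw [Finset.sum_eq_single b]
    · rw [if_pos rfl, Complex.mul_conj']
      push_cast
      ring
    · intro c _ hc
      rw [if_neg (Ne.symm hc)]
      simp
    · simp
  have hφ : (d.totient : ℂ) ≠ 0 := by
    exact_mod_cast (Nat.totient_pos.2 (NeZero.pos d)).ne'
  have := mul_left_cancel₀ hφ (h1.symm.trans h2)
  exact_mod_cast this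

lemma sum_norm_sq_sum_char {d : ℕ} [NeZero d] (f : (ZMod d)ˣ → ℂ) :
    ∑ χ : DirichletCharacter ℂ d, ‖∑ u : (ZMod d)ˣ, χ u * f u‖ ^ 2 =
      d.totient * ∑ u : (ZMod d)ˣ, ‖f u‖ ^ 2 := by
  have key : ((∑ χ : DirichletCharacter ℂ d, ‖∑ u : (ZMod d)ˣ, χ u * f u‖ ^ 2 : ℝ) : ℂ) =
      ((d.totient * ∑ u : (ZMod d)ˣ, ‖f u‖ ^ 2 : ℝ) : ℂ) := by
    push_cast
    have : ∀ χ : DirichletCharacter ℂ d, (‖∑ u : (ZMod d)ˣ, χ u * f u‖ : ℂ) ^ 2 =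
        ∑ v : (ZMod d)ˣ, ∑ u : (ZMod d)ˣ,
          (f u * (starRingEnd ℂ) (f v)) * (χ (v : ZMod d)⁻¹ * χ u) := by
      intro χ
      rw [← Complex.conj_mul', map_sum, Finset.sum_mul_sum]
      refine Finset.sum_congr rfl fun v _ => Finset.sum_congr rfl fun u _ => ?_
      have : (starRingEnd ℂ) (χ v) = χ (v : ZMod d)⁻¹ := by
        rw [starRingEnd_apply, MulChar.star_apply', MulChar.inv_apply, Ring.inverse_unit,
          ZMod.inv_coe_unit]
      rw [map_mul, this]
      ring
    rw [Finset.sum_congr rfl fun χ _ => this χ, Finset.sum_comm, Finset.mul_sum]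
    refine Finset.sum_congr rfl fun v _ => ?_
    rw [Finset.sum_comm]
    simp_rw [← Finset.mul_sum, DirichletCharacter.sum_char_inv_mul_char_eq ℂ v.isUnit]
    rw [Finset.sum_eq_single v]
    · rw [if_pos rfl, Complex.mul_conj']
      ring
    · intro u _ hu
      rw [if_neg fun h => hu (Units.ext h).symm, mul_zero]
    · simp
  exact_mod_cast key

instance finite_dirichletCharacter (d : ℕ) : Finite (DirichletCharacter ℂ d) := by
  rcases Nat.eq_zero_or_pos d with rfl | h
  · exact inferInstanceAs (Finite (MulChar ℤ ℂ))
  · have : NeZero d := ⟨h.ne'⟩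
    infer_instance

/-- The primitive Dirichlet characters modulo `d`. -/
noncomputable def primChars (d : ℕ) : Finset (DirichletCharacter ℂ d) :=
  (Set.toFinite {χ : DirichletCharacter ℂ d | χ.IsPrimitive}).toFinset

lemma mem_primChars {d : ℕ} {χ : DirichletCharacter ℂ d} : χ ∈ primChars d ↔ χ.IsPrimitive := by
  simp [primChars]

lemma stdAddChar_mul_natCast {d : ℕ} [NeZero d] (u : ZMod d) (n : ℕ) :
    ZMod.stdAddChar (u * (n : ZMod d)) = expChar (n * (u.val / d : ℝ)) := by
  have h : u * n = ((u.val * n : ℤ) : ZMod d) := by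
    push_cast
    rw [ZMod.natCast_zmod_val]
  rw [h, ZMod.stdAddChar_coe, expChar]
  congr 1
  push_cast
  ring

lemma card_mul_norm_sum_sq {d : ℕ} [NeZero d] {χ : DirichletCharacter ℂ d} (hχ : χ.IsPrimitive)
    (N : ℕ) (a : ℕ → ℂ) :
    d * ‖∑ n ∈ Finset.Icc 1 N, a n * χ⁻¹ n‖ ^ 2 =
      ‖∑ u : (ZMod d)ˣ, χ u * ∑ n ∈ Finset.Icc 1 N,
          a n * expChar (n * (u.val.val / d : ℝ))‖ ^ 2 := by
  have h : ∀ n : ℕ, gaussSum χ (ZMod.stdAddChar (N := d)) * (a n * χ⁻¹ n) =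
      ∑ u : (ZMod d)ˣ, χ u * (a n * expChar (n * (u.val.val / d : ℝ))) := by
    intro n
    rw [mul_left_comm, mul_comm (gaussSum _ _), ← gaussSum_mulShift_of_isPrimitive _ hχ, gaussSum,
      Finset.mul_sum, sum_eq_sum_units fun x hx => by rw [MulChar.map_nonunit χ hx]; simp]
    refine Finset.sum_congr rfl fun u _ => ?_
    rw [AddChar.mulShift_apply, mul_comm (n : ZMod d), stdAddChar_mul_natCast]
    ring
  have h2 : gaussSum χ (ZMod.stdAddChar (N := d)) * ∑ n ∈ Finset.Icc 1 N, a n * χ⁻¹ n =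
      ∑ u : (ZMod d)ˣ, χ u * ∑ n ∈ Finset.Icc 1 N, a n * expChar (n * (u.val.val / d : ℝ)) := by
    simp_rw [Finset.mul_sum, h]
    rw [Finset.sum_comm]
  rw [← h2, norm_mul, mul_pow, norm_gaussSum_sq hχ]


/-- The reduced fractions `a / d` with `1 ≤ d ≤ R`, as pairs `⟨d, a⟩`. -/
def fareyPairs (R : ℕ) : Finset (Σ _ : ℕ, ℕ) :=
  (Finset.Icc 1 R).sigma fun d => (Finset.range d).filter fun a => a.Coprime d

lemma le_fract_sub_of_mem_fareyPairs {R : ℕ} {i j : Σ _ : ℕ, ℕ} (hi : i ∈ fareyPairs R)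
    (hj : j ∈ fareyPairs R) (hij : i ≠ j) :
    1 / (R : ℝ) ^ 2 ≤ Int.fract ((i.2 / i.1 : ℝ) - (j.2 / j.1 : ℝ)) := by
  obtain ⟨d, a⟩ := i
  obtain ⟨d', a'⟩ := j
  simp only [fareyPairs, Finset.mem_sigma, Finset.mem_Icc, Finset.mem_filter,
    Finset.mem_range] at hi hj ⊢
  obtain ⟨⟨hd1, hdR⟩, had, hcop⟩ := hi
  obtain ⟨⟨hd1', hdR'⟩, had', hcop'⟩ := hj
  have hd0 : (0 : ℝ) < d := by exact_mod_cast hd1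
  have hd0' : (0 : ℝ) < d' := by exact_mod_cast hd1'
  set x : ℝ := a / d - a' / d' with hx
  set m : ℤ := a * d' - a' * d - ⌊x⌋ * (d * d') with hm
  have hfm : Int.fract x * (d * d') = m := by
    rw [← Int.self_sub_floor, hm]
    push_cast
    rw [sub_mul, hx]
    congr 1
    field_simp
  have hm0 : 0 ≤ m := by
    have : (0 : ℝ) ≤ m := by
      rw [← hfm]
      exact mul_nonneg (Int.fract_nonneg x) (by positivity)
    exact_mod_cast this
  have hm1 : 1 ≤ m := by
    by_contra hlt
    have hm00 : m = 0 := by omega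
    have hx0 : Int.fract x = 0 := by
      rw [hm00, Int.cast_zero] at hfm
      rcases mul_eq_zero.1 hfm with h | h
      · exact h
      · exact absurd h (by positivity)
    have hxlt : |x| < 1 := by
      have b1 : (a : ℝ) / d < 1 := by rw [div_lt_one hd0]; exact_mod_cast had
      have b2 : (a' : ℝ) / d' < 1 := by rw [div_lt_one hd0']; exact_mod_cast had'
      have b3 : 0 ≤ (a : ℝ) / d := by positivity
      have b4 : 0 ≤ (a' : ℝ) / d' := by positivity
      rw [abs_lt]
      constructor <;> linarith
    have hfl : (⌊x⌋ : ℝ) = x := by have := Int.self_sub_floor x; linarith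
    have hfl0 : ⌊x⌋ = 0 := by
      rw [← hfl] at hxlt
      have : |⌊x⌋| < 1 := by exact_mod_cast hxlt
      exact Int.abs_lt_one_iff.1 this
    rw [hm, hfl0] at hm00
    have heq : a * d' = a' * d := by
      have : (a * d' : ℤ) = a' * d := by linarith
      exact_mod_cast this
    have e1 : d ∣ d' := (hcop.symm.dvd_of_dvd_mul_left (Dvd.intro_left a' heq.symm))
    have e2 : d' ∣ d := (hcop'.symm.dvd_of_dvd_mul_left (Dvd.intro_left a heq))
    have e3 : d = d' := Nat.dvd_antisymm e1 e2
    subst e3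
    have e4 : a = a' := Nat.eq_of_mul_eq_mul_right hd1 heq
    exact hij (by rw [e4])
  have hR0 : (0 : ℝ) < R := by exact_mod_cast lt_of_lt_of_le hd1 hdR
  have hm1' : (1 : ℝ) ≤ m := by exact_mod_cast hm1
  calc 1 / (R : ℝ) ^ 2 ≤ 1 / (d * d') := by
        apply one_div_le_one_div_of_le (by positivity)
        rw [sq]
        gcongr
    _ ≤ m / (d * d') := by gcongr
    _ = Int.fract x := by rw [← hfm]; field_simp

lemma primChars_sum_le {d : ℕ} (hd : 1 ≤ d) (N : ℕ) (a : ℕ → ℂ) :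
    (d / d.totient : ℝ) * ∑ χ ∈ primChars d, ‖∑ n ∈ Finset.Icc 1 N, a n * χ⁻¹ n‖ ^ 2 ≤
      ∑ k ∈ (Finset.range d).filter fun a => a.Coprime d,
        ‖∑ n ∈ Finset.Icc 1 N, a n * expChar (n * (k / d : ℝ))‖ ^ 2 := by
  have : NeZero d := ⟨by omega⟩
  have hφ : (0 : ℝ) < d.totient := by exact_mod_cast Nat.totient_pos.2 hd
  set S : ℕ → ℂ := fun k => ∑ n ∈ Finset.Icc 1 N, a n * expChar (n * (k / d : ℝ)) with hS
  rw [div_mul_eq_mul_div, div_le_iff₀ hφ, Finset.mul_sum]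
  calc ∑ χ ∈ primChars d, d * ‖∑ n ∈ Finset.Icc 1 N, a n * χ⁻¹ n‖ ^ 2
      = ∑ χ ∈ primChars d, ‖∑ u : (ZMod d)ˣ, χ u * S u.val.val‖ ^ 2 :=
        Finset.sum_congr rfl fun χ hχ => card_mul_norm_sum_sq (mem_primChars.1 hχ) N a
    _ ≤ ∑ χ : DirichletCharacter ℂ d, ‖∑ u : (ZMod d)ˣ, χ u * S u.val.val‖ ^ 2 :=
        Finset.sum_le_sum_of_subset_of_nonneg (Finset.subset_univ _) fun _ _ _ => by positivity
    _ = d.totient * ∑ u : (ZMod d)ˣ, ‖S u.val.val‖ ^ 2 := sum_norm_sq_sum_char _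
    _ = d.totient * ∑ k ∈ Finset.univ.image (fun u : (ZMod d)ˣ => u.val.val), ‖S k‖ ^ 2 := by
        rw [Finset.sum_image]
        intro u _ v _ huv
        exact Units.ext (ZMod.val_injective d huv)
    _ ≤ d.totient * ∑ k ∈ (Finset.range d).filter fun a => a.Coprime d, ‖S k‖ ^ 2 := by
        gcongr
        intro k hk
        obtain ⟨u, -, rfl⟩ := Finset.mem_image.1 hk
        rw [Finset.mem_filter, Finset.mem_range]
        exact ⟨ZMod.val_lt _, ZMod.val_coe_unit_coprime u⟩
    _ = _ := mul_comm _ _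

/-- The large sieve inequality for primitive characters. -/
lemma large_sieve_char {R : ℕ} (hR : 1 ≤ R) (N : ℕ) (a : ℕ → ℂ) :
    ∑ d ∈ Finset.Icc 1 R, (d / d.totient : ℝ) *
        ∑ χ ∈ primChars d, ‖∑ n ∈ Finset.Icc 1 N, a n * χ n‖ ^ 2 ≤
      (N + R ^ 2 * (1 + 2 * Real.log R)) * ∑ n ∈ Finset.Icc 1 N, ‖a n‖ ^ 2 := by
  set b : ℕ → ℂ := fun n => (starRingEnd ℂ) (a n) with hb
  have hR' : (1 : ℝ) ≤ R := by exact_mod_cast hR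
  have hconj : ∀ (d : ℕ) (χ : DirichletCharacter ℂ d),
      ‖∑ n ∈ Finset.Icc 1 N, a n * χ n‖ = ‖∑ n ∈ Finset.Icc 1 N, b n * χ⁻¹ n‖ := by
    intro d χ
    rw [← Complex.norm_conj, map_sum]
    congr 1
    refine Finset.sum_congr rfl fun n _ => ?_
    rw [map_mul, ← MulChar.star_apply']
    rfl
  have hls := large_sieve (fareyPairs R) (fun i => (i.2 / i.1 : ℝ)) (δ := 1 / (R : ℝ) ^ 2)
    (by positivity) (by rw [div_le_one (by positivity)]; exact one_le_pow₀ hR')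
    (fun i hi j hj hij => le_fract_sub_of_mem_fareyPairs hi hj hij) N b
  rw [one_div_one_div, Real.log_pow, fareyPairs, Finset.sum_sigma] at hls
  calc _ ≤ ∑ d ∈ Finset.Icc 1 R, ∑ k ∈ (Finset.range d).filter fun a => a.Coprime d,
        ‖∑ n ∈ Finset.Icc 1 N, b n * expChar (n * (k / d : ℝ))‖ ^ 2 := by
        refine Finset.sum_le_sum fun d hd => ?_
        simp_rw [hconj]
        exact primChars_sum_le (Finset.mem_Icc.1 hd).1 N b
    _ ≤ _ := by
        refine hls.trans_eq ?_
        simp [hb]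

/-- The truncation of an arithmetic function to `n ≤ U`. -/
noncomputable def truncLe (U : ℕ) (f : ArithmeticFunction ℝ) : ArithmeticFunction ℝ :=
  ⟨fun n => if n ≤ U then f n else 0, by simp⟩

/-- The truncation of an arithmetic function to `U < n`. -/
noncomputable def truncGt (U : ℕ) (f : ArithmeticFunction ℝ) : ArithmeticFunction ℝ :=
  ⟨fun n => if U < n then f n else 0, by simp⟩

lemma truncLe_apply (U : ℕ) (f : ArithmeticFunction ℝ) (n : ℕ) :
    truncLe U f n = if n ≤ U then f n else 0 := rfl

lemma truncGt_apply (U : ℕ) (f : ArithmeticFunction ℝ) (n : ℕ) :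
    truncGt U f n = if U < n then f n else 0 := rfl

lemma truncLe_add_truncGt (U : ℕ) (f : ArithmeticFunction ℝ) :
    truncLe U f + truncGt U f = f := by
  ext n
  rw [ArithmeticFunction.add_apply, truncLe_apply, truncGt_apply]
  rcases le_or_gt n U with h | h
  · simp [h]
  · simp [h, not_le.2 h]

/-- The Moebius function with real values. -/
noncomputable def realMoebius : ArithmeticFunction ℝ :=
    (ArithmeticFunction.moebius : ArithmeticFunction ℝ)

/-- The zeta arithmetic function with real values. -/
noncomputable def realZeta : ArithmeticFunction ℝ :=
    (ArithmeticFunction.zeta : ArithmeticFunction ℝ)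

lemma vaughan_identity (U V : ℕ) :
    ArithmeticFunction.vonMangoldt +
      truncLe U realMoebius * truncLe V ArithmeticFunction.vonMangoldt * realZeta =
      truncLe V ArithmeticFunction.vonMangoldt +
      truncLe U realMoebius * ArithmeticFunction.log +
      truncGt U realMoebius * (truncGt V ArithmeticFunction.vonMangoldt * realZeta) := by
  have h1 := truncLe_add_truncGt U realMoebius
  have h2 := truncLe_add_truncGt V ArithmeticFunction.vonMangoldt
  have h3 : ArithmeticFunction.vonMangoldt * realZeta = ArithmeticFunction.log :=
    ArithmeticFunction.vonMangoldt_mul_zeta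
  have h4 : realMoebius * realZeta = 1 := ArithmeticFunction.coe_moebius_mul_coe_zeta
  set a := truncLe U realMoebius
  set a' := truncGt U realMoebius
  set b := truncLe V ArithmeticFunction.vonMangoldt
  set b' := truncGt V ArithmeticFunction.vonMangoldt
  linear_combination (a * realZeta - 1) * h2 + a * h3 - b' * h4 - b' * realZeta * h1

/-- The twist of an arithmetic function by a Dirichlet character. -/
noncomputable def charTwist {q : ℕ} (χ : DirichletCharacter ℂ q) (f : ArithmeticFunction ℝ) :
    ArithmeticFunction ℂ :=
  ⟨fun n => f n * χ n, by simp⟩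

lemma charTwist_apply {q : ℕ} (χ : DirichletCharacter ℂ q) (f : ArithmeticFunction ℝ) (n : ℕ) :
    charTwist χ f n = f n * χ n := rfl

lemma charTwist_mul {q : ℕ} (χ : DirichletCharacter ℂ q) (f g : ArithmeticFunction ℝ) :
    charTwist χ (f * g) = charTwist χ f * charTwist χ g := by
  ext n
  rw [charTwist_apply, ArithmeticFunction.mul_apply, ArithmeticFunction.mul_apply]
  push_cast
  rw [Finset.sum_mul]
  refine Finset.sum_congr rfl fun x hx => ?_
  rw [charTwist_apply, charTwist_apply, ← (Nat.mem_divisorsAntidiagonal.1 hx).1]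
  push_cast
  rw [map_mul]
  ring

lemma norm_charTwist_le {q : ℕ} (χ : DirichletCharacter ℂ q) (f : ArithmeticFunction ℝ) (n : ℕ) :
    ‖charTwist χ f n‖ ≤ |f n| := by
  rw [charTwist_apply, norm_mul, Complex.norm_real, Real.norm_eq_abs]
  exact mul_le_of_le_one_right (abs_nonneg _) (χ.norm_le_one _)

/-- The sum of a twisted arithmetic function. -/
noncomputable def charSum {q : ℕ} (χ : DirichletCharacter ℂ q) (f : ArithmeticFunction ℝ) (N : ℕ) :
    ℂ := ∑ n ∈ Finset.Ioc 0 N, charTwist χ f n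

lemma charSum_mul {q : ℕ} (χ : DirichletCharacter ℂ q) (f g : ArithmeticFunction ℝ) (N : ℕ) :
    charSum χ (f * g) N = ∑ n ∈ Finset.Ioc 0 N, charTwist χ f n * charSum χ g (N / n) := by
  rw [charSum, charTwist_mul, ArithmeticFunction.sum_Ioc_mul_eq_sum_sum]
  rfl

lemma norm_sum_Ioc_le_of_support {F : ℕ → ℂ} {N U : ℕ} {c : ℝ} (hc : 0 ≤ c)
    (h : ∀ n, 0 < n → n ≤ N → ‖F n‖ ≤ c) (h0 : ∀ n, U < n → F n = 0) :
    ‖∑ n ∈ Finset.Ioc 0 N, F n‖ ≤ U * c := by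
  calc ‖∑ n ∈ Finset.Ioc 0 N, F n‖ = ‖∑ n ∈ (Finset.Ioc 0 N).filter (· ≤ U), F n‖ := by
        rw [Finset.sum_filter_of_ne]
        intro n _ hn
        by_contra hlt
        exact hn (h0 n (not_le.1 hlt))
    _ ≤ ∑ n ∈ (Finset.Ioc 0 N).filter (· ≤ U), c := by
        refine norm_sum_le_of_le _ fun n hn => ?_
        rw [Finset.mem_filter, Finset.mem_Ioc] at hn
        exact h n hn.1.1 hn.1.2
    _ ≤ ∑ n ∈ Finset.Ioc 0 U, c := by
        refine Finset.sum_le_sum_of_subset_of_nonneg (fun n hn => ?_) fun _ _ _ => hc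
        rw [Finset.mem_filter, Finset.mem_Ioc] at hn
        rw [Finset.mem_Ioc]
        exact ⟨hn.1.1, hn.2⟩
    _ = U * c := by simp

lemma norm_charSum_zeta_le {q : ℕ} [NeZero q] {χ : DirichletCharacter ℂ q} (hχ : χ ≠ 1) (N : ℕ) :
    ‖charSum χ realZeta N‖ ≤ 5 * q := by
  rcases Nat.eq_zero_or_pos N with rfl | hN
  · simp [charSum]
  have := norm_sum_char_sub_le χ 0 N (by exact_mod_cast hN)
  rw [charMean_eq_zero hχ, zero_mul, Nat.floor_natCast] at this
  rw [sub_zero] at this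
  refine le_trans (le_of_eq ?_) this
  rw [charSum]
  congr 1
  refine Finset.sum_congr rfl fun n hn => ?_
  rw [charTwist_apply, realZeta, ArithmeticFunction.natCoe_apply,
    ArithmeticFunction.zeta_apply_ne (Finset.mem_Ioc.1 hn).1.ne']
  simp

lemma norm_charSum_log_le {q : ℕ} [NeZero q] {χ : DirichletCharacter ℂ q} (hχ : χ ≠ 1) (N : ℕ) :
    ‖charSum χ ArithmeticFunction.log N‖ ≤ 10 * q * Real.log N := by
  rcases Nat.eq_zero_or_pos N with rfl | hN
  · simp [charSum]
  have hz : ∀ n : ℕ, ‖∑ k ∈ Finset.Ioc 0 n, χ k‖ ≤ 5 * q := by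
    intro n
    refine le_trans (le_of_eq ?_) (norm_charSum_zeta_le hχ n)
    rw [charSum]
    congr 1
    refine Finset.sum_congr rfl fun n hn => ?_
    rw [charTwist_apply, realZeta, ArithmeticFunction.natCoe_apply,
      ArithmeticFunction.zeta_apply_ne (Finset.mem_Ioc.1 hn).1.ne']
    simp
  have hw := norm_sum_mul_antitone_le (b := fun n => χ n)
    (w := fun n => max 0 (Real.log N - Real.log n)) (M := 0) (D := 5 * q) (by
      intro m n hm hmn
      have : Real.log m ≤ Real.log n := Real.log_le_log (by exact_mod_cast hm)
          (by exact_mod_cast hmn)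
      exact max_le_max le_rfl (by linarith)) (fun _ _ => le_max_left _ _) hN (fun n _ _ => hz n)
  have hlogN : 0 ≤ Real.log N := Real.log_natCast_nonneg N
  simp only [zero_add, Nat.cast_one, Real.log_one, sub_zero, max_eq_right hlogN] at hw
  have e : charSum χ ArithmeticFunction.log N = Real.log N * ∑ k ∈ Finset.Ioc 0 N, χ k -
      ∑ j ∈ Finset.Ioc 0 N, χ j * ((max 0 (Real.log N - Real.log j) : ℝ) : ℂ) := by
    rw [charSum, Finset.mul_sum, ← Finset.sum_sub_distrib]
    refine Finset.sum_congr rfl fun n hn => ?_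
    have hn' := Finset.mem_Ioc.1 hn
    have : Real.log n ≤ Real.log N := Real.log_le_log (by exact_mod_cast hn'.1)
        (by exact_mod_cast hn'.2)
    rw [charTwist_apply, max_eq_right (by linarith), ArithmeticFunction.log_apply]
    push_cast
    ring
  rw [e]
  refine (norm_sub_le _ _).trans ?_
  rw [norm_mul, Complex.norm_real, Real.norm_eq_abs, abs_of_nonneg hlogN]
  have := mul_le_mul_of_nonneg_left (hz N) hlogN
  linarith

lemma abs_realMoebius_le (n : ℕ) : |realMoebius n| ≤ 1 := by
  rw [realMoebius, ArithmeticFunction.intCoe_apply]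
  exact_mod_cast ArithmeticFunction.abs_moebius_le_one

lemma abs_truncLe_moebius_mul_le (U V n : ℕ) :
    |(truncLe U realMoebius * truncLe V ArithmeticFunction.vonMangoldt) n| ≤ Real.log n := by
  rw [← ArithmeticFunction.log_apply, ← ArithmeticFunction.zeta_mul_vonMangoldt,
    ArithmeticFunction.mul_apply, ArithmeticFunction.mul_apply]
  refine (Finset.abs_sum_le_sum_abs _ _).trans (Finset.sum_le_sum fun x hx => ?_)
  rw [abs_mul, ArithmeticFunction.natCoe_apply, ArithmeticFunction.zeta_apply_ne
    (Nat.ne_zero_of_mem_divisorsAntidiagonal hx).1]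
  gcongr
  · rw [truncLe_apply]
    split_ifs
    · simpa using abs_realMoebius_le x.1
    · simp
  · rw [truncLe_apply]
    split_ifs
    · rw [abs_of_nonneg ArithmeticFunction.vonMangoldt_nonneg]
    · simp

lemma truncLe_mul_eq_zero {U V n : ℕ} (f g : ArithmeticFunction ℝ) (hn : U * V < n) :
    (truncLe U f * truncLe V g) n = 0 := by
  rw [ArithmeticFunction.mul_apply]
  refine Finset.sum_eq_zero fun x hx => ?_
  have hx1 := (Nat.mem_divisorsAntidiagonal.1 hx).1
  rw [truncLe_apply, truncLe_apply]
  by_cases h1 : x.1 ≤ U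
  · by_cases h2 : x.2 ≤ V
    · have := Nat.mul_le_mul h1 h2
      lia
    · simp [h2]
  · simp [h1]

lemma psiChar_eq_charSum {q : ℕ} (χ : DirichletCharacter ℂ q) (N : ℕ) :
    psiChar χ N = charSum χ ArithmeticFunction.vonMangoldt N := by
  rw [psiChar, charSum]
  refine Finset.sum_congr rfl fun n _ => ?_
  rw [charTwist_apply, mul_comm]

lemma norm_psiChar_le_add {q : ℕ} [NeZero q] {χ : DirichletCharacter ℂ q} (hχ : χ ≠ 1) {U V : ℕ}
    (hU : 1 ≤ U) (hV : 1 ≤ V) (N : ℕ) :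
    ‖psiChar χ N‖ ≤ 16 * q * U * V * Real.log N +
      ‖charSum χ (truncGt U realMoebius *
        (truncGt V ArithmeticFunction.vonMangoldt * realZeta)) N‖ := by
  have hq : (1 : ℝ) ≤ q := by exact_mod_cast Nat.pos_of_ne_zero (NeZero.ne q)
  have hU' : (1 : ℝ) ≤ U := by exact_mod_cast hU
  have hV' : (1 : ℝ) ≤ V := by exact_mod_cast hV
  have hlogN : 0 ≤ Real.log N := Real.log_natCast_nonneg N
  have hlog : ∀ n : ℕ, 0 < n → n ≤ N → Real.log n ≤ Real.log N := fun n h0 hn =>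
    Real.log_le_log (by exact_mod_cast h0) (by exact_mod_cast hn)
  have b1 : ‖charSum χ (truncLe V ArithmeticFunction.vonMangoldt) N‖ ≤ V * Real.log N := by
    refine norm_sum_Ioc_le_of_support hlogN (fun n h0 hn => ?_) fun n hn => ?_
    · refine (norm_charTwist_le _ _ _).trans ?_
      rw [truncLe_apply]
      split_ifs
      · rw [abs_of_nonneg ArithmeticFunction.vonMangoldt_nonneg]
        exact ArithmeticFunction.vonMangoldt_le_log.trans (hlog n h0 hn)
      · simpa using hlogN
    · rw [charTwist_apply, truncLe_apply, if_neg (not_le.2 hn)]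
      simp
  have b2 : ‖charSum χ (truncLe U realMoebius * ArithmeticFunction.log) N‖ ≤
      U * (10 * q * Real.log N) := by
    rw [charSum_mul]
    refine norm_sum_Ioc_le_of_support (by positivity) (fun n h0 hn => ?_) fun n hn => ?_
    · rw [norm_mul]
      have h1 : ‖charTwist χ (truncLe U realMoebius) n‖ ≤ 1 := by
        refine (norm_charTwist_le _ _ _).trans ?_
        rw [truncLe_apply]
        split_ifs
        · exact abs_realMoebius_le n
        · simp
      have h2 : ‖charSum χ ArithmeticFunction.log (N / n)‖ ≤ 10 * q * Real.log N := by
        refine (norm_charSum_log_le hχ _).trans ?_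
        refine mul_le_mul_of_nonneg_left ?_ (by positivity)
        rcases Nat.eq_zero_or_pos (N / n) with h | h
        · simpa [h] using hlogN
        · exact hlog _ h (Nat.div_le_self N n)
      calc _ ≤ 1 * (10 * q * Real.log N) := by gcongr
        _ = _ := one_mul _
    · rw [charTwist_apply, truncLe_apply, if_neg (not_le.2 hn)]
      simp
  have b3 : ‖charSum χ (truncLe U realMoebius * truncLe V ArithmeticFunction.vonMangoldt *
      realZeta) N‖ ≤ (U * V : ℕ) * (Real.log N * (5 * q)) := by
    rw [charSum_mul]
    refine norm_sum_Ioc_le_of_support (by positivity) (fun n h0 hn => ?_) fun n hn => ?_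
    · rw [norm_mul]
      have h1 := (norm_charTwist_le χ _ n).trans
        ((abs_truncLe_moebius_mul_le U V n).trans (hlog n h0 hn))
      have h2 := norm_charSum_zeta_le hχ (N / n)
      gcongr
    · rw [charTwist_apply, truncLe_mul_eq_zero _ _ hn]
      simp
  set T := charSum χ (truncGt U realMoebius *
        (truncGt V ArithmeticFunction.vonMangoldt * realZeta)) N with hT
  have e : psiChar χ N = charSum χ (truncLe V ArithmeticFunction.vonMangoldt) N +
      charSum χ (truncLe U realMoebius * ArithmeticFunction.log) N -
      charSum χ (truncLe U realMoebius * truncLe V ArithmeticFunction.vonMangoldt *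
      realZeta) N + T := by
    have hv := fun n => congrArg (fun f : ArithmeticFunction ℝ => f n) (vaughan_identity U V)
    rw [psiChar_eq_charSum, hT, eq_comm, sub_add_eq_add_sub, sub_eq_iff_eq_add]
    simp only [charSum, ← Finset.sum_add_distrib]
    refine Finset.sum_congr rfl fun n _ => ?_
    have := hv n
    simp only [ArithmeticFunction.add_apply] at this
    simp only [charTwist_apply, ← add_mul, ← ofReal_add, this]
  push_cast at b3
  rw [e]
  refine (norm_add_le _ _).trans ?_
  have b4 := norm_sub_le (charSum χ (truncLe V ArithmeticFunction.vonMangoldt) N +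
      charSum χ (truncLe U realMoebius * ArithmeticFunction.log) N)
      (charSum χ (truncLe U realMoebius * truncLe V ArithmeticFunction.vonMangoldt * realZeta) N)
  have b5 := norm_add_le (charSum χ (truncLe V ArithmeticFunction.vonMangoldt) N)
      (charSum χ (truncLe U realMoebius * ArithmeticFunction.log) N)
  have c1 : (V : ℝ) * Real.log N ≤ q * U * V * Real.log N := by
    have : (1 : ℝ) ≤ q * U := one_le_mul_of_one_le_of_one_le hq hU'
    nlinarith [mul_nonneg (show (0 : ℝ) ≤ V by positivity) hlogN]
  have c2 : (U : ℝ) * (10 * q * Real.log N) ≤ 10 * (q * U * V * Real.log N) := by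
    have : (0 : ℝ) ≤ q * U * Real.log N := by positivity
    nlinarith
  linarith

/-- The primitive characters of modulus in `[2, R]`. -/
noncomputable def primFamily (R : ℕ) : Finset (Σ d : ℕ, DirichletCharacter ℂ d) :=
  (Finset.Icc 2 R).sigma primChars

lemma mem_primFamily {R : ℕ} {c : Σ d : ℕ, DirichletCharacter ℂ d} :
    c ∈ primFamily R ↔ (2 ≤ c.1 ∧ c.1 ≤ R) ∧ c.2.IsPrimitive := by
  rw [primFamily, Finset.mem_sigma, Finset.mem_Icc, mem_primChars]

/-- The weight `d / φ(d)`. -/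
noncomputable def charWeight (c : Σ d : ℕ, DirichletCharacter ℂ d) : ℝ := c.1 / c.1.totient

lemma charWeight_nonneg (c : Σ d : ℕ, DirichletCharacter ℂ d) : 0 ≤ charWeight c := by
  unfold charWeight
  positivity

lemma large_sieve_family {R : ℕ} (hR : 1 ≤ R) (N : ℕ) (a : ℕ → ℂ) :
    ∑ c ∈ primFamily R, charWeight c * ‖∑ n ∈ Finset.Icc 1 N, a n * c.2 n‖ ^ 2 ≤
      (N + R ^ 2 * (1 + 2 * Real.log R)) * ∑ n ∈ Finset.Icc 1 N, ‖a n‖ ^ 2 := by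
  refine le_trans ?_ (large_sieve_char hR N a)
  rw [primFamily, Finset.sum_sigma]
  simp only [charWeight, ← Finset.mul_sum]
  refine Finset.sum_le_sum_of_subset_of_nonneg (Finset.Icc_subset_Icc_left (by norm_num)) ?_
  intro d _ _
  exact mul_nonneg (by positivity) (Finset.sum_nonneg fun _ _ => by positivity)

lemma card_primChars_le {d : ℕ} (hd : 1 ≤ d) : (primChars d).card ≤ d.totient := by
  have : NeZero d := ⟨by omega⟩
  rw [← DirichletCharacter.card_eq_totient_of_hasEnoughRootsOfUnity ℂ d, Nat.card_eq_fintype_card]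
  exact Finset.card_le_univ _

lemma sum_charWeight_mul_le (R : ℕ) :
    ∑ c ∈ primFamily R, charWeight c * c.1 ≤ (R : ℝ) ^ 3 := by
  rw [primFamily, Finset.sum_sigma]
  simp only [charWeight, Finset.sum_const, nsmul_eq_mul]
  calc _ ≤ ∑ d ∈ Finset.Icc 2 R, (R : ℝ) ^ 2 := by
        refine Finset.sum_le_sum fun d hd => ?_
        rw [Finset.mem_Icc] at hd
        have h1 : ((primChars d).card : ℝ) ≤ d.totient := by
          exact_mod_cast card_primChars_le (by omega)
        have hφ : (0 : ℝ) < d.totient := by exact_mod_cast Nat.totient_pos.2 (by omega)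
        have hd2 : (d : ℝ) ≤ R := by exact_mod_cast hd.2
        calc ((primChars d).card : ℝ) * (d / d.totient * d) ≤ d.totient * (d / d.totient * d) := by
              gcongr
          _ = (d : ℝ) ^ 2 := by field_simp
          _ ≤ _ := by gcongr
    _ ≤ (R : ℝ) ^ 3 := by
        rw [Finset.sum_const, nsmul_eq_mul, Nat.card_Icc]
        have : ((R + 1 - 2 : ℕ) : ℝ) ≤ R := by exact_mod_cast (by omega)
        calc _ ≤ (R : ℝ) * R ^ 2 := by gcongr
          _ = _ := by ring

/-- The finite Fourier coefficients of the indicator function of `[1, K]` modulo `B`. -/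
noncomputable def cutCoeff (B : ℕ) [NeZero B] (u : ZMod B) (K : ℕ) : ℂ :=
  1 / B * ∑ j ∈ Finset.Icc 1 K, ZMod.stdAddChar (-(u * (j : ZMod B)))

lemma sum_cutCoeff (B : ℕ) [NeZero B] {K : ℕ} (hK : K ≤ B) {k : ℕ} (hk1 : 1 ≤ k) (hk : k ≤ B) :
    ∑ u : ZMod B, cutCoeff B u K * ZMod.stdAddChar (u * (k : ZMod B)) = if k ≤ K then 1 else 0 := by
  have hB : (B : ℂ) ≠ 0 := by exact_mod_cast NeZero.ne B
  simp only [cutCoeff, mul_assoc, Finset.sum_mul, ← Finset.mul_sum]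
  rw [Finset.sum_comm]
  have : ∀ j ∈ Finset.Icc 1 K, ∑ u : ZMod B, ZMod.stdAddChar (-(u * (j : ZMod B))) *
      ZMod.stdAddChar (u * (k : ZMod B)) = if k = j then (B : ℂ) else 0 := by
    intro j hj
    rw [Finset.mem_Icc] at hj
    have e : ∀ u : ZMod B, ZMod.stdAddChar (-(u * (j : ZMod B))) *
      ZMod.stdAddChar (u * (k : ZMod B)) =
        ZMod.stdAddChar (u * ((k : ZMod B) - (j : ZMod B))) := by
      intro u
      rw [← AddChar.map_add_eq_mul]
      congr 1
      ring
    rw [Finset.sum_congr rfl fun u _ => e u,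
      AddChar.sum_mulShift _ (ZMod.isPrimitive_stdAddChar B), ZMod.card]
    have hiff : (k : ZMod B) - (j : ZMod B) = 0 ↔ k = j := by
      rw [sub_eq_zero]
      refine ⟨fun h => ?_, fun h => by rw [h]⟩
      have h3 := (ZMod.natCast_eq_natCast_iff _ _ _).1 h
      rcases le_total k j with hle | hle
      · have := (Nat.modEq_iff_dvd' hle).1 h3
        rcases Nat.eq_zero_or_pos (j - k) with h0 | h0
        · omega
        · have := Nat.le_of_dvd h0 this
          omega
      · have := (Nat.modEq_iff_dvd' hle).1 h3.symm
        rcases Nat.eq_zero_or_pos (k - j) with h0 | h0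
        · omega
        · have := Nat.le_of_dvd h0 this
          omega
    simp only [hiff]
    split_ifs <;> simp
  rw [Finset.sum_congr rfl this, Finset.sum_ite_eq]
  simp only [Finset.mem_Icc, hk1, true_and]
  split_ifs
  · field_simp
  · simp

/-- A bound for the Fourier coefficients `cutCoeff`. -/
noncomputable def cutBound (B h : ℕ) : ℝ :=
  if h = 0 then 1 else 1 / 2 * (1 / h + 1 / ((B - h : ℕ) : ℝ))

lemma norm_cutCoeff_le (B : ℕ) [NeZero B] {K : ℕ} (hK : K ≤ B) (u : ZMod B) :
    ‖cutCoeff B u K‖ ≤ cutBound B u.val := by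
  have hB : (0 : ℝ) < B := by exact_mod_cast NeZero.pos B
  rw [cutCoeff, norm_mul, norm_div, Complex.norm_natCast, norm_one, cutBound]
  split_ifs with h
  · have : ‖∑ j ∈ Finset.Icc 1 K, ZMod.stdAddChar (-(u * (j : ZMod B)))‖ ≤ K := by
      refine (norm_sum_le _ _).trans_eq ?_
      simp
    rw [one_div_mul_eq_div, div_le_one hB]
    exact this.trans (by exact_mod_cast hK)
  · have hval : u.val < B := ZMod.val_lt u
    have hv0 : (0 : ℝ) < u.val := by exact_mod_cast Nat.pos_of_ne_zero h
    have hvB : (u.val : ℝ) < B := by exact_mod_cast hval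
    have hfr : Int.fract (u.val / B : ℝ) = u.val / B := by
      rw [Int.fract_eq_self]
      exact ⟨by positivity, by rwa [div_lt_one hB]⟩
    have hs := norm_sum_expChar_le K (u.val / B : ℝ) (by rw [hfr]; positivity)
    have e : ‖∑ j ∈ Finset.Icc 1 K, ZMod.stdAddChar (-(u * (j : ZMod B)))‖ =
        ‖∑ n ∈ Finset.Icc 1 K, expChar (n * (u.val / B : ℝ))‖ := by
      rw [← Complex.norm_conj, map_sum]
      congr 1
      refine Finset.sum_congr rfl fun j _ => ?_
      rw [← AddChar.map_neg_eq_conj, neg_neg, stdAddChar_mul_natCast]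
    rw [e]
    rw [hfr] at hs
    calc _ ≤ 1 / (B : ℝ) * (1 / 2 * (1 / (u.val / B : ℝ) + 1 / (1 - u.val / B : ℝ))) := by gcongr
      _ = _ := by
        rw [Nat.cast_sub hval.le]
        have : (B : ℝ) - u.val ≠ 0 := by linarith
        have h2 : (1 : ℝ) - u.val / B = (B - u.val) / B := by field_simp
        rw [h2]
        field_simp

lemma sum_cutBound_le {B : ℕ} (hB : 1 ≤ B) :
    ∑ h ∈ Finset.range B, cutBound B h ≤ 2 + Real.log B := by
  have hh := harmonic_le_one_add_log B
  rw [harmonic_eq_sum_Icc] at hh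
  push_cast at hh
  obtain ⟨b, rfl⟩ := Nat.exists_eq_add_of_le' hB
  have hmono : ∑ i ∈ Finset.Icc 1 b, ((i : ℕ) : ℝ)⁻¹ ≤
      ∑ i ∈ Finset.Icc 1 (b + 1), ((i : ℕ) : ℝ)⁻¹ :=
    Finset.sum_le_sum_of_subset_of_nonneg (Finset.Icc_subset_Icc_right (by omega))
      fun _ _ _ => by positivity
  have e1 : ∑ i ∈ Finset.Icc 1 b, ((i : ℕ) : ℝ)⁻¹ =
      ∑ h ∈ Finset.range b, 1 / ((h + 1 : ℕ) : ℝ) := by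
    rw [Finset.range_eq_Ico, Finset.sum_Ico_add' (fun i : ℕ => 1 / (i : ℝ)) 0 b 1]
    simp [Finset.Ico_add_one_right_eq_Icc]
  have e2 : ∑ h ∈ Finset.range b, 1 / ((b + 1 - (h + 1) : ℕ) : ℝ) =
      ∑ h ∈ Finset.range b, 1 / ((h + 1 : ℕ) : ℝ) := by
    rw [← Finset.sum_range_reflect]
    refine Finset.sum_congr rfl fun h hh => ?_
    rw [Finset.mem_range] at hh
    congr 2
    omega
  rw [Finset.sum_range_succ']
  have : ∀ h, cutBound (b + 1) (h + 1) = 1 / 2 * (1 / ((h + 1 : ℕ) : ℝ)) +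
      1 / 2 * (1 / ((b + 1 - (h + 1) : ℕ) : ℝ)) := by
    intro h
    rw [cutBound, if_neg (by omega), mul_add]
  simp only [this, Finset.sum_add_distrib, ← Finset.mul_sum, e2, ← e1]
  simp only [cutBound, if_true]
  linarith

lemma sum_zmod_val (B : ℕ) [NeZero B] (f : ℕ → ℝ) :
    ∑ u : ZMod B, f u.val = ∑ h ∈ Finset.range B, f h := by
  refine Finset.sum_bij (fun u _ => u.val) (fun u _ => by simpa using ZMod.val_lt u)
    (fun u _ v _ h => ZMod.val_injective B h) (fun h hh => ?_) fun _ _ => rfl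
  exact ⟨h, Finset.mem_univ _, ZMod.val_cast_of_lt (Finset.mem_range.1 hh)⟩

lemma bilinear_separation {A B : ℕ} [NeZero B] {K : ℕ → ℕ} {α β : ℕ → ℂ}
    (hK : ∀ n, α n ≠ 0 → K n ≤ B) :
    ∑ n ∈ Finset.Icc 1 A, α n * ∑ m ∈ Finset.Icc 1 (K n), β m =
      ∑ u : ZMod B, (∑ n ∈ Finset.Icc 1 A, cutCoeff B u (K n) * α n) *
        ∑ m ∈ Finset.Icc 1 B, ZMod.stdAddChar (u * (m : ZMod B)) * β m := by
  simp_rw [Finset.sum_mul]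
  rw [Finset.sum_comm]
  refine Finset.sum_congr rfl fun n _ => ?_
  by_cases hn : α n = 0
  · simp [hn]
  have hKn := hK n hn
  have h1 : ∀ u : ZMod B, cutCoeff B u (K n) * α n *
      ∑ m ∈ Finset.Icc 1 B, ZMod.stdAddChar (u * (m : ZMod B)) * β m =
      ∑ m ∈ Finset.Icc 1 B, α n * β m * (cutCoeff B u (K n) *
          ZMod.stdAddChar (u * (m : ZMod B))) := by
    intro u
    rw [Finset.mul_sum]
    refine Finset.sum_congr rfl fun m _ => ?_
    ring
  rw [Finset.sum_congr rfl fun u _ => h1 u, Finset.sum_comm]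
  have h2 : ∀ m ∈ Finset.Icc 1 B, ∑ u : ZMod B, α n * β m *
      (cutCoeff B u (K n) * ZMod.stdAddChar (u * (m : ZMod B))) =
      if m ≤ K n then α n * β m else 0 := by
    intro m hm
    rw [Finset.mem_Icc] at hm
    rw [← Finset.mul_sum, sum_cutCoeff B hKn hm.1 hm.2]
    split_ifs <;> simp
  rw [Finset.sum_congr rfl h2, ← Finset.sum_filter, Finset.mul_sum]
  refine Finset.sum_congr ?_ fun _ _ => rfl
  ext m
  simp only [Finset.mem_Icc, Finset.mem_filter]
  omega

lemma bilinear_block {R A B : ℕ} (hR : 1 ≤ R) (hB : 1 ≤ B) {K : ℕ → ℕ} {α β : ℕ → ℂ} {b : ℝ}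
    (hb : 0 ≤ b) (hK : ∀ n, α n ≠ 0 → K n ≤ B) (hα : ∀ n, ‖α n‖ ≤ 1)
    (hβ : ∀ m, 1 ≤ m → m ≤ B → ‖β m‖ ≤ b) :
    ∑ c ∈ primFamily R, charWeight c * ‖∑ n ∈ Finset.Icc 1 A, α n * c.2 n *
        ∑ m ∈ Finset.Icc 1 (K n), β m * c.2 m‖ ≤
      (2 + Real.log B) * (b * √((A + R ^ 2 * (1 + 2 * Real.log R)) * A *
        ((B + R ^ 2 * (1 + 2 * Real.log R)) * B))) := by
  have : NeZero B := ⟨by omega⟩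
  set Q : ℝ := R ^ 2 * (1 + 2 * Real.log R) with hQ
  have hQ0 : 0 ≤ Q := by
    have := Real.log_natCast_nonneg R
    positivity
  set X : ZMod B → (Σ d : ℕ, DirichletCharacter ℂ d) → ℂ := fun u c =>
    ∑ n ∈ Finset.Icc 1 A, cutCoeff B u (K n) * α n * c.2 n with hX
  set Y : ZMod B → (Σ d : ℕ, DirichletCharacter ℂ d) → ℂ := fun u c =>
    ∑ m ∈ Finset.Icc 1 B, ZMod.stdAddChar (u * (m : ZMod B)) * β m * c.2 m with hY
  have hG0 : ∀ h, 0 ≤ cutBound B h := by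
    intro h
    unfold cutBound
    split_ifs <;> positivity
  have hsep : ∀ c : Σ d : ℕ, DirichletCharacter ℂ d, ‖∑ n ∈ Finset.Icc 1 A, α n * c.2 n *
        ∑ m ∈ Finset.Icc 1 (K n), β m * c.2 m‖ ≤ ∑ u : ZMod B, ‖X u c‖ * ‖Y u c‖ := by
    intro c
    rw [bilinear_separation (B := B) (α := fun n => α n * c.2 n) (β := fun m => β m * c.2 m)
      fun n hn => hK n fun h => hn (by rw [h, zero_mul])]
    refine (norm_sum_le _ _).trans_eq (Finset.sum_congr rfl fun u _ => ?_)
    rw [norm_mul, hX, hY]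
    simp only [mul_assoc]
  have hone : ∀ u : ZMod B, ∑ c ∈ primFamily R, charWeight c * (‖X u c‖ * ‖Y u c‖) ≤
      cutBound B u.val * (b * √((A + Q) * A * ((B + Q) * B))) := by
    intro u
    have hX2 : ∑ c ∈ primFamily R, charWeight c * ‖X u c‖ ^ 2 ≤
        (A + Q) * (A * cutBound B u.val ^ 2) := by
      refine (large_sieve_family hR A _).trans ?_
      gcongr
      refine (Finset.sum_le_sum (g := fun _ => cutBound B u.val ^ 2) fun n _ => ?_).trans_eq ?_
      · rw [norm_mul]
        by_cases hn : α n = 0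
        · rw [hn, norm_zero, mul_zero, zero_pow two_ne_zero]
          exact sq_nonneg _
        · have h1 := norm_cutCoeff_le B (hK n hn) u
          have h2 := hα n
          have h3 := hG0 u.val
          calc _ ≤ (cutBound B u.val * 1) ^ 2 := by gcongr
            _ = _ := by rw [mul_one]
      · simp
    have hY2 : ∑ c ∈ primFamily R, charWeight c * ‖Y u c‖ ^ 2 ≤ (B + Q) * (B * b ^ 2) := by
      refine (large_sieve_family hR B _).trans ?_
      gcongr
      refine (Finset.sum_le_sum (g := fun _ => b ^ 2) fun n hn => ?_).trans_eq ?_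
      · rw [norm_mul, AddChar.norm_apply, one_mul]
        rw [Finset.mem_Icc] at hn
        have := hβ n hn.1 hn.2
        gcongr
      · simp
    have hcs := Finset.sum_sq_le_sum_mul_sum_of_sq_le_mul (primFamily R)
      (r := fun c => charWeight c * (‖X u c‖ * ‖Y u c‖))
      (f := fun c => charWeight c * ‖X u c‖ ^ 2) (g := fun c => charWeight c * ‖Y u c‖ ^ 2)
      (fun c _ => mul_nonneg (charWeight_nonneg c) (by positivity))
      (fun c _ => mul_nonneg (charWeight_nonneg c) (by positivity)) (fun c _ => by
        rw [← sub_nonneg]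
        ring_nf
        exact le_rfl)
    have hbb : 0 ≤ b * √((A + Q) * A * ((B + Q) * B)) := by positivity
    refine (le_abs_self _).trans (abs_le_of_sq_le_sq (hcs.trans ?_) (mul_nonneg (hG0 _) hbb))
    rw [mul_pow, mul_pow, Real.sq_sqrt (by positivity)]
    calc _ ≤ (A + Q) * (A * cutBound B u.val ^ 2) * ((B + Q) * (B * b ^ 2)) := by
          gcongr
          exact Finset.sum_nonneg fun c _ => mul_nonneg (charWeight_nonneg c) (by positivity)
      _ = _ := by ring
  calc _ ≤ ∑ c ∈ primFamily R, charWeight c * ∑ u : ZMod B, ‖X u c‖ * ‖Y u c‖ :=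
        Finset.sum_le_sum fun c _ => mul_le_mul_of_nonneg_left (hsep c) (charWeight_nonneg c)
    _ = ∑ u : ZMod B, ∑ c ∈ primFamily R, charWeight c * (‖X u c‖ * ‖Y u c‖) := by
        simp_rw [Finset.mul_sum]
        rw [Finset.sum_comm]
    _ ≤ ∑ u : ZMod B, cutBound B u.val * (b * √((A + Q) * A * ((B + Q) * B))) :=
        Finset.sum_le_sum fun u _ => hone u
    _ = (∑ h ∈ Finset.range B, cutBound B h) * (b * √((A + Q) * A * ((B + Q) * B))) := by
        rw [← Finset.sum_mul, sum_zmod_val]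
    _ ≤ _ := by
        have := sum_cutBound_le hB
        gcongr

/-- The second bilinear coefficient in Vaughan's identity. -/
noncomputable def vaughanCoeff (U : ℕ) : ArithmeticFunction ℝ :=
  truncGt U ArithmeticFunction.vonMangoldt * realZeta

lemma vaughanCoeff_nonneg (U m : ℕ) : 0 ≤ vaughanCoeff U m := by
  rw [vaughanCoeff, ArithmeticFunction.mul_apply]
  refine Finset.sum_nonneg fun x _ => mul_nonneg ?_ ?_
  · rw [truncGt_apply]
    split_ifs
    · exact ArithmeticFunction.vonMangoldt_nonneg
    · exact le_rfl
  · rw [realZeta, ArithmeticFunction.natCoe_apply]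
    positivity

lemma vaughanCoeff_le (U m : ℕ) : vaughanCoeff U m ≤ Real.log m := by
  rw [← ArithmeticFunction.log_apply, ← ArithmeticFunction.vonMangoldt_mul_zeta, vaughanCoeff,
    ArithmeticFunction.mul_apply, ArithmeticFunction.mul_apply]
  refine Finset.sum_le_sum fun x _ => mul_le_mul_of_nonneg_right ?_ ?_
  · rw [truncGt_apply]
    split_ifs
    · exact le_rfl
    · exact ArithmeticFunction.vonMangoldt_nonneg
  · rw [realZeta, ArithmeticFunction.natCoe_apply]
    positivity

lemma vaughanCoeff_eq_zero {U m : ℕ} (hm : m ≤ U) : vaughanCoeff U m = 0 := by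
  rw [vaughanCoeff, ArithmeticFunction.mul_apply]
  refine Finset.sum_eq_zero fun x hx => ?_
  have h := Nat.mem_divisorsAntidiagonal.1 hx
  have : x.1 ≤ m := Nat.le_of_dvd (Nat.pos_of_ne_zero h.2) (Dvd.intro _ h.1)
  rw [truncGt_apply, if_neg (by omega), zero_mul]

lemma charSum_eq_sum_Icc {q : ℕ} (χ : DirichletCharacter ℂ q) (f : ArithmeticFunction ℝ) (N : ℕ) :
    charSum χ f N = ∑ m ∈ Finset.Icc 1 N, (f m : ℂ) * χ m := rfl

/-- The first bilinear coefficient in Vaughan's identity, restricted to a dyadic block. -/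
noncomputable def dyadicCoeff (U N j n : ℕ) : ℂ :=
  if n ≤ N ∧ Nat.log 2 n = j then (truncGt U realMoebius n : ℂ) else 0

lemma charSum_eq_sum_dyadic {q : ℕ} (χ : DirichletCharacter ℂ q) (U N : ℕ) :
    charSum χ (truncGt U realMoebius * vaughanCoeff U) N =
      ∑ j ∈ Finset.range (Nat.log 2 N + 1), ∑ n ∈ Finset.Icc 1 (2 ^ (j + 1)),
        dyadicCoeff U N j n * χ n *
          ∑ m ∈ Finset.Icc 1 (N / n), (vaughanCoeff U m : ℂ) * χ m := by
  rw [charSum_mul, ← Finset.sum_fiberwise_of_maps_to (s := Finset.Ioc 0 N)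
    (t := Finset.range (Nat.log 2 N + 1)) (g := Nat.log 2)]
  · refine Finset.sum_congr rfl fun j _ => ?_
    have h1 : ∀ n ∈ (Finset.Ioc 0 N).filter (fun n => Nat.log 2 n = j),
        charTwist χ (truncGt U realMoebius) n * charSum χ (vaughanCoeff U) (N / n) =
        dyadicCoeff U N j n * χ n *
          ∑ m ∈ Finset.Icc 1 (N / n), (vaughanCoeff U m : ℂ) * χ m := by
      intro n hn
      rw [Finset.mem_filter, Finset.mem_Ioc] at hn
      rw [charTwist_apply, charSum_eq_sum_Icc, dyadicCoeff, if_pos ⟨hn.1.2, hn.2⟩]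
    rw [Finset.sum_congr rfl h1]
    refine Finset.sum_subset_zero_on_sdiff (fun n hn => ?_) (fun n hn => ?_) fun _ _ => rfl
    · rw [Finset.mem_filter, Finset.mem_Ioc] at hn
      rw [Finset.mem_Icc, ← hn.2]
      exact ⟨hn.1.1, (Nat.lt_pow_succ_log_self (by norm_num) n).le⟩
    · rw [Finset.mem_sdiff, Finset.mem_filter, Finset.mem_Ioc, Finset.mem_Icc] at hn
      rw [dyadicCoeff, if_neg (fun h => hn.2 ⟨⟨hn.1.1, h.1⟩, h.2⟩), zero_mul, zero_mul]
  · intro n hn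
    rw [Finset.mem_Ioc] at hn
    rw [Finset.mem_range]
    exact Nat.lt_succ_of_le (Nat.log_mono_right hn.2)

lemma sqrt_block_le {A B N Q U s : ℝ} (hU : 0 < U) (hUA : U ≤ A) (hUB : U ≤ B)
    (hAB : A * B ≤ 2 * N) (hQ : 0 ≤ Q) (hs : 0 ≤ s) (hQs : Q / U ≤ s ^ 2) :
    √((A + Q) * A * ((B + Q) * B)) ≤ 2 * N + 3 * N * s + 2 * Q * √N := by
  have hA : 0 < A := by linarith
  have hB : 0 < B := by linarith
  have hN : 0 < N := by nlinarith [mul_pos hA hB]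
  have hsN := Real.sq_sqrt hN.le
  have hsN0 := Real.sqrt_nonneg N
  rw [Real.sqrt_le_left (by positivity)]
  rw [div_le_iff₀ hU] at hQs
  have hAU : A * U ≤ 2 * N := (mul_le_mul_of_nonneg_left hUB hA.le).trans hAB
  have hBU : B * U ≤ 2 * N := by
    have := mul_le_mul_of_nonneg_left hUA hB.le
    linarith
  have h1 : Q * (A + B) ≤ 4 * N * s ^ 2 := by
    calc Q * (A + B) ≤ s ^ 2 * U * (A + B) := by gcongr
      _ = s ^ 2 * (A * U + B * U) := by ring
      _ ≤ s ^ 2 * (2 * N + 2 * N) := by gcongr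
      _ = _ := by ring
  calc (A + Q) * A * ((B + Q) * B) = (A * B) * (A * B + Q * (A + B) + Q ^ 2) := by ring
    _ ≤ (2 * N) * (2 * N + 4 * N * s ^ 2 + Q ^ 2) := by gcongr
    _ = 4 * N ^ 2 + 8 * N ^ 2 * s ^ 2 + 2 * Q ^ 2 * √N ^ 2 := by rw [hsN]; ring
    _ ≤ _ := by
      have c1 : 0 ≤ N * (N * s) := by positivity
      have c2 : 0 ≤ N * (Q * √N) := by positivity
      have c3 : 0 ≤ (N * s) * (Q * √N) := by positivity
      have c4 : 0 ≤ N ^ 2 * s ^ 2 := by positivity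
      have c5 : 0 ≤ Q ^ 2 * √N ^ 2 := by positivity
      nlinarith

lemma sum_norm_bilinear_le {R U N : ℕ} (hR : 1 ≤ R) (hRN : R ≤ N) (hU : 1 ≤ U) (hN : 3 ≤ N) :
    ∑ c ∈ primFamily R, charWeight c *
        ‖charSum c.2 (truncGt U realMoebius * vaughanCoeff U) N‖ ≤
      54 * Real.log N ^ 4 * (N + N * R / √U + R ^ 2 * √N) := by
  have hl := one_le_log_of_three_le (x := N) (by exact_mod_cast hN)
  set l := Real.log N with hl_def
  set D : ℝ := N + N * R / √U + R ^ 2 * √N with hD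
  have hD0 : 0 ≤ D := by positivity
  have hU' : (1 : ℝ) ≤ U := by exact_mod_cast hU
  have hN' : (0 : ℝ) < N := by exact_mod_cast (by omega : 0 < N)
  have hblock : ∀ j ∈ Finset.range (Nat.log 2 N + 1), ∑ c ∈ primFamily R, charWeight c *
      ‖∑ n ∈ Finset.Icc 1 (2 ^ (j + 1)), dyadicCoeff U N j n * c.2 n *
          ∑ m ∈ Finset.Icc 1 (N / n), (vaughanCoeff U m : ℂ) * c.2 m‖ ≤ 18 * l ^ 3 * D := by
    intro j hj
    have hjN : 2 ^ j ≤ N := by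
      rw [Finset.mem_range] at hj
      exact Nat.pow_le_of_le_log (by omega) (by omega)
    have hK : ∀ n, dyadicCoeff U N j n ≠ 0 → N / n ≤ N / 2 ^ j := by
      intro n hn
      rw [dyadicCoeff] at hn
      split_ifs at hn with h
      · refine Nat.div_le_div_left ?_ (by positivity)
        rw [← h.2]
        refine Nat.pow_log_le_self 2 fun h0 => hn ?_
        rw [h0, ArithmeticFunction.map_zero, ofReal_zero]
      · exact absurd rfl hn
    rcases le_or_gt (2 ^ (j + 1)) U with hAU | hAU
    · refine (Finset.sum_nonpos fun c _ => ?_).trans (by positivity)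
      rw [Finset.sum_eq_zero, norm_zero, mul_zero]
      intro n hn
      rw [Finset.mem_Icc] at hn
      have : dyadicCoeff U N j n = 0 := by
        rw [dyadicCoeff, truncGt_apply, if_neg (by omega : ¬U < n)]
        simp
      rw [this, zero_mul, zero_mul]
    rcases le_or_gt (N / 2 ^ j) U with hBU | hBU
    · refine (Finset.sum_nonpos fun c _ => ?_).trans (by positivity)
      rw [Finset.sum_eq_zero, norm_zero, mul_zero]
      intro n _
      by_cases hn : dyadicCoeff U N j n = 0
      · rw [hn, zero_mul, zero_mul]
      · rw [Finset.sum_eq_zero, mul_zero]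
        intro m hm
        rw [Finset.mem_Icc] at hm
        have := hK n hn
        rw [vaughanCoeff_eq_zero (by omega), ofReal_zero, zero_mul]
    have hB1 : 1 ≤ N / 2 ^ j := by omega
    have hBN : N / 2 ^ j ≤ N := Nat.div_le_self _ _
    have hmain := bilinear_block (R := R) (A := 2 ^ (j + 1)) (B := N / 2 ^ j) (K := fun n => N / n)
      (α := dyadicCoeff U N j) (β := fun m => (vaughanCoeff U m : ℂ)) (b := l) hR hB1 (by linarith)
      hK (by
        intro n
        rw [dyadicCoeff]
        split_ifs
        · rw [Complex.norm_real, Real.norm_eq_abs, truncGt_apply]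
          split_ifs
          · exact abs_realMoebius_le n
          · simp
        · simp) (by
        intro m hm1 hm
        rw [Complex.norm_real, Real.norm_eq_abs, abs_of_nonneg (vaughanCoeff_nonneg U m)]
        refine (vaughanCoeff_le U m).trans (Real.log_le_log (by exact_mod_cast hm1) ?_)
        exact_mod_cast hm.trans hBN)
    refine hmain.trans ?_
    set Q : ℝ := R ^ 2 * (1 + 2 * Real.log R) with hQ
    have hlogR : Real.log R ≤ l := Real.log_le_log (by exact_mod_cast hR) (by exact_mod_cast hRN)
    have hQ0 : 0 ≤ Q := by
      have := Real.log_natCast_nonneg R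
      positivity
    have hQle : Q ≤ 3 * l * R ^ 2 := by
      rw [hQ, mul_comm]
      gcongr
      linarith
    have hsU : 0 < √(U : ℝ) := Real.sqrt_pos.2 (by linarith)
    have hsq := sqrt_block_le (A := ((2 ^ (j + 1) : ℕ) : ℝ)) (B := ((N / 2 ^ j : ℕ) : ℝ)) (N := N)
      (Q := Q) (U := U) (s := 2 * l * R / √U) (by linarith) (by exact_mod_cast hAU.le)
      (by exact_mod_cast hBU.le) (by
        have : 2 ^ (j + 1) * (N / 2 ^ j) ≤ 2 * N := by
          have := Nat.mul_div_le N (2 ^ j)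
          rw [pow_succ]
          linarith
        exact_mod_cast this) hQ0 (by positivity) (by
        rw [div_pow, Real.sq_sqrt (by linarith)]
        gcongr
        refine hQle.trans ?_
        have : 0 ≤ l * (R : ℝ) ^ 2 := by positivity
        nlinarith)
    have hlogB : Real.log ((N / 2 ^ j : ℕ) : ℝ) ≤ l :=
      Real.log_le_log (by exact_mod_cast hB1) (by exact_mod_cast hBN)
    have hs2 : 2 * (N : ℝ) + 3 * N * (2 * l * R / √U) + 2 * Q * √N ≤ 6 * l * D := by
      have e1 : 2 * Q * √N ≤ 6 * l * (R ^ 2 * √N) := by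
        have := mul_le_mul_of_nonneg_right hQle (Real.sqrt_nonneg N)
        linarith
      have e2 : 3 * N * (2 * l * R / √U) = 6 * l * (N * R / √U) := by ring
      have e3 : 2 * (N : ℝ) ≤ 6 * l * N := by nlinarith
      rw [e2, hD]
      linarith
    calc _ ≤ (3 * l) * (l * (6 * l * D)) := by
          have h2 : 2 + Real.log ((N / 2 ^ j : ℕ) : ℝ) ≤ 3 * l := by linarith
          have h3 := hsq.trans hs2
          gcongr
      _ = _ := by ring
  have hcount : ((Nat.log 2 N + 1 : ℕ) : ℝ) ≤ 3 * l := by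
    have h1 : (Nat.log 2 N : ℝ) * Real.log 2 ≤ l := by
      rw [← Real.log_pow]
      refine Real.log_le_log (by positivity) ?_
      exact_mod_cast Nat.pow_log_le_self 2 (by omega)
    have := Real.log_two_gt_d9
    have h0 : (0 : ℝ) ≤ Nat.log 2 N := by positivity
    push_cast
    nlinarith
  calc _ ≤ ∑ c ∈ primFamily R, charWeight c * ∑ j ∈ Finset.range (Nat.log 2 N + 1),
      ‖∑ n ∈ Finset.Icc 1 (2 ^ (j + 1)), dyadicCoeff U N j n * c.2 n *
          ∑ m ∈ Finset.Icc 1 (N / n), (vaughanCoeff U m : ℂ) * c.2 m‖ := by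
        refine Finset.sum_le_sum fun c _ => mul_le_mul_of_nonneg_left ?_ (charWeight_nonneg c)
        rw [charSum_eq_sum_dyadic]
        exact norm_sum_le _ _
    _ = ∑ j ∈ Finset.range (Nat.log 2 N + 1), ∑ c ∈ primFamily R, charWeight c *
      ‖∑ n ∈ Finset.Icc 1 (2 ^ (j + 1)), dyadicCoeff U N j n * c.2 n *
          ∑ m ∈ Finset.Icc 1 (N / n), (vaughanCoeff U m : ℂ) * c.2 m‖ := by
        simp_rw [Finset.mul_sum]
        rw [Finset.sum_comm]
    _ ≤ ∑ j ∈ Finset.range (Nat.log 2 N + 1), 18 * l ^ 3 * D := Finset.sum_le_sum hblock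
    _ = ((Nat.log 2 N + 1 : ℕ) : ℝ) * (18 * l ^ 3 * D) := by simp
    _ ≤ 3 * l * (18 * l ^ 3 * D) := by gcongr
    _ = _ := by ring

lemma ne_one_of_isPrimitive {d : ℕ} (hd : 2 ≤ d) {χ : DirichletCharacter ℂ d}
    (hχ : χ.IsPrimitive) : χ ≠ 1 := by
  rintro rfl
  have : NeZero d := ⟨by omega⟩
  rw [DirichletCharacter.isPrimitive_def, DirichletCharacter.conductor_one] at hχ
  omega

/-- The mean value of `ψ(N, χ)` over primitive characters. -/
lemma sum_norm_psiChar_le {R U N : ℕ} (hR : 1 ≤ R) (hRN : R ≤ N) (hU : 1 ≤ U) (hN : 3 ≤ N) :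
    ∑ c ∈ primFamily R, charWeight c * ‖psiChar c.2 N‖ ≤
      54 * Real.log N ^ 4 * (N + N * R / √U + R ^ 2 * √N + R ^ 3 * U ^ 2) := by
  have hl := one_le_log_of_three_le (x := N) (by exact_mod_cast hN)
  have h1 := sum_norm_bilinear_le hR hRN hU hN
  have h2 := sum_charWeight_mul_le R
  set l := Real.log N with hl_def
  calc _ ≤ ∑ c ∈ primFamily R, (16 * U * U * l * (charWeight c * c.1) + charWeight c *
        ‖charSum c.2 (truncGt U realMoebius * vaughanCoeff U) N‖) := by
        refine Finset.sum_le_sum fun c hc => ?_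
        have hc' := mem_primFamily.1 hc
        have : NeZero c.1 := ⟨by omega⟩
        have := mul_le_mul_of_nonneg_left
          (norm_psiChar_le_add (ne_one_of_isPrimitive hc'.1.1 hc'.2) hU hU N) (charWeight_nonneg c)
        rw [vaughanCoeff]
        linarith
    _ = 16 * U * U * l * (∑ c ∈ primFamily R, charWeight c * c.1) +
        ∑ c ∈ primFamily R, charWeight c *
          ‖charSum c.2 (truncGt U realMoebius * vaughanCoeff U) N‖ := by
        rw [Finset.sum_add_distrib, Finset.mul_sum]
    _ ≤ 16 * U * U * l * R ^ 3 + 54 * l ^ 4 * (N + N * R / √U + R ^ 2 * √N) := by gcongr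
    _ ≤ _ := by
        have : l ≤ l ^ 4 := le_self_pow₀ hl (by norm_num)
        have h3 : 16 * U * U * l * R ^ 3 ≤ 54 * l ^ 4 * (R ^ 3 * U ^ 2) := by
          calc 16 * U * U * l * R ^ 3 = 16 * l * (R ^ 3 * (U : ℝ) ^ 2) := by ring
            _ ≤ 54 * l ^ 4 * (R ^ 3 * U ^ 2) := by
              gcongr
              linarith
        linarith

lemma natLog_add_one_le {N : ℕ} (hN : 3 ≤ N) :
    ((Nat.log 2 N + 1 : ℕ) : ℝ) ≤ 3 * Real.log N := by
  have hl := one_le_log_of_three_le (x := N) (by exact_mod_cast hN)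
  have h1 : (Nat.log 2 N : ℝ) * Real.log 2 ≤ Real.log N := by
    rw [← Real.log_pow]
    refine Real.log_le_log (by positivity) ?_
    exact_mod_cast Nat.pow_log_le_self 2 (by omega)
  have h2 := Real.log_two_gt_d9
  have h0 : (0 : ℝ) ≤ Nat.log 2 N := by positivity
  push_cast
  nlinarith

/-- Dyadic summation of `sum_norm_psiChar_le`. -/
lemma sum_inv_totient_mul_norm_psiChar_le {Q U N : ℕ} (hQ : 1 ≤ Q) (hQN : 2 * Q ≤ N) (hU : 1 ≤ U)
    (hN : 3 ≤ N) {z : ℝ} (hz : 0 < z) :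
    ∑ c ∈ (primFamily Q).filter (fun c => z ≤ c.1), 1 / (c.1.totient : ℝ) * ‖psiChar c.2 N‖ ≤
      324 * Real.log N ^ 5 * (N / z + N / √U + 2 * Q * √N + 4 * Q ^ 2 * U ^ 2) := by
  have hl := one_le_log_of_three_le (x := N) (by exact_mod_cast hN)
  set l := Real.log N with hl_def
  set D : ℝ := N / z + N / √U + 2 * Q * √N + 4 * Q ^ 2 * U ^ 2 with hD
  have hD0 : 0 ≤ D := by positivity
  rw [← Finset.sum_fiberwise_of_maps_to (s := (primFamily Q).filter (fun c => z ≤ c.1))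
    (t := Finset.range (Nat.log 2 N + 1)) (g := fun c => Nat.log 2 c.1)]
  swap
  · intro c hc
    have hc' := mem_primFamily.1 (Finset.mem_filter.1 hc).1
    rw [Finset.mem_range, Nat.lt_succ_iff]
    exact Nat.log_mono_right (by omega)
  have hblock : ∀ j ∈ Finset.range (Nat.log 2 N + 1),
      ∑ c ∈ ((primFamily Q).filter (fun c => z ≤ c.1)).filter (fun c => Nat.log 2 c.1 = j),
        1 / (c.1.totient : ℝ) * ‖psiChar c.2 N‖ ≤ 108 * l ^ 4 * D := by
    intro j _
    rcases (((primFamily Q).filter (fun c => z ≤ c.1)).filter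
      (fun c => Nat.log 2 c.1 = j)).eq_empty_or_nonempty with he | ⟨c₀, hc₀⟩
    · rw [he, Finset.sum_empty]
      positivity
    rw [Finset.mem_filter, Finset.mem_filter, mem_primFamily] at hc₀
    obtain ⟨⟨⟨⟨h2, hcQ⟩, -⟩, hzc⟩, hj⟩ := hc₀
    have hjQ : 2 ^ j ≤ Q := by
      rw [← hj]
      exact (Nat.pow_log_le_self 2 (by omega)).trans hcQ
    have hzj : z ≤ 2 ^ (j + 1) := by
      refine hzc.trans ?_
      rw [← hj]
      exact_mod_cast (Nat.lt_pow_succ_log_self one_lt_two _).le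
    have hpow : 2 ^ (j + 1) ≤ 2 * Q := by
      rw [pow_succ]
      omega
    have hmain := sum_norm_psiChar_le (R := 2 ^ (j + 1)) Nat.one_le_two_pow (hpow.trans hQN) hU hN
    rw [← hl_def] at hmain
    set T : ℝ := ((2 ^ (j + 1) : ℕ) : ℝ) with hT
    have hT0 : 0 < T := by positivity
    have hTQ : T ≤ 2 * Q := by rw [hT]; exact_mod_cast hpow
    have hzT : z ≤ T := by rw [hT]; exact_mod_cast hzj
    have hT2 : T = 2 * (2 : ℝ) ^ j := by rw [hT]; push_cast; ring
    calc _ ≤ ∑ c ∈ ((primFamily Q).filter (fun c => z ≤ c.1)).filter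
          (fun c => Nat.log 2 c.1 = j), 2 / T * (charWeight c * ‖psiChar c.2 N‖) := by
          refine Finset.sum_le_sum fun c hc => ?_
          rw [Finset.mem_filter, Finset.mem_filter, mem_primFamily] at hc
          have hcj : (2 : ℝ) ^ j ≤ c.1 := by
            rw [← hc.2]
            exact_mod_cast Nat.pow_log_le_self 2 (by omega)
          rw [← mul_assoc]
          refine mul_le_mul_of_nonneg_right ?_ (norm_nonneg _)
          have hφ : (0 : ℝ) < c.1.totient := by
            exact_mod_cast Nat.totient_pos.2 (by omega)
          rw [charWeight, hT2, div_mul_div_comm, div_le_div_iff₀ hφ (by positivity)]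
          nlinarith
      _ ≤ ∑ c ∈ primFamily (2 ^ (j + 1)), 2 / T * (charWeight c * ‖psiChar c.2 N‖) := by
          refine Finset.sum_le_sum_of_subset_of_nonneg ?_ fun c _ _ =>
            mul_nonneg (by positivity) (mul_nonneg (charWeight_nonneg c) (norm_nonneg _))
          intro c hc
          rw [Finset.mem_filter, Finset.mem_filter, mem_primFamily] at hc
          rw [mem_primFamily]
          refine ⟨⟨hc.1.1.1.1, ?_⟩, hc.1.1.2⟩
          rw [← hc.2]
          exact (Nat.lt_pow_succ_log_self one_lt_two _).le
      _ = 2 / T * ∑ c ∈ primFamily (2 ^ (j + 1)), charWeight c * ‖psiChar c.2 N‖ := by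
          rw [Finset.mul_sum]
      _ ≤ 2 / T * (54 * l ^ 4 * (N + N * T / √U + T ^ 2 * √N + T ^ 3 * U ^ 2)) := by gcongr
      _ = 108 * l ^ 4 * (N / T + N / √U + T * √N + T ^ 2 * U ^ 2) := by
          have : (√U : ℝ) ≠ 0 := by positivity
          field_simp
          ring
      _ ≤ 108 * l ^ 4 * D := by
          have h4 : T ^ 2 ≤ 4 * Q ^ 2 := by nlinarith
          rw [hD]
          gcongr
  refine (Finset.sum_le_sum hblock).trans ?_
  rw [Finset.sum_const, Finset.card_range, nsmul_eq_mul]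
  calc _ ≤ 3 * l * (108 * l ^ 4 * D) :=
        mul_le_mul_of_nonneg_right (natLog_add_one_le hN) (by positivity)
    _ = _ := by ring

lemma norm_psiChar_le_psi {q : ℕ} (χ : DirichletCharacter ℂ q) (N : ℕ) :
    ‖psiChar χ N‖ ≤ Chebyshev.psi N := by
  rw [psiChar, Chebyshev.psi, Nat.floor_natCast]
  refine (norm_sum_le _ _).trans (Finset.sum_le_sum fun n _ => ?_)
  rw [norm_mul, Complex.norm_real, Real.norm_of_nonneg ArithmeticFunction.vonMangoldt_nonneg]
  exact mul_le_of_le_one_left ArithmeticFunction.vonMangoldt_nonneg (χ.norm_le_one _)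

lemma sum_inv_totient_mul_norm_psiChar_le' {Q N : ℕ} (hQ : 1 ≤ Q) (hQN : 2 * Q ≤ N) (hN : 3 ≤ N)
    (hQ5 : (Q : ℝ) ≤ 2 * (N : ℝ) ^ (5 / 12 : ℝ)) {z : ℝ} (hz : 0 < z) :
    ∑ c ∈ (primFamily Q).filter (fun c => z ≤ c.1), 1 / (c.1.totient : ℝ) * ‖psiChar c.2 N‖ ≤
      324 * Real.log N ^ 5 * (N / z + 22 * (N : ℝ) ^ (31 / 32 : ℝ)) := by
  have hN1 : (1 : ℝ) ≤ N := by exact_mod_cast (by omega : 1 ≤ N)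
  have hN0 : (0 : ℝ) ≤ N := by linarith
  have hl := one_le_log_of_three_le (x := N) (by exact_mod_cast hN)
  set t : ℝ := (N : ℝ) ^ (1 / 96 : ℝ) with ht
  have ht1 : 1 ≤ t := Real.one_le_rpow hN1 (by norm_num)
  have hpow : ∀ k : ℕ, t ^ k = (N : ℝ) ^ ((k : ℝ) / 96) := by
    intro k
    rw [ht, ← Real.rpow_natCast, ← Real.rpow_mul hN0]
    congr 1
    ring
  have h6 : t ^ 6 = (N : ℝ) ^ (1 / 16 : ℝ) := by rw [hpow]; norm_num
  have h40 : t ^ 40 = (N : ℝ) ^ (5 / 12 : ℝ) := by rw [hpow]; norm_num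
  have h48 : t ^ 48 = √N := by rw [hpow, Real.sqrt_eq_rpow]; norm_num
  have h93 : t ^ 93 = (N : ℝ) ^ (31 / 32 : ℝ) := by rw [hpow]; norm_num
  have h96 : t ^ 96 = N := by rw [hpow]; norm_num
  have ht6 : 1 ≤ t ^ 6 := one_le_pow₀ ht1
  set U := ⌊t ^ 6⌋₊ with hU
  have hU1 : 1 ≤ U := Nat.one_le_floor_iff _ |>.2 ht6
  have hUle : (U : ℝ) ≤ t ^ 6 := Nat.floor_le (by positivity)
  have hUge : t ^ 6 ≤ 2 * U := by
    have h1 := Nat.lt_floor_add_one (t ^ 6)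
    rw [← hU] at h1
    have h2 : (1 : ℝ) ≤ U := by exact_mod_cast hU1
    linarith
  have hsq : t ^ 3 ≤ 2 * √U := by
    have : √(t ^ 6) ≤ √(4 * U) := Real.sqrt_le_sqrt (by linarith)
    rw [Real.sqrt_mul (by norm_num), show t ^ 6 = (t ^ 3) ^ 2 by ring,
      Real.sqrt_sq (by positivity), show (4 : ℝ) = 2 ^ 2 by norm_num,
      Real.sqrt_sq (by norm_num)] at this
    exact this
  refine (sum_inv_totient_mul_norm_psiChar_le hQ hQN hU1 hN hz).trans ?_
  rw [← h93]
  rw [← h40] at hQ5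
  have e1 : (N : ℝ) / √U ≤ 2 * t ^ 93 := by
    have hU0 : (0 : ℝ) < √U := by positivity
    rw [div_le_iff₀ hU0]
    calc (N : ℝ) = t ^ 93 * t ^ 3 := by rw [← h96]; ring
      _ ≤ t ^ 93 * (2 * √U) := by gcongr
      _ = _ := by ring
  have e2 : 2 * (Q : ℝ) * √N ≤ 4 * t ^ 93 := by
    rw [← h48]
    calc 2 * (Q : ℝ) * t ^ 48 ≤ 2 * (2 * t ^ 40) * t ^ 48 := by gcongr
      _ = 4 * t ^ 88 := by ring
      _ ≤ 4 * t ^ 93 := by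
        gcongr
        norm_num
  have e3 : 4 * (Q : ℝ) ^ 2 * (U : ℝ) ^ 2 ≤ 16 * t ^ 93 := by
    calc 4 * (Q : ℝ) ^ 2 * (U : ℝ) ^ 2 ≤ 4 * (2 * t ^ 40) ^ 2 * (t ^ 6) ^ 2 := by gcongr
      _ = 16 * t ^ 92 := by ring
      _ ≤ 16 * t ^ 93 := by
        gcongr
        norm_num
  refine mul_le_mul_of_nonneg_left ?_ (by positivity)
  linarith

/-- The mean value estimate over primitive characters of moderately large conductor. -/
lemma exists_sum_norm_psiChar_le : ∃ K : ℝ, 0 < K ∧ ∀ y : ℝ, 3 ≤ y → ∀ N Q : ℕ, 1 ≤ Q →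
    (Q : ℝ) ≤ y ^ (5 / 2 : ℝ) → y ^ 6 ≤ N + 1 →
    ∑ c ∈ (primFamily Q).filter (fun c => y ≤ 2 * c.1.totient),
      1 / (c.1.totient : ℝ) * ‖psiChar c.2 N‖ ≤ K * (N / Real.log y ^ 2) := by
  obtain ⟨C, hC, HC⟩ := exists_norm_psiChar_le 21 23
  set G : ℝ := ((7 + 1) / (1 / 32 : ℝ)) ^ 7 with hG
  have hG0 : 0 < G := by positivity
  refine ⟨324 * (2 + 22 * G) + (C + 2 * (Real.log 4 + 4) * 9), by positivity, ?_⟩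
  intro y hy N Q hQ hQy hyN
  have hy0 : 0 < y := by linarith
  have hly := one_le_log_of_three_le hy
  have hy3 : y ^ (5 / 2 : ℝ) ≤ y ^ 3 := by
    rw [← Real.rpow_natCast]
    exact Real.rpow_le_rpow_of_exponent_le (by linarith) (by norm_num)
  have hy27 : 27 ≤ y ^ 3 := by
    calc (27 : ℝ) = 3 ^ 3 := by norm_num
      _ ≤ y ^ 3 := by gcongr
  have hNbig : 2 * y ^ 3 ≤ N := by nlinarith
  have hyy : y ≤ y ^ 3 := le_self_pow₀ (by linarith) (by norm_num)
  have hyN1 : y ≤ N := by linarith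
  have hN54 : (54 : ℝ) ≤ N := by linarith
  have hN3 : 9 ≤ N := by exact_mod_cast (by linarith : (9 : ℝ) ≤ N)
  have hQN : 2 * Q ≤ N := by
    have : (2 : ℝ) * Q ≤ N := by linarith
    exact_mod_cast this
  have hN0 : (0 : ℝ) < N := by linarith
  have hL := one_le_log_of_three_le (x := N) (by linarith)
  set L := Real.log N with hLdef
  have hlyL : Real.log y ≤ L := Real.log_le_log hy0 hyN1
  have hQ5 : (Q : ℝ) ≤ 2 * (N : ℝ) ^ (5 / 12 : ℝ) := by
    calc (Q : ℝ) ≤ y ^ (5 / 2 : ℝ) := hQy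
      _ = (y ^ 6) ^ (5 / 12 : ℝ) := by
        rw [← Real.rpow_natCast, ← Real.rpow_mul hy0.le]
        norm_num
      _ ≤ (2 * N) ^ (5 / 12 : ℝ) := by
        refine Real.rpow_le_rpow (by positivity) (by linarith) (by norm_num)
      _ = 2 ^ (5 / 12 : ℝ) * (N : ℝ) ^ (5 / 12 : ℝ) := Real.mul_rpow (by norm_num) hN0.le
      _ ≤ 2 * (N : ℝ) ^ (5 / 12 : ℝ) := by
        gcongr
        calc (2 : ℝ) ^ (5 / 12 : ℝ) ≤ 2 ^ (1 : ℝ) :=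
              Real.rpow_le_rpow_of_exponent_le (by norm_num) (by norm_num)
          _ = 2 := by norm_num
  have hNL : (N : ℝ) / L ^ 2 ≤ N / Real.log y ^ 2 := by gcongr
  have hMpos : 0 < (N : ℝ) / Real.log y ^ 2 := by positivity
  rcases le_or_gt (L ^ 7) y with hcase | hcase
  · have hmain := sum_inv_totient_mul_norm_psiChar_le' hQ hQN (by omega) hQ5
      (z := y / 2) (by linarith)
    refine (Finset.sum_le_sum_of_subset_of_nonneg (t := (primFamily Q).filter
      (fun c => y / 2 ≤ c.1)) ?_ fun _ _ _ => by positivity).trans (hmain.trans ?_)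
    · intro c hc
      rw [Finset.mem_filter] at hc ⊢
      refine ⟨hc.1, ?_⟩
      have : (c.1.totient : ℝ) ≤ c.1 := by exact_mod_cast Nat.totient_le _
      linarith [hc.2]
    · have h1 : L ^ 5 * (N / (y / 2)) ≤ 2 * (N / L ^ 2) := by
        calc L ^ 5 * (N / (y / 2)) ≤ L ^ 5 * (N / (L ^ 7 / 2)) := by gcongr
          _ = _ := by field_simp
      have h2 : L ^ 5 * (N : ℝ) ^ (31 / 32 : ℝ) ≤ G * (N / L ^ 2) := by
        have h3 := log_pow_le_rpow 7 (x := N) (by linarith) (ε := 1 / 32) (by norm_num)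
        rw [← hLdef] at h3
        push_cast at h3
        rw [← hG] at h3
        have h4 : (N : ℝ) ^ (1 / 32 : ℝ) * (N : ℝ) ^ (31 / 32 : ℝ) = N := by
          rw [← Real.rpow_add hN0]
          norm_num
        rw [← mul_div_assoc, le_div_iff₀ (by positivity)]
        calc _ = L ^ 7 * (N : ℝ) ^ (31 / 32 : ℝ) := by ring
          _ ≤ G * (N : ℝ) ^ (1 / 32 : ℝ) * (N : ℝ) ^ (31 / 32 : ℝ) := by gcongr
          _ = _ := by rw [mul_assoc, h4]
      calc _ = 324 * (L ^ 5 * (N / (y / 2)) + 22 * (L ^ 5 * (N : ℝ) ^ (31 / 32 : ℝ))) := by ring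
        _ ≤ 324 * (2 * (N / L ^ 2) + 22 * (G * (N / L ^ 2))) := by gcongr
        _ = 324 * (2 + 22 * G) * (N / L ^ 2) := by ring
        _ ≤ 324 * (2 + 22 * G) * (N / Real.log y ^ 2) := by gcongr
        _ ≤ _ := by
          refine mul_le_mul_of_nonneg_right ?_ hMpos.le
          have : 0 ≤ C + 2 * (Real.log 4 + 4) * 9 := by positivity
          linarith
  · classical
    obtain ⟨b, hb⟩ := HC N hN3
    have hQL : (Q : ℝ) ≤ L ^ 21 := by
      calc (Q : ℝ) ≤ y ^ 3 := hQy.trans hy3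
        _ ≤ (L ^ 7) ^ 3 := by gcongr
        _ = L ^ 21 := by ring
    have hsplit : ∀ c ∈ (primFamily Q).filter (fun c => y ≤ 2 * c.1.totient),
        1 / (c.1.totient : ℝ) * ‖psiChar c.2 N‖ ≤
        1 / (c.1.totient : ℝ) * (C * (N / L ^ 23)) +
          if c = b then 2 / y * ((Real.log 4 + 4) * N) else 0 := by
      intro c hc
      rw [Finset.mem_filter, mem_primFamily] at hc
      obtain ⟨⟨⟨h2, hcQ⟩, hprim⟩, hφ⟩ := hc
      have hφ0 : (0 : ℝ) < c.1.totient := by linarith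
      have : NeZero c.1 := ⟨by omega⟩
      split_ifs with hcb
      · have h1 : ‖psiChar c.2 N‖ ≤ (Real.log 4 + 4) * N :=
          (norm_psiChar_le_psi _ _).trans (Chebyshev.psi_le_const_mul_self hN0.le)
        have h3 : 1 / (c.1.totient : ℝ) ≤ 2 / y := by
          rw [div_le_div_iff₀ hφ0 hy0]
          linarith
        have h4 : 1 / (c.1.totient : ℝ) * ‖psiChar c.2 N‖ ≤ 2 / y * ((Real.log 4 + 4) * N) := by
          gcongr
        have h5 : 0 ≤ 1 / (c.1.totient : ℝ) * (C * (N / L ^ 23)) := by positivity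
        linarith
      · rw [add_zero]
        have hcL : (c.1 : ℝ) ≤ L ^ 21 := le_trans (by exact_mod_cast hcQ) hQL
        have h1 := hb hcL hprim (ne_one_of_isPrimitive h2 hprim) hcb
        gcongr
    refine (Finset.sum_le_sum hsplit).trans ?_
    rw [Finset.sum_add_distrib]
    have h1 : ∑ c ∈ (primFamily Q).filter (fun c => y ≤ 2 * c.1.totient),
        1 / (c.1.totient : ℝ) * (C * (N / L ^ 23)) ≤ C * (N / Real.log y ^ 2) := by
      calc _ ≤ ∑ c ∈ primFamily Q, 1 / (c.1.totient : ℝ) * (C * (N / L ^ 23)) :=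
            Finset.sum_le_sum_of_subset_of_nonneg (Finset.filter_subset _ _)
              fun _ _ _ => by positivity
        _ = ∑ d ∈ Finset.Icc 2 Q, (primChars d).card *
            (1 / (d.totient : ℝ) * (C * (N / L ^ 23))) := by
            rw [primFamily, Finset.sum_sigma]
            simp
        _ ≤ ∑ d ∈ Finset.Icc 2 Q, C * (N / L ^ 23) := by
            refine Finset.sum_le_sum fun d hd => ?_
            have hd2 := (Finset.mem_Icc.1 hd).1
            have hφ0 : (0 : ℝ) < d.totient := by exact_mod_cast Nat.totient_pos.2 (by omega)
            have hcard : ((primChars d).card : ℝ) ≤ d.totient := by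
              exact_mod_cast card_primChars_le (by omega)
            rw [← mul_assoc, mul_one_div]
            refine mul_le_of_le_one_left (by positivity) ?_
            rwa [div_le_one hφ0]
        _ ≤ Q * (C * (N / L ^ 23)) := by
            rw [Finset.sum_const, nsmul_eq_mul]
            refine mul_le_mul_of_nonneg_right ?_ (by positivity)
            rw [Nat.card_Icc]
            exact_mod_cast (by omega : Q + 1 - 2 ≤ Q)
        _ ≤ L ^ 21 * (C * (N / L ^ 23)) := by gcongr
        _ = C * (N / L ^ 2) := by field_simp
        _ ≤ _ := by gcongr
    have h2 : ∑ c ∈ (primFamily Q).filter (fun c => y ≤ 2 * c.1.totient),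
        (if c = b then 2 / y * ((Real.log 4 + 4) * N) else 0) ≤
        2 * (Real.log 4 + 4) * 9 * (N / Real.log y ^ 2) := by
      rw [Finset.sum_ite_eq']
      have h3 := log_pow_le_rpow 2 (x := y) (by linarith) (ε := 1) (by norm_num)
      rw [Real.rpow_one] at h3
      have h4 : 1 / y ≤ 9 / Real.log y ^ 2 := by
        rw [div_le_div_iff₀ hy0 (by positivity)]
        norm_num at h3
        linarith
      split_ifs
      · calc _ = 2 * (Real.log 4 + 4) * N * (1 / y) := by ring
          _ ≤ 2 * (Real.log 4 + 4) * N * (9 / Real.log y ^ 2) := by gcongr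
          _ = _ := by ring
      · positivity
    have h3 : 0 ≤ 324 * (2 + 22 * G) * (N / Real.log y ^ 2) := by positivity
    linarith

/-- `ψ(N; r, 1)`. -/
noncomputable def psiAP (N r : ℕ) : ℝ :=
  ∑ n ∈ (Finset.Icc 1 N).filter (fun n => r ∣ n - 1), ArithmeticFunction.vonMangoldt n

/-- The part of `ψ(N)` supported on integers not coprime to `r`. -/
noncomputable def psiNonCoprime (N r : ℕ) : ℝ :=
  ∑ n ∈ (Finset.Icc 1 N).filter (fun n => ¬ n.Coprime r), ArithmeticFunction.vonMangoldt n

lemma sum_vonMangoldt_dvd_le {p : ℕ} (hp : p.Prime) (N : ℕ) :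
    ∑ n ∈ (Finset.Icc 1 N).filter (fun n => p ∣ n), ArithmeticFunction.vonMangoldt n ≤
      Real.log N := by
  rcases Nat.eq_zero_or_pos N with rfl | hN
  · simp
  calc _ ≤ ∑ n ∈ (Finset.Icc 1 (Nat.log p N)).image (p ^ ·), ArithmeticFunction.vonMangoldt n := by
        rw [← Finset.sum_filter_ne_zero]
        refine Finset.sum_le_sum_of_subset_of_nonneg (fun n hn => ?_) fun _ _ _ =>
          ArithmeticFunction.vonMangoldt_nonneg
        obtain ⟨hn, h0⟩ := Finset.mem_filter.1 hn
        rw [Finset.mem_filter, Finset.mem_Icc] at hn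
        obtain ⟨q, k, hq, hk, rfl⟩ := ArithmeticFunction.vonMangoldt_ne_zero_iff.1 h0
        rw [← Nat.prime_iff] at hq
        have hpq : p = q := (Nat.prime_dvd_prime_iff_eq hp hq).1 (hp.dvd_of_dvd_pow hn.2)
        rw [hpq]
        refine Finset.mem_image.2 ⟨k, Finset.mem_Icc.2 ⟨hk, ?_⟩, rfl⟩
        exact Nat.le_log_of_pow_le hq.one_lt hn.1.2
    _ = ∑ k ∈ Finset.Icc 1 (Nat.log p N), ArithmeticFunction.vonMangoldt (p ^ k) :=
        Finset.sum_image fun _ _ _ _ h => Nat.pow_right_injective hp.two_le h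
    _ = ∑ k ∈ Finset.Icc 1 (Nat.log p N), Real.log p := by
        refine Finset.sum_congr rfl fun k hk => ?_
        rw [ArithmeticFunction.vonMangoldt_apply_pow (by have := (Finset.mem_Icc.1 hk).1; omega),
          ArithmeticFunction.vonMangoldt_apply_prime hp]
    _ = Nat.log p N * Real.log p := by simp
    _ ≤ Real.log N := by
        rw [← Real.log_pow]
        refine Real.log_le_log (by have := hp.pos; positivity) ?_
        exact_mod_cast Nat.pow_log_le_self p (by omega)

lemma psiNonCoprime_le {r : ℕ} (hr : r ≠ 0) (N : ℕ) :
    psiNonCoprime N r ≤ r.primeFactors.card * Real.log N := by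
  calc psiNonCoprime N r ≤ ∑ n ∈ Finset.Icc 1 N, ∑ p ∈ r.primeFactors,
        if p ∣ n then ArithmeticFunction.vonMangoldt n else 0 := by
        rw [psiNonCoprime, Finset.sum_filter]
        refine Finset.sum_le_sum fun n _ => ?_
        have h0 : ∀ p ∈ r.primeFactors,
            0 ≤ if p ∣ n then ArithmeticFunction.vonMangoldt n else 0 := fun p _ => by
          split_ifs
          · exact ArithmeticFunction.vonMangoldt_nonneg
          · exact le_rfl
        by_cases hn : n.Coprime r
        · rw [if_neg (not_not.2 hn)]
          exact Finset.sum_nonneg h0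
        · obtain ⟨p, hp, hpn, hpr⟩ := Nat.Prime.not_coprime_iff_dvd.1 hn
          have := Finset.single_le_sum h0 (Nat.mem_primeFactors.2 ⟨hp, hpr, hr⟩)
          rw [if_pos hpn] at this
          rwa [if_pos hn]
    _ = ∑ p ∈ r.primeFactors, ∑ n ∈ (Finset.Icc 1 N).filter (fun n => p ∣ n),
        ArithmeticFunction.vonMangoldt n := by
        simp_rw [Finset.sum_filter]
        exact Finset.sum_comm
    _ ≤ ∑ p ∈ r.primeFactors, Real.log N := Finset.sum_le_sum fun p hp =>
        sum_vonMangoldt_dvd_le (Nat.prime_of_mem_primeFactors hp) N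
    _ = _ := by simp

lemma psiNonCoprime_nonneg (N r : ℕ) : 0 ≤ psiNonCoprime N r :=
  Finset.sum_nonneg fun _ _ => ArithmeticFunction.vonMangoldt_nonneg

lemma norm_psiChar_le_primitive {r : ℕ} (χ : DirichletCharacter ℂ r) (N : ℕ) :
    ‖psiChar χ N‖ ≤ ‖psiChar χ.primitiveCharacter N‖ + psiNonCoprime N r := by
  have h : ‖psiChar χ N - psiChar χ.primitiveCharacter N‖ ≤ psiNonCoprime N r := by
    rw [psiChar, psiChar, ← Finset.sum_sub_distrib, psiNonCoprime, Finset.sum_filter]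
    refine (norm_sum_le _ _).trans (Finset.sum_le_sum fun n _ => ?_)
    rw [← sub_mul, norm_mul, Complex.norm_real,
      Real.norm_of_nonneg ArithmeticFunction.vonMangoldt_nonneg]
    by_cases hn : n.Coprime r
    · have hcop : IsCoprime (n : ℤ) (r : ℤ) := Nat.isCoprime_iff_coprime.2 hn
      have := χ.primitiveCharacter_apply_of_isCoprime hcop
      push_cast at this
      rw [this, sub_self, norm_zero, zero_mul, if_neg (not_not.2 hn)]
    · rw [if_pos hn]
      refine mul_le_of_le_one_left ArithmeticFunction.vonMangoldt_nonneg ?_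
      have hnu : ¬ IsUnit (n : ZMod r) := by rwa [ZMod.isUnit_iff_coprime]
      rw [MulChar.map_nonunit χ hnu, zero_sub, norm_neg]
      exact DirichletCharacter.norm_le_one _ _
  have := norm_sub_norm_le (psiChar χ N) (psiChar χ.primitiveCharacter N)
  linarith

lemma sum_norm_psiChar_primitive_le {r Q : ℕ} [NeZero r] (hr : r ≤ Q) (N : ℕ) :
    ∑ χ ∈ (Finset.univ : Finset (DirichletCharacter ℂ r)).erase 1,
        ‖psiChar χ.primitiveCharacter N‖ ≤
      ∑ c ∈ (primFamily Q).filter (fun c => c.1 ∣ r), ‖psiChar c.2 N‖ := by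
  classical
  set f : DirichletCharacter ℂ r → Σ d : ℕ, DirichletCharacter ℂ d :=
    fun χ => ⟨χ.conductor, χ.primitiveCharacter⟩ with hf
  have hinj : Function.Injective f := by
    have : Function.LeftInverse (fun c : Σ d : ℕ, DirichletCharacter ℂ d =>
        if h : c.1 ∣ r then DirichletCharacter.changeLevel h c.2 else 1) f := by
      intro χ
      simp only [hf]
      rw [dif_pos χ.conductor_dvd_level, χ.changeLevel_primitiveCharacter]
    exact this.injective
  rw [← Finset.sum_image (s := (Finset.univ : Finset (DirichletCharacter ℂ r)).erase 1) (g := f)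
    (f := fun c => ‖psiChar c.2 N‖) hinj.injOn]
  refine Finset.sum_le_sum_of_subset_of_nonneg ?_ fun _ _ _ => norm_nonneg _
  intro c hc
  obtain ⟨χ, hχ, rfl⟩ := Finset.mem_image.1 hc
  have hχ1 := Finset.ne_of_mem_erase hχ
  rw [Finset.mem_filter, mem_primFamily]
  have hpos : χ.conductor ≠ 0 := χ.conductor_ne_zero
  have hne : χ.conductor ≠ 1 := fun h => hχ1 (χ.eq_one_iff_conductor_eq_one.2 h)
  have hle := Nat.le_of_dvd (Nat.pos_of_ne_zero (NeZero.ne r)) χ.conductor_dvd_level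
  refine ⟨⟨⟨?_, hle.trans hr⟩, χ.primitiveCharacter_isPrimitive⟩, χ.conductor_dvd_level⟩
  change 2 ≤ χ.conductor
  omega

lemma sum_psiChar (r : ℕ) [NeZero r] (N : ℕ) :
    ∑ χ : DirichletCharacter ℂ r, psiChar χ N = ((r.totient * psiAP N r : ℝ) : ℂ) := by
  simp only [psiChar]
  rw [Finset.sum_comm]
  simp only [← Finset.sum_mul, DirichletCharacter.sum_characters_eq]
  rw [psiAP, Finset.sum_filter, Finset.mul_sum]
  push_cast
  refine Finset.sum_congr rfl fun n hn => ?_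
  have hn1 := (Finset.mem_Icc.1 hn).1
  have hiff : (n : ZMod r) = 1 ↔ r ∣ n - 1 := by
    rw [← ZMod.natCast_eq_zero_iff, Nat.cast_sub hn1, Nat.cast_one, sub_eq_zero]
  by_cases h : r ∣ n - 1
  · rw [if_pos h, if_pos (hiff.2 h)]
  · rw [if_neg h, if_neg (mt hiff.1 h)]
    simp

lemma psiChar_one (r N : ℕ) :
    psiChar (1 : DirichletCharacter ℂ r) N =
      ((Chebyshev.psi N - psiNonCoprime N r : ℝ) : ℂ) := by
  rw [psiChar, Chebyshev.psi, Nat.floor_natCast, psiNonCoprime, Finset.sum_filter,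
    show Finset.Ioc 0 N = Finset.Icc 1 N from rfl, ← Finset.sum_sub_distrib]
  push_cast
  refine Finset.sum_congr rfl fun n _ => ?_
  by_cases hn : n.Coprime r
  · rw [MulChar.one_apply ((ZMod.isUnit_iff_coprime n r).2 hn)]
    simp [hn]
  · rw [MulChar.map_nonunit _ (by rwa [ZMod.isUnit_iff_coprime])]
    simp [hn]

/-- The error term in the prime number theorem in the progression `1 mod r`. -/
lemma abs_psiAP_sub_le {r Q : ℕ} (hr0 : r ≠ 0) (hr : r ≤ Q) (N : ℕ) :
    |psiAP N r - Chebyshev.psi N / r.totient| ≤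
      1 / (r.totient : ℝ) * ∑ c ∈ (primFamily Q).filter (fun c => c.1 ∣ r), ‖psiChar c.2 N‖ +
        psiNonCoprime N r := by
  classical
  have : NeZero r := ⟨hr0⟩
  have hφ : (0 : ℝ) < r.totient := by exact_mod_cast Nat.totient_pos.2 (Nat.pos_of_ne_zero hr0)
  have hsum := sum_psiChar r N
  rw [← Finset.add_sum_erase _ _ (Finset.mem_univ (1 : DirichletCharacter ℂ r)),
    psiChar_one] at hsum
  set S := ∑ χ ∈ (Finset.univ : Finset (DirichletCharacter ℂ r)).erase 1, psiChar χ N with hS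
  have hSeq : S = ((r.totient * psiAP N r - Chebyshev.psi N + psiNonCoprime N r : ℝ) : ℂ) := by
    rw [← sub_eq_iff_eq_add'.2 hsum.symm]
    push_cast
    ring
  have hSle : ‖S‖ ≤ ∑ c ∈ (primFamily Q).filter (fun c => c.1 ∣ r), ‖psiChar c.2 N‖ +
      (r.totient - 1) * psiNonCoprime N r := by
    calc ‖S‖ ≤ ∑ χ ∈ (Finset.univ : Finset (DirichletCharacter ℂ r)).erase 1,
          (‖psiChar χ.primitiveCharacter N‖ + psiNonCoprime N r) :=
          (norm_sum_le _ _).trans (Finset.sum_le_sum fun χ _ => norm_psiChar_le_primitive χ N)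
      _ ≤ _ := by
          rw [Finset.sum_add_distrib, Finset.sum_const, nsmul_eq_mul,
            Finset.card_erase_of_mem (Finset.mem_univ _), Finset.card_univ,
            ← Nat.card_eq_fintype_card,
            DirichletCharacter.card_eq_totient_of_hasEnoughRootsOfUnity ℂ r,
            Nat.cast_sub (Nat.totient_pos.2 (Nat.pos_of_ne_zero hr0)), Nat.cast_one]
          exact add_le_add_left (sum_norm_psiChar_primitive_le hr N) _
  rw [hSeq, Complex.norm_real, Real.norm_eq_abs] at hSle
  have hD := psiNonCoprime_nonneg N r
  have hfin : |r.totient * psiAP N r - Chebyshev.psi N| ≤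
      ∑ c ∈ (primFamily Q).filter (fun c => c.1 ∣ r), ‖psiChar c.2 N‖ +
      r.totient * psiNonCoprime N r := by
    have h1 : |r.totient * psiAP N r - Chebyshev.psi N| ≤
        |r.totient * psiAP N r - Chebyshev.psi N + psiNonCoprime N r| + psiNonCoprime N r := by
      have := abs_sub (r.totient * psiAP N r - Chebyshev.psi N + psiNonCoprime N r)
        (psiNonCoprime N r)
      rwa [add_sub_cancel_right, abs_of_nonneg hD] at this
    linarith
  have heq : psiAP N r - Chebyshev.psi N / r.totient =
      (r.totient * psiAP N r - Chebyshev.psi N) / r.totient := by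
    field_simp
  rw [heq, abs_div, abs_of_pos hφ, div_le_iff₀ hφ]
  refine hfin.trans (le_of_eq ?_)
  field_simp

/-- The ordered pairs `a < b` of elements of `P`. -/
def ltPairs (P : Finset ℕ) : Finset (ℕ × ℕ) := (P ×ˢ P).filter fun p => p.1 < p.2

lemma mem_ltPairs {P : Finset ℕ} {p : ℕ × ℕ} :
    p ∈ ltPairs P ↔ (p.1 ∈ P ∧ p.2 ∈ P) ∧ p.1 < p.2 := by
  rw [ltPairs, Finset.mem_filter, Finset.mem_product]

lemma sq_sum_eq_ltPairs (P : Finset ℕ) (f : ℕ → ℝ) :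
    (∑ a ∈ P, f a) ^ 2 = ∑ a ∈ P, f a ^ 2 + 2 * ∑ p ∈ ltPairs P, f p.1 * f p.2 := by
  have h1 : ∑ p ∈ (P ×ˢ P).filter (fun p => p.2 < p.1), f p.1 * f p.2 =
      ∑ p ∈ ltPairs P, f p.1 * f p.2 := by
    refine Finset.sum_nbij' Prod.swap Prod.swap ?_ ?_ ?_ ?_ ?_
    · intro p hp
      rw [Finset.mem_filter, Finset.mem_product] at hp
      exact mem_ltPairs.2 ⟨⟨hp.1.2, hp.1.1⟩, hp.2⟩
    · intro p hp
      rw [mem_ltPairs] at hp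
      rw [Finset.mem_filter, Finset.mem_product]
      exact ⟨⟨hp.1.2, hp.1.1⟩, hp.2⟩
    · exact fun p _ => Prod.swap_swap p
    · exact fun p _ => Prod.swap_swap p
    · exact fun p _ => mul_comm _ _
  have h2 : ∑ p ∈ (P ×ˢ P).filter (fun p => p.1 = p.2), f p.1 * f p.2 = ∑ a ∈ P, f a ^ 2 := by
    symm
    refine Finset.sum_nbij' (fun a => (a, a)) Prod.fst ?_ ?_ ?_ ?_ ?_
    · intro a ha
      rw [Finset.mem_filter, Finset.mem_product]
      exact ⟨⟨ha, ha⟩, rfl⟩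
    · intro p hp
      exact (Finset.mem_product.1 (Finset.mem_filter.1 hp).1).1
    · exact fun _ _ => rfl
    · intro p hp
      exact Prod.ext rfl (Finset.mem_filter.1 hp).2
    · exact fun a _ => sq _
  rw [sq, Finset.sum_mul_sum, ← Finset.sum_product',
    ← Finset.sum_filter_add_sum_filter_not _ (fun p => p.1 = p.2), h2]
  congr 1
  rw [← Finset.sum_filter_add_sum_filter_not _ (fun p : ℕ × ℕ => p.1 < p.2),
    Finset.filter_filter, Finset.filter_filter, two_mul]
  congr 1
  · rw [ltPairs]
    refine Finset.sum_congr (Finset.filter_congr fun p _ => ?_) fun _ _ => rfl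
    omega
  · rw [← h1]
    refine Finset.sum_congr (Finset.filter_congr fun p _ => ?_) fun _ _ => rfl
    omega

lemma mul_injOn_ltPairs {P : Finset ℕ} (hP : ∀ q ∈ P, q.Prime) :
    Set.InjOn (fun p : ℕ × ℕ => p.1 * p.2) (ltPairs P) := by
  rintro ⟨a, b⟩ h ⟨c, d⟩ h' heq
  rw [Finset.mem_coe, mem_ltPairs] at h h'
  simp only at h h' heq
  have ha := hP a h.1.1
  have hc := hP c h'.1.1
  have hb := hP b h.1.2
  have hd := hP d h'.1.2
  have h1 : a ∣ c * d := heq ▸ Dvd.intro _ rfl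
  rcases (ha.dvd_mul).1 h1 with h2 | h2
  · have hac := (Nat.prime_dvd_prime_iff_eq ha hc).1 h2
    subst hac
    have := Nat.eq_of_mul_eq_mul_left ha.pos heq
    rw [this]
  · have had := (Nat.prime_dvd_prime_iff_eq ha hd).1 h2
    subst had
    rw [mul_comm c a] at heq
    have := Nat.eq_of_mul_eq_mul_left ha.pos heq
    omega

/-- Summing the error terms over a family of moduli. -/
lemma sum_abs_psiAP_sub_le {ι : Type*} (M : Finset ι) (f : ι → ℕ) {Q N : ℕ} {y κ B : ℝ}
    (hinj : Set.InjOn f M) (hpos : ∀ i ∈ M, f i ≠ 0) (hQ : ∀ i ∈ M, f i ≤ Q)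
    (hy : ∀ i ∈ M, ∀ d, 2 ≤ d → d ∣ f i → y ≤ 2 * d.totient)
    (hκ : ∀ d, 2 ≤ d → ∑ i ∈ M.filter (fun i => d ∣ f i), 1 / ((f i).totient : ℝ) ≤
      κ * (1 / (d.totient : ℝ))) (hκ0 : 0 ≤ κ)
    (hω : ∀ i ∈ M, (f i).primeFactors.card ≤ 2)
    (hB : ∑ c ∈ (primFamily Q).filter (fun c => y ≤ 2 * c.1.totient),
      1 / (c.1.totient : ℝ) * ‖psiChar c.2 N‖ ≤ B) :
    ∑ i ∈ M, |psiAP N (f i) - Chebyshev.psi N / (f i).totient| ≤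
      κ * B + Q * (2 * Real.log N) := by
  have hlog : 0 ≤ Real.log N := Real.log_natCast_nonneg N
  have hcard : M.card ≤ Q := by
    rw [← Finset.card_image_of_injOn hinj]
    calc _ ≤ (Finset.Icc 1 Q).card := Finset.card_le_card fun r hr => by
          obtain ⟨i, hi, rfl⟩ := Finset.mem_image.1 hr
          have := hpos i hi
          exact Finset.mem_Icc.2 ⟨by omega, hQ i hi⟩
      _ = Q := by simp
  have hsum : ∑ i ∈ M, 1 / ((f i).totient : ℝ) *
      ∑ c ∈ (primFamily Q).filter (fun c => c.1 ∣ f i), ‖psiChar c.2 N‖ ≤ κ * B := by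
    calc _ = ∑ i ∈ M, ∑ c ∈ (primFamily Q).filter (fun c => y ≤ 2 * c.1.totient),
          if c.1 ∣ f i then 1 / ((f i).totient : ℝ) * ‖psiChar c.2 N‖ else 0 := by
          refine Finset.sum_congr rfl fun i hi => ?_
          rw [Finset.mul_sum, ← Finset.sum_filter, Finset.filter_filter]
          refine Finset.sum_congr (Finset.filter_congr fun c hc => ?_) fun _ _ => rfl
          exact ⟨fun h => ⟨hy i hi c.1 (mem_primFamily.1 hc).1.1 h, h⟩, fun h => h.2⟩
      _ = ∑ c ∈ (primFamily Q).filter (fun c => y ≤ 2 * c.1.totient),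
          (∑ i ∈ M.filter (fun i => c.1 ∣ f i), 1 / ((f i).totient : ℝ)) * ‖psiChar c.2 N‖ := by
          rw [Finset.sum_comm]
          refine Finset.sum_congr rfl fun c _ => ?_
          rw [Finset.sum_mul, Finset.sum_filter]
      _ ≤ ∑ c ∈ (primFamily Q).filter (fun c => y ≤ 2 * c.1.totient),
          κ * (1 / (c.1.totient : ℝ)) * ‖psiChar c.2 N‖ :=
          Finset.sum_le_sum fun c hc => mul_le_mul_of_nonneg_right
            (hκ c.1 (mem_primFamily.1 (Finset.mem_filter.1 hc).1).1.1) (norm_nonneg _)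
      _ = κ * ∑ c ∈ (primFamily Q).filter (fun c => y ≤ 2 * c.1.totient),
          1 / (c.1.totient : ℝ) * ‖psiChar c.2 N‖ := by
          rw [Finset.mul_sum]
          exact Finset.sum_congr rfl fun _ _ => mul_assoc _ _ _
      _ ≤ κ * B := mul_le_mul_of_nonneg_left hB hκ0
  calc _ ≤ ∑ i ∈ M, (1 / ((f i).totient : ℝ) *
        ∑ c ∈ (primFamily Q).filter (fun c => c.1 ∣ f i), ‖psiChar c.2 N‖ + 2 * Real.log N) := by
        refine Finset.sum_le_sum fun i hi => ?_
        refine (abs_psiAP_sub_le (hpos i hi) (hQ i hi) N).trans ?_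
        have h1 := psiNonCoprime_le (hpos i hi) N
        have h2 : ((f i).primeFactors.card : ℝ) ≤ 2 := by exact_mod_cast hω i hi
        have h3 : ((f i).primeFactors.card : ℝ) * Real.log N ≤ 2 * Real.log N := by gcongr
        linarith
    _ ≤ κ * B + Q * (2 * Real.log N) := by
        rw [Finset.sum_add_distrib, Finset.sum_const, nsmul_eq_mul]
        gcongr

lemma le_two_mul_totient {y : ℝ} (hy : 2 ≤ y) {d q : ℕ} (hd : d ≠ 0) (hq : q.Prime)
    (hqy : y < q) (hqd : q ∣ d) : y ≤ 2 * d.totient := by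
  have h1 : q - 1 ≤ d.totient := by
    rw [← Nat.totient_prime hq]
    exact Nat.le_of_dvd (Nat.totient_pos.2 (Nat.pos_of_ne_zero hd)) (Nat.totient_dvd_of_dvd hqd)
  have h2 : (q : ℝ) ≤ d.totient + 1 := by exact_mod_cast (by omega : q ≤ d.totient + 1)
  linarith

lemma bonferroni (P : Finset ℕ) (p : ℕ → Prop) [DecidablePred p] :
    (if ∀ q ∈ P, ¬ p q then (1 : ℝ) else 0) ≤
      1 - ∑ q ∈ P, (if p q then (1 : ℝ) else 0) +
        ∑ c ∈ ltPairs P, if p c.1 ∧ p c.2 then (1 : ℝ) else 0 := by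
  have h := sq_sum_eq_ltPairs P (fun q => if p q then (1 : ℝ) else 0)
  have h1 : ∑ q ∈ P, (if p q then (1 : ℝ) else 0) ^ 2 = ∑ q ∈ P, if p q then (1 : ℝ) else 0 :=
    Finset.sum_congr rfl fun q _ => by split_ifs <;> norm_num
  have h2 : ∑ c ∈ ltPairs P, (if p c.1 then (1 : ℝ) else 0) * (if p c.2 then (1 : ℝ) else 0) =
      ∑ c ∈ ltPairs P, if p c.1 ∧ p c.2 then (1 : ℝ) else 0 :=
    Finset.sum_congr rfl fun c _ => by
      by_cases h1 : p c.1 <;> by_cases h2 : p c.2 <;> simp [h1, h2]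
  rw [h1, h2] at h
  have hk : ∑ q ∈ P, (if p q then (1 : ℝ) else 0) = ((P.filter p).card : ℝ) := by simp
  rw [hk] at h ⊢
  by_cases hall : ∀ q ∈ P, ¬ p q
  · have h0 : (P.filter p).card = 0 := by
      rw [Finset.card_eq_zero, Finset.filter_eq_empty_iff]
      exact hall
    rw [h0] at h ⊢
    rw [if_pos hall]
    push_cast at h ⊢
    linarith
  · rw [if_neg hall]
    push Not at hall
    obtain ⟨q, hq, hpq⟩ := hall
    have hpos : 1 ≤ (P.filter p).card :=
      Finset.card_pos.2 ⟨q, Finset.mem_filter.2 ⟨hq, hpq⟩⟩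
    set k := (P.filter p).card
    have hkk : (0 : ℝ) ≤ ((k : ℝ) - 1) * (k - 2) := by
      rcases Nat.lt_or_ge k 2 with h2 | h2
      · have : k = 1 := by omega
        rw [this]
        norm_num
      · have : (2 : ℝ) ≤ k := by exact_mod_cast h2
        exact mul_nonneg (by linarith) (by linarith)
    nlinarith

lemma sum_primes_abs_psiAP_sub_le {P : Finset ℕ} (hP : ∀ q ∈ P, q.Prime) {Q N : ℕ} {y B : ℝ}
    (hy2 : 2 ≤ y) (hPy : ∀ q ∈ P, y < q) (hQ : ∀ q ∈ P, q ≤ Q)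
    (hB : ∑ c ∈ (primFamily Q).filter (fun c => y ≤ 2 * c.1.totient),
      1 / (c.1.totient : ℝ) * ‖psiChar c.2 N‖ ≤ B) :
    ∑ q ∈ P, |psiAP N q - Chebyshev.psi N / q.totient| ≤ 1 * B + Q * (2 * Real.log N) := by
  refine sum_abs_psiAP_sub_le P (fun q => q) Function.injective_id.injOn
    (fun q hq => (hP q hq).ne_zero) hQ ?_ ?_ zero_le_one ?_ hB
  · intro q hq d hd hdq
    have : d = q := ((Nat.dvd_prime (hP q hq)).1 hdq).resolve_left (by omega)
    subst this
    exact le_two_mul_totient hy2 (hP d hq).ne_zero (hP d hq) (hPy d hq) dvd_rfl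
  · intro d hd
    calc _ ≤ ∑ q ∈ ({d} : Finset ℕ), 1 / (q.totient : ℝ) := by
          refine Finset.sum_le_sum_of_subset_of_nonneg ?_ fun _ _ _ => by positivity
          intro q hq
          rw [Finset.mem_filter] at hq
          rw [Finset.mem_singleton]
          exact (((Nat.dvd_prime (hP q hq.1)).1 hq.2).resolve_left (by omega)).symm
      _ = _ := by rw [Finset.sum_singleton, one_mul]
  · intro q hq
    rw [(hP q hq).primeFactors]
    simp

lemma sum_pairs_abs_psiAP_sub_le {P : Finset ℕ} (hP : ∀ q ∈ P, q.Prime) {Q N : ℕ} {y B : ℝ}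
    (hy2 : 2 ≤ y) (hPy : ∀ q ∈ P, y < q) (hQ : ∀ p ∈ ltPairs P, p.1 * p.2 ≤ Q)
    (hS : ∑ q ∈ P, 1 / (q.totient : ℝ) ≤ 1)
    (hB : ∑ c ∈ (primFamily Q).filter (fun c => y ≤ 2 * c.1.totient),
      1 / (c.1.totient : ℝ) * ‖psiChar c.2 N‖ ≤ B) :
    ∑ p ∈ ltPairs P, |psiAP N (p.1 * p.2) - Chebyshev.psi N / (p.1 * p.2).totient| ≤
      2 * B + Q * (2 * Real.log N) := by
  have hne : ∀ p ∈ ltPairs P, p.1 * p.2 ≠ 0 := fun p hp => by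
    rw [mem_ltPairs] at hp
    exact mul_ne_zero (hP _ hp.1.1).ne_zero (hP _ hp.1.2).ne_zero
  refine sum_abs_psiAP_sub_le (ltPairs P) (fun p => p.1 * p.2) (mul_injOn_ltPairs hP) hne hQ
    ?_ ?_ zero_le_two ?_ hB
  · intro p hp d hd hdp
    rw [mem_ltPairs] at hp
    obtain ⟨q, hq, hqd⟩ := Nat.exists_prime_and_dvd (n := d) (by omega)
    have hqP : q ∈ P := by
      rcases (hq.dvd_mul).1 (hqd.trans hdp) with h | h
      · rw [(Nat.prime_dvd_prime_iff_eq hq (hP _ hp.1.1)).1 h]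
        exact hp.1.1
      · rw [(Nat.prime_dvd_prime_iff_eq hq (hP _ hp.1.2)).1 h]
        exact hp.1.2
    exact le_two_mul_totient hy2 (by omega) hq (hPy q hqP) hqd
  · intro d hd
    have hφd : (0 : ℝ) < d.totient := by exact_mod_cast Nat.totient_pos.2 (by omega)
    have h1P : 1 ∉ P := fun h => Nat.not_prime_one (hP 1 h)
    have hinj : Set.InjOn (fun p : ℕ × ℕ => p.1 * p.2 / d)
        ((ltPairs P).filter (fun p => d ∣ p.1 * p.2)) := by
      intro p hp p' hp' heq
      rw [Finset.mem_coe, Finset.mem_filter] at hp hp'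
      refine mul_injOn_ltPairs hP hp.1 hp'.1 ?_
      change p.1 * p.2 = p'.1 * p'.2
      rw [← Nat.mul_div_cancel' hp.2, ← Nat.mul_div_cancel' hp'.2]
      exact congrArg (d * ·) heq
    have hmaps : ∀ p ∈ (ltPairs P).filter (fun p => d ∣ p.1 * p.2),
        p.1 * p.2 / d ∈ insert 1 P := by
      intro p hp
      rw [Finset.mem_filter, mem_ltPairs] at hp
      obtain ⟨⟨hpP, hlt⟩, m, hm⟩ := hp
      rw [hm, Nat.mul_div_cancel_left _ (by omega), Finset.mem_insert]
      by_contra! hcon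
      obtain ⟨q, hq, hqd⟩ := Nat.exists_prime_and_dvd (n := d) (by omega)
      obtain ⟨q', hq', hqm⟩ := Nat.exists_prime_and_dvd (n := m) hcon.1
      have hpa := hP _ hpP.1
      have hpb := hP _ hpP.2
      obtain ⟨e, he⟩ := hqd
      obtain ⟨e', he'⟩ := hqm
      have hprod : p.1 * p.2 = q * q' * (e * e') := by rw [hm, he, he']; ring
      have hq1 : q ∣ p.1 * p.2 := ⟨q' * (e * e'), by rw [hprod]; ring⟩
      rcases (hq.dvd_mul).1 hq1 with h | h
      · have := (Nat.prime_dvd_prime_iff_eq hq hpa).1 h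
        rw [this, mul_assoc] at hprod
        have h2 := Nat.eq_of_mul_eq_mul_left hpa.pos hprod
        rcases (Nat.dvd_prime hpb).1 (Dvd.intro _ h2.symm) with h3 | h3
        · exact hq'.one_lt.ne' h3
        · rw [h3] at h2
          have h4 : e * e' = 1 := by
            have := Nat.eq_of_mul_eq_mul_left hpb.pos (h2.symm.trans (mul_one _).symm)
            exact this
          have h5 := Nat.eq_one_of_mul_eq_one_left h4
          rw [h5, mul_one] at he'
          exact hcon.2 (by rw [he', h3]; exact hpP.2)
      · have := (Nat.prime_dvd_prime_iff_eq hq hpb).1 h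
        rw [this, mul_assoc, mul_comm p.1] at hprod
        have h2 := Nat.eq_of_mul_eq_mul_left hpb.pos hprod
        rcases (Nat.dvd_prime hpa).1 (Dvd.intro _ h2.symm) with h3 | h3
        · exact hq'.one_lt.ne' h3
        · rw [h3] at h2
          have h4 : e * e' = 1 := by
            have := Nat.eq_of_mul_eq_mul_left hpa.pos (h2.symm.trans (mul_one _).symm)
            exact this
          have h5 := Nat.eq_one_of_mul_eq_one_left h4
          rw [h5, mul_one] at he'
          exact hcon.2 (by rw [he', h3]; exact hpP.1)
    calc _ ≤ ∑ p ∈ (ltPairs P).filter (fun p => d ∣ p.1 * p.2),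
          1 / (d.totient : ℝ) * (1 / ((p.1 * p.2 / d).totient : ℝ)) := by
          refine Finset.sum_le_sum fun p hp => ?_
          have hpne := hne p (Finset.mem_filter.1 hp).1
          obtain ⟨m, hm⟩ := (Finset.mem_filter.1 hp).2
          rw [hm] at hpne ⊢
          rw [Nat.mul_div_cancel_left _ (by omega), one_div_mul_one_div]
          have hm0 : 0 < m := Nat.pos_of_ne_zero (right_ne_zero_of_mul hpne)
          have hφm : (0 : ℝ) < m.totient := by exact_mod_cast Nat.totient_pos.2 hm0
          have hsuper : (d.totient : ℝ) * m.totient ≤ (d * m).totient := by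
            exact_mod_cast Nat.totient_super_multiplicative d m
          exact one_div_le_one_div_of_le (mul_pos hφd hφm) hsuper
      _ = 1 / (d.totient : ℝ) * ∑ r ∈ ((ltPairs P).filter (fun p => d ∣ p.1 * p.2)).image
          (fun p => p.1 * p.2 / d), 1 / (r.totient : ℝ) := by
          rw [Finset.sum_image hinj, Finset.mul_sum]
      _ ≤ 1 / (d.totient : ℝ) * ∑ r ∈ insert 1 P, 1 / (r.totient : ℝ) := by
          refine mul_le_mul_of_nonneg_left ?_ (by positivity)
          refine Finset.sum_le_sum_of_subset_of_nonneg ?_ fun _ _ _ => by positivity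
          intro r hr
          obtain ⟨p, hp, rfl⟩ := Finset.mem_image.1 hr
          exact hmaps p hp
      _ ≤ 1 / (d.totient : ℝ) * 2 := by
          refine mul_le_mul_of_nonneg_left ?_ (by positivity)
          rw [Finset.sum_insert h1P, Nat.totient_one]
          norm_num
          simp only [one_div] at hS
          linarith
      _ = _ := mul_comm _ _
  · intro p hp
    rw [mem_ltPairs] at hp
    rw [Nat.primeFactors_mul (hP _ hp.1.1).ne_zero (hP _ hp.1.2).ne_zero,
      (hP _ hp.1.1).primeFactors, (hP _ hp.1.2).primeFactors]
    exact Finset.card_union_le _ _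

/-- The sieve bound in terms of the von Mangoldt function. -/
lemma sum_vonMangoldt_sieve_le {P : Finset ℕ} (hP : ∀ q ∈ P, q.Prime) {Q N : ℕ} {y B : ℝ}
    (hy2 : 2 ≤ y) (hPy : ∀ q ∈ P, y < q) (hPQ : ∀ q ∈ P, q ≤ Q)
    (hQ : ∀ p ∈ ltPairs P, p.1 * p.2 ≤ Q)
    (hS : ∑ q ∈ P, 1 / (q.totient : ℝ) ≤ 1)
    (hB : ∑ c ∈ (primFamily Q).filter (fun c => y ≤ 2 * c.1.totient),
      1 / (c.1.totient : ℝ) * ‖psiChar c.2 N‖ ≤ B) :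
    ∑ n ∈ (Finset.Icc 1 N).filter (fun n => ∀ q ∈ P, ¬ q ∣ n - 1),
        ArithmeticFunction.vonMangoldt n ≤
      Chebyshev.psi N * (1 - ∑ q ∈ P, 1 / (q.totient : ℝ) +
        (∑ q ∈ P, 1 / (q.totient : ℝ)) ^ 2 / 2) + (3 * B + 4 * Q * Real.log N) := by
  have h1 := sum_primes_abs_psiAP_sub_le hP hy2 hPy hPQ hB
  have h2 := sum_pairs_abs_psiAP_sub_le hP hy2 hPy hQ hS hB
  have h3 : ∑ q ∈ P, (Chebyshev.psi N * (1 / (q.totient : ℝ)) - psiAP N q) ≤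
      1 * B + Q * (2 * Real.log N) := by
    refine le_trans (Finset.sum_le_sum fun q _ => ?_) h1
    rw [abs_sub_comm, mul_one_div]
    exact le_abs_self _
  have h4 : ∑ p ∈ ltPairs P, (psiAP N (p.1 * p.2) -
      Chebyshev.psi N * (1 / (p.1.totient : ℝ) * (1 / (p.2.totient : ℝ)))) ≤
      2 * B + Q * (2 * Real.log N) := by
    refine le_trans (Finset.sum_le_sum fun p hp => ?_) h2
    rw [mem_ltPairs] at hp
    have hcop : p.1.Coprime p.2 :=
      (Nat.coprime_primes (hP _ hp.1.1) (hP _ hp.1.2)).2 hp.2.ne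
    rw [Nat.totient_mul hcop, one_div_mul_one_div, mul_one_div, Nat.cast_mul]
    exact le_abs_self _
  rw [Finset.sum_sub_distrib, ← Finset.mul_sum] at h3 h4
  have hsq := sq_sum_eq_ltPairs P (fun q => 1 / (q.totient : ℝ))
  have hsq0 : 0 ≤ ∑ q ∈ P, (1 / (q.totient : ℝ)) ^ 2 := Finset.sum_nonneg fun _ _ => sq_nonneg _
  set S := ∑ q ∈ P, 1 / (q.totient : ℝ)
  set S₂ := ∑ p ∈ ltPairs P, 1 / (p.1.totient : ℝ) * (1 / (p.2.totient : ℝ))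
  have hS2 : S₂ ≤ S ^ 2 / 2 := by linarith
  have hψ := Chebyshev.psi_nonneg (N : ℝ)
  have hψS := mul_le_mul_of_nonneg_left hS2 hψ
  have hswap1 : ∑ q ∈ P, psiAP N q = ∑ n ∈ Finset.Icc 1 N,
      ArithmeticFunction.vonMangoldt n * ∑ q ∈ P, if q ∣ n - 1 then (1 : ℝ) else 0 := by
    simp_rw [psiAP, Finset.sum_filter, Finset.mul_sum]
    rw [Finset.sum_comm]
    exact Finset.sum_congr rfl fun n _ => Finset.sum_congr rfl fun q _ => by
      rw [mul_ite, mul_one, mul_zero]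
  have hswap2 : ∑ p ∈ ltPairs P, psiAP N (p.1 * p.2) = ∑ n ∈ Finset.Icc 1 N,
      ArithmeticFunction.vonMangoldt n *
        ∑ p ∈ ltPairs P, if p.1 ∣ n - 1 ∧ p.2 ∣ n - 1 then (1 : ℝ) else 0 := by
    simp_rw [psiAP, Finset.sum_filter, Finset.mul_sum]
    rw [Finset.sum_comm]
    refine Finset.sum_congr rfl fun n _ => Finset.sum_congr rfl fun p hp => ?_
    rw [mem_ltPairs] at hp
    have hcop : p.1.Coprime p.2 :=
      (Nat.coprime_primes (hP _ hp.1.1) (hP _ hp.1.2)).2 hp.2.ne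
    rw [mul_ite, mul_one, mul_zero]
    have hiff : p.1 * p.2 ∣ n - 1 ↔ p.1 ∣ n - 1 ∧ p.2 ∣ n - 1 :=
      ⟨fun h => ⟨(Dvd.intro _ rfl).trans h, (Dvd.intro_left _ rfl).trans h⟩,
        fun h => hcop.mul_dvd_of_dvd_of_dvd h.1 h.2⟩
    by_cases h : p.1 * p.2 ∣ n - 1
    · rw [if_pos h, if_pos (hiff.1 h)]
    · rw [if_neg h, if_neg (mt hiff.2 h)]
  have hmain : ∑ n ∈ (Finset.Icc 1 N).filter (fun n => ∀ q ∈ P, ¬ q ∣ n - 1),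
        ArithmeticFunction.vonMangoldt n ≤
      Chebyshev.psi N - ∑ q ∈ P, psiAP N q + ∑ p ∈ ltPairs P, psiAP N (p.1 * p.2) := by
    rw [hswap1, hswap2, Chebyshev.psi, Nat.floor_natCast,
      show Finset.Ioc 0 N = Finset.Icc 1 N from rfl, ← Finset.sum_sub_distrib,
      ← Finset.sum_add_distrib, Finset.sum_filter]
    refine Finset.sum_le_sum fun n _ => ?_
    have := mul_le_mul_of_nonneg_left (bonferroni P (fun q => q ∣ n - 1))
      (ArithmeticFunction.vonMangoldt_nonneg (n := n))
    rw [mul_ite, mul_one, mul_zero] at this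
    refine this.trans (le_of_eq ?_)
    ring
  nlinarith

lemma abs_theta_sub_le : ∃ C : ℝ, 0 < C ∧ ∀ x : ℝ, 9 ≤ x →
    |Chebyshev.theta x - x| ≤ C * (x / Real.log x ^ 2) := by
  obtain ⟨C, hC, H⟩ := abs_psi_sub_le 2
  refine ⟨C + 2 * ((3 + 1) / (1 / 2)) ^ 3, by positivity, fun x hx => ?_⟩
  have hl := one_le_log_of_three_le (x := x) (by linarith)
  have h1 := abs_le.1 (H x hx)
  have h2 := Chebyshev.theta_le_psi x
  have h3 := Chebyshev.psi_sub_theta_le (x := x) (by linarith)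
  have h4 := log_pow_le_rpow 3 (x := x) (by linarith) (ε := 1 / 2) (by norm_num)
  rw [← Real.sqrt_eq_rpow] at h4
  push_cast at h4
  have h5 : 2 * √x * Real.log x ≤ 2 * ((3 + 1) / (1 / 2)) ^ 3 * (x / Real.log x ^ 2) := by
    rw [← mul_div_assoc, le_div_iff₀ (by positivity)]
    calc _ = 2 * √x * Real.log x ^ 3 := by ring
      _ ≤ 2 * √x * (((3 + 1) / (1 / 2)) ^ 3 * √x) := by gcongr
      _ = 2 * ((3 + 1) / (1 / 2)) ^ 3 * (√x * √x) := by ring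
      _ = _ := by rw [Real.mul_self_sqrt (by linarith)]
  have h6 : 0 ≤ 2 * ((3 + 1) / (1 / 2)) ^ 3 * (x / Real.log x ^ 2) := by positivity
  rw [abs_le, add_mul]
  constructor <;> linarith

/-- Mertens' estimate for `∑ 1/p` over an interval, with error `O(1 / log² y)`. -/
lemma abs_sum_inv_prime_sub_le : ∃ K : ℝ, 0 < K ∧ ∀ y z : ℝ, 9 ≤ y → y ≤ z →
    |∑ q ∈ (Finset.Ioc ⌊y⌋₊ ⌊z⌋₊).filter Nat.Prime, 1 / (q : ℝ) -
      (Real.log (Real.log z) - Real.log (Real.log y))| ≤ K / Real.log y ^ 2 := by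
  obtain ⟨C, hC, H⟩ := abs_theta_sub_le
  refine ⟨3 * C, by positivity, fun y z hy hyz => ?_⟩
  have hly := one_le_log_of_three_le (x := y) (by linarith)
  have hlyz : Real.log y ≤ Real.log z := Real.log_le_log (by linarith) hyz
  set f : ℝ → ℝ := fun t => 1 / (t * Real.log t) with hf
  set f' : ℝ → ℝ := fun t => -(Real.log t + 1) / (t * Real.log t) ^ 2 with hf'
  have hpos : ∀ t ∈ Icc y z, 0 < t ∧ 1 ≤ Real.log t := fun t ht =>
    ⟨by linarith [ht.1], one_le_log_of_three_le (by linarith [ht.1])⟩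
  have hderiv : ∀ t ∈ Icc y z, HasDerivAt f (f' t) t := by
    intro t ht
    obtain ⟨h0, h1⟩ := hpos t ht
    have hne : t * Real.log t ≠ 0 := by positivity
    have h2 : HasDerivAt (fun t => t * Real.log t) (Real.log t + 1) t :=
        Real.hasDerivAt_mul_log h0.ne'
    have h3 := h2.inv hne
    simp only [hf, one_div]
    exact h3
  have hcont : ContinuousOn f' (Icc y z) := by
    intro t ht
    obtain ⟨h0, h1⟩ := hpos t ht
    have hne : t * Real.log t ≠ 0 := by positivity
    refine ContinuousAt.continuousWithinAt ?_
    have hlog := Real.continuousAt_log h0.ne'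
    exact ((hlog.add continuousAt_const).neg).div ((continuousAt_id.mul hlog).pow 2)
      (pow_ne_zero 2 hne)
  have habel := sum_mul_eq_sub_sub_integral_mul
    (fun n : ℕ => if n.Prime then Real.log n else 0) (f := f) (a := y) (b := z)
    (by linarith) hyz (fun t ht => (hderiv t ht).differentiableAt)
    ((hcont.congr fun t ht => (hderiv t ht).deriv).integrableOn_Icc)
  have hθ : ∀ t : ℝ, ∑ k ∈ Finset.Icc 0 ⌊t⌋₊, (if k.Prime then Real.log k else 0) =
      Chebyshev.theta t := by
    intro t
    rw [Chebyshev.theta_eq_sum_Icc, Finset.sum_filter]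
  simp only [hθ] at habel
  have hsum : ∑ k ∈ Finset.Ioc ⌊y⌋₊ ⌊z⌋₊, f k * (if k.Prime then Real.log k else 0) =
      ∑ q ∈ (Finset.Ioc ⌊y⌋₊ ⌊z⌋₊).filter Nat.Prime, 1 / (q : ℝ) := by
    rw [Finset.sum_filter]
    refine Finset.sum_congr rfl fun k hk => ?_
    split_ifs with hp
    · have h1 : 0 < Real.log k := Real.log_pos (by exact_mod_cast hp.one_lt)
      have h2 : (0 : ℝ) < k := by exact_mod_cast hp.pos
      simp only [hf]
      field_simp
    · rw [mul_zero]
  rw [hsum] at habel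
  have hInt : ∫ t in Ioc y z, deriv f t * Chebyshev.theta t =
      ∫ t in y..z, f' t * Chebyshev.theta t := by
    rw [intervalIntegral.integral_of_le hyz]
    refine setIntegral_congr_fun measurableSet_Ioc fun t ht => ?_
    simp only [(hderiv t (Ioc_subset_Icc_self ht)).deriv]
  rw [hInt] at habel
  have huIcc : uIcc y z = Icc y z := uIcc_of_le hyz
  have hi1 : IntervalIntegrable (fun t => f' t * Chebyshev.theta t) volume y z := by
    refine (Chebyshev.theta_mono.intervalIntegrable).continuousOn_mul ?_
    rwa [huIcc]
  have hi2 : IntervalIntegrable (fun t => f' t * t) volume y z := by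
    refine ContinuousOn.intervalIntegrable ?_
    rw [huIcc]
    exact hcont.mul continuousOn_id
  have hmain : ∫ t in y..z, f' t * t =
      (-Real.log (Real.log z) + 1 / Real.log z) - (-Real.log (Real.log y) + 1 / Real.log y) := by
    refine intervalIntegral.integral_eq_sub_of_hasDerivAt
      (f := fun t => -Real.log (Real.log t) + 1 / Real.log t) (fun t ht => ?_) hi2
    rw [huIcc] at ht
    obtain ⟨h0, h1⟩ := hpos t ht
    have hlog := Real.hasDerivAt_log h0.ne'
    have h2 := ((hlog.log (by positivity)).neg).add (hlog.inv (by positivity))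
    simp only [one_div]
    refine h2.congr_deriv ?_
    simp only [hf']
    field_simp
    ring
  have herr : |∫ t in y..z, f' t * (Chebyshev.theta t - t)| ≤ C / Real.log y ^ 2 := by
    have hg : ∀ t ∈ uIcc y z, HasDerivAt (fun t => -(C / Real.log t ^ 2))
        (2 * C / (t * Real.log t ^ 3)) t := by
      intro t ht
      rw [huIcc] at ht
      obtain ⟨h0, h1⟩ := hpos t ht
      have hlog := Real.hasDerivAt_log h0.ne'
      have h2 := (((hlog.pow 2).inv (pow_ne_zero 2 (by positivity))).const_mul C).neg
      simp only [div_eq_mul_inv C]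
      refine h2.congr_deriv ?_
      simp only [Pi.pow_apply]
      field_simp
      push_cast
      ring
    have hgi : IntervalIntegrable (fun t => 2 * C / (t * Real.log t ^ 3)) volume y z := by
      refine ContinuousOn.intervalIntegrable ?_
      rw [huIcc]
      intro t ht
      obtain ⟨h0, h1⟩ := hpos t ht
      refine ContinuousAt.continuousWithinAt ?_
      exact continuousAt_const.div (continuousAt_id.mul ((Real.continuousAt_log h0.ne').pow 3))
        (mul_ne_zero h0.ne' (by positivity))
    have hle : |∫ t in y..z, f' t * (Chebyshev.theta t - t)| ≤
        ∫ t in y..z, 2 * C / (t * Real.log t ^ 3) := by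
      rw [← Real.norm_eq_abs]
      refine intervalIntegral.norm_integral_le_of_norm_le hyz
        (Eventually.of_forall fun t ht => ?_) hgi
      have ht' := Ioc_subset_Icc_self ht
      obtain ⟨h0, h1⟩ := hpos t ht'
      have hE := H t (by linarith [ht'.1])
      rw [norm_mul, Real.norm_eq_abs, Real.norm_eq_abs]
      have hf'le : |f' t| ≤ 2 / (t ^ 2 * Real.log t) := by
        simp only [hf']
        rw [abs_div, abs_neg, abs_of_pos (by linarith), abs_of_pos (by positivity),
          div_le_div_iff₀ (by positivity) (by positivity)]
        have h3 : 0 ≤ t ^ 2 * Real.log t := by positivity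
        have : (Real.log t + 1) * (t ^ 2 * Real.log t) ≤
            (2 * Real.log t) * (t ^ 2 * Real.log t) := by
          gcongr
          linarith
        refine this.trans (le_of_eq (by ring))
      calc |f' t| * |Chebyshev.theta t - t| ≤
            2 / (t ^ 2 * Real.log t) * (C * (t / Real.log t ^ 2)) := by gcongr
        _ = 2 * C / (t * Real.log t ^ 3) := by field_simp
    refine hle.trans ?_
    rw [intervalIntegral.integral_eq_sub_of_hasDerivAt hg hgi]
    have : 0 ≤ C / Real.log z ^ 2 := by positivity
    linarith
  have hsplit : ∫ t in y..z, f' t * Chebyshev.theta t =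
      (∫ t in y..z, f' t * (Chebyshev.theta t - t)) + ∫ t in y..z, f' t * t := by
    rw [← intervalIntegral.integral_add _ hi2]
    · refine intervalIntegral.integral_congr fun t _ => ?_
      ring
    · refine (hi1.sub hi2).congr (fun t _ => ?_)
      ring
  have hend : ∀ t ∈ Icc y z, |f t * (Chebyshev.theta t - t)| ≤ C / Real.log y ^ 2 := by
    intro t ht
    obtain ⟨h0, h1⟩ := hpos t ht
    have hE := H t (by linarith [ht.1])
    have hlyt : Real.log y ≤ Real.log t := Real.log_le_log (by linarith) ht.1
    have hfpos : 0 ≤ f t := by simp only [hf]; positivity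
    rw [abs_mul, abs_of_nonneg hfpos]
    calc f t * |Chebyshev.theta t - t| ≤ f t * (C * (t / Real.log t ^ 2)) := by gcongr
      _ = C / Real.log t ^ 2 / Real.log t := by
        simp only [hf]
        field_simp
      _ ≤ C / Real.log t ^ 2 := div_le_self (by positivity) h1
      _ ≤ _ := by gcongr
  have hft : ∀ t ∈ Icc y z, f t * t = 1 / Real.log t := by
    intro t ht
    obtain ⟨h0, h1⟩ := hpos t ht
    simp only [hf]
    field_simp
  have hy1 := abs_le.1 (hend y (left_mem_Icc.2 hyz))
  have hz1 := abs_le.1 (hend z (right_mem_Icc.2 hyz))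
  have herr' := abs_le.1 herr
  have hfy := hft y (left_mem_Icc.2 hyz)
  have hfz := hft z (right_mem_Icc.2 hyz)
  rw [habel, hsplit, hmain, mul_div_assoc, abs_le]
  rw [mul_sub, hfy] at hy1
  rw [mul_sub, hfz] at hz1
  constructor <;> linarith

lemma integral_one_div_log_sq_le {a b : ℝ} (hab : a ≤ b) (ha : Real.exp 52 ≤ a) :
    ∫ t in a..b, 1 / Real.log t ^ 2 ≤ 1.04 * (b / Real.log b ^ 2) := by
  have huIcc : uIcc a b = Icc a b := uIcc_of_le hab
  have hlog : ∀ t ∈ Icc a b, 0 < t ∧ 52 ≤ Real.log t := fun t ht =>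
    have h := ha.trans ht.1
    ⟨(Real.exp_pos _).trans_le h, (Real.le_log_iff_exp_le ((Real.exp_pos _).trans_le h)).2 h⟩
  have hcont : ContinuousOn Real.log (Icc a b) := fun t ht =>
    (Real.continuousAt_log (hlog t ht).1.ne').continuousWithinAt
  have hne : ∀ t ∈ Icc a b, Real.log t ≠ 0 := fun t ht => by linarith [(hlog t ht).2]
  have hi1 : IntervalIntegrable (fun t => 1 / Real.log t ^ 2) volume a b := by
    refine ContinuousOn.intervalIntegrable ?_
    rw [huIcc]
    exact continuousOn_const.div (hcont.pow 2) fun t ht => pow_ne_zero 2 (hne t ht)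
  have hi2 : IntervalIntegrable (fun t => 1.04 * (1 / Real.log t ^ 2 - 2 / Real.log t ^ 3))
      volume a b := by
    refine ContinuousOn.intervalIntegrable ?_
    rw [huIcc]
    exact continuousOn_const.mul
      ((continuousOn_const.div (hcont.pow 2) fun t ht => pow_ne_zero 2 (hne t ht)).sub
        (continuousOn_const.div (hcont.pow 3) fun t ht => pow_ne_zero 3 (hne t ht)))
  have hder : ∀ t ∈ uIcc a b, HasDerivAt (fun t => 1.04 * (t / Real.log t ^ 2))
      (1.04 * (1 / Real.log t ^ 2 - 2 / Real.log t ^ 3)) t := by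
    intro t ht
    rw [huIcc] at ht
    obtain ⟨h0, h1⟩ := hlog t ht
    have hl0 : Real.log t ≠ 0 := hne t ht
    have h2 := (((hasDerivAt_id t).div ((Real.hasDerivAt_log h0.ne').pow 2)
      (pow_ne_zero 2 hl0)).const_mul (1.04 : ℝ))
    refine h2.congr_deriv ?_
    simp only [Pi.pow_apply, id]
    field_simp
    push_cast
    ring
  have hle : ∫ t in a..b, 1 / Real.log t ^ 2 ≤
      ∫ t in a..b, 1.04 * (1 / Real.log t ^ 2 - 2 / Real.log t ^ 3) := by
    refine intervalIntegral.integral_mono_on hab hi1 hi2 fun t ht => ?_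
    obtain ⟨h0, h1⟩ := hlog t ht
    have hl0 : 0 < Real.log t := by linarith
    have : 2 / Real.log t ^ 3 ≤ (1 / 26) * (1 / Real.log t ^ 2) := by
      rw [← mul_div_assoc, div_le_div_iff₀ (by positivity) (by positivity)]
      nlinarith [pow_pos hl0 2]
    have h3 : 0 < 1 / Real.log t ^ 2 := by positivity
    linarith
  rw [intervalIntegral.integral_eq_sub_of_hasDerivAt hder hi2] at hle
  have h4 : 0 ≤ a / Real.log a ^ 2 := by
    have := (hlog a (left_mem_Icc.2 hab)).1
    positivity
  linarith

lemma eventually_primeCounting_mul_log_sub_theta_le : ∀ᶠ x : ℝ in atTop,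
    (Nat.primeCounting ⌊x⌋₊ : ℝ) * Real.log x - Chebyshev.theta x ≤
      1.45 * (x / Real.log x) := by
  set T : ℝ := Real.exp 52 with hT
  have hT2 : 53 ≤ T := by
    have := Real.add_one_le_exp (52 : ℝ)
    linarith
  set A : ℝ := ∫ t in (2 : ℝ)..T, Chebyshev.theta t / (t * Real.log t ^ 2) with hA
  have hsmall : ∀ᶠ x : ℝ in atTop, A ≤ 0.008 * (x / Real.log x ^ 2) := by
    filter_upwards [eventually_ge_atTop (3 : ℝ),
      eventually_ge_atTop ((|A| * (((2 : ℕ) + 1) / (1 / 2)) ^ 2 / 0.008) ^ 2)] with x hx3 hx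
    have hl := one_le_log_of_three_le hx3
    have h1 := log_pow_le_rpow 2 (x := x) (by linarith) (ε := 1 / 2) (by norm_num)
    rw [← Real.sqrt_eq_rpow] at h1
    have h2 := Real.le_sqrt_of_sq_le hx
    rw [div_le_iff₀ (by norm_num)] at h2
    rw [← mul_div_assoc, le_div_iff₀ (by positivity)]
    calc A * Real.log x ^ 2 ≤ |A| * Real.log x ^ 2 := by gcongr; exact le_abs_self A
      _ ≤ |A| * ((((2 : ℕ) + 1) / (1 / 2)) ^ 2 * √x) := by gcongr
      _ = |A| * (((2 : ℕ) + 1) / (1 / 2)) ^ 2 * √x := by ring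
      _ ≤ √x * 0.008 * √x := by gcongr
      _ = 0.008 * (√x * √x) := by ring
      _ = 0.008 * x := by rw [Real.mul_self_sqrt (by linarith)]
  filter_upwards [hsmall, eventually_ge_atTop T] with x hx hxT
  have hl := one_le_log_of_three_le (x := x) (by linarith)
  have hi : ∀ a b : ℝ, 2 ≤ a → a ≤ b →
      IntervalIntegrable (fun t => Chebyshev.theta t / (t * Real.log t ^ 2)) volume a b := by
    intro a b ha hab
    rw [intervalIntegrable_iff_integrableOn_Icc_of_le hab]
    exact (Chebyshev.integrableOn_theta_div_id_mul_log_sq b).mono_set (Icc_subset_Icc_left ha)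
  rw [Chebyshev.primeCounting_eq_theta_div_log_add_integral (by linarith),
    ← intervalIntegral.integral_add_adjacent_intervals (hi 2 T le_rfl (by linarith))
      (hi T x (by linarith) hxT), ← hA]
  have hlogT : ∀ t ∈ Icc T x, 0 < t ∧ 0 < Real.log t := fun t ht =>
    ⟨by linarith [ht.1], by linarith [one_le_log_of_three_le (x := t) (by linarith [ht.1])]⟩
  have hle : ∫ t in T..x, Chebyshev.theta t / (t * Real.log t ^ 2) ≤
      ∫ t in T..x, Real.log 4 * (1 / Real.log t ^ 2) := by
    refine intervalIntegral.integral_mono_on hxT (hi T x (by linarith) hxT) ?_ fun t ht => ?_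
    · refine ContinuousOn.intervalIntegrable ?_
      rw [uIcc_of_le hxT]
      refine continuousOn_const.mul (continuousOn_const.div (ContinuousOn.pow ?_ 2) ?_)
      · exact fun t ht => (Real.continuousAt_log (hlogT t ht).1.ne').continuousWithinAt
      · exact fun t ht => pow_ne_zero 2 (hlogT t ht).2.ne'
    · obtain ⟨h0, h1⟩ := hlogT t ht
      have h2 := Chebyshev.theta_le_log4_mul_x h0.le
      calc _ ≤ Real.log 4 * t / (t * Real.log t ^ 2) := by gcongr
        _ = _ := by field_simp
  rw [intervalIntegral.integral_const_mul] at hle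
  have h3 := integral_one_div_log_sq_le hxT le_rfl
  have hlog4 : Real.log 4 ≤ 1.3864 := by
    rw [show (4 : ℝ) = 2 ^ 2 by norm_num, Real.log_pow]
    push_cast
    linarith [Real.log_two_lt_d9]
  have hx0 : 0 < x := by linarith
  have h5 : 0 ≤ x / Real.log x ^ 2 := by positivity
  have h4 : Real.log 4 * ∫ t in T..x, 1 / Real.log t ^ 2 ≤
      1.3864 * (1.04 * (x / Real.log x ^ 2)) := by
    have : 0 ≤ Real.log 4 := Real.log_nonneg (by norm_num)
    calc _ ≤ Real.log 4 * (1.04 * (x / Real.log x ^ 2)) := by gcongr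
      _ ≤ _ := mul_le_mul_of_nonneg_right hlog4 (by positivity)
  have h6 : A + ∫ t in T..x, Chebyshev.theta t / (t * Real.log t ^ 2) ≤
      1.45 * (x / Real.log x ^ 2) := by linarith
  calc _ = (A + ∫ t in T..x, Chebyshev.theta t / (t * Real.log t ^ 2)) * Real.log x := by
        field_simp
        ring
    _ ≤ 1.45 * (x / Real.log x ^ 2) * Real.log x := by gcongr
    _ = _ := by field_simp

/-- Passing from a von Mangoldt-weighted count to an unweighted count of primes. -/
lemma card_primes_mul_log_le (p : ℕ → Prop) [DecidablePred p] {w : ℝ} (hw : 1 ≤ w) :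
    (((Finset.Icc 1 ⌊w⌋₊).filter fun n => n.Prime ∧ p n).card : ℝ) * Real.log w ≤
      ∑ n ∈ (Finset.Icc 1 ⌊w⌋₊).filter p, ArithmeticFunction.vonMangoldt n +
        ((Nat.primeCounting ⌊w⌋₊ : ℝ) * Real.log w - Chebyshev.theta w) := by
  set A := (Finset.Icc 1 ⌊w⌋₊).filter fun n => n.Prime ∧ p n
  set R := (Finset.Icc 1 ⌊w⌋₊).filter Nat.Prime with hR
  have h1 : ∑ n ∈ A, Real.log n ≤
      ∑ n ∈ (Finset.Icc 1 ⌊w⌋₊).filter p, ArithmeticFunction.vonMangoldt n := by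
    calc ∑ n ∈ A, Real.log n = ∑ n ∈ A, ArithmeticFunction.vonMangoldt n :=
          Finset.sum_congr rfl fun n hn =>
            (ArithmeticFunction.vonMangoldt_apply_prime (Finset.mem_filter.1 hn).2.1).symm
      _ ≤ _ := Finset.sum_le_sum_of_subset_of_nonneg
          (fun n hn => Finset.mem_filter.2
            ⟨(Finset.mem_filter.1 hn).1, (Finset.mem_filter.1 hn).2.2⟩)
          fun _ _ _ => ArithmeticFunction.vonMangoldt_nonneg
  have h2 : ∑ n ∈ A, (Real.log w - Real.log n) ≤ ∑ n ∈ R, (Real.log w - Real.log n) := by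
    refine Finset.sum_le_sum_of_subset_of_nonneg (fun n hn => Finset.mem_filter.2
      ⟨(Finset.mem_filter.1 hn).1, (Finset.mem_filter.1 hn).2.1⟩) fun n hn _ => ?_
    have h3 := Finset.mem_Icc.1 (Finset.mem_filter.1 hn).1
    have h4 : (n : ℝ) ≤ w := (Nat.le_floor_iff (by linarith)).1 h3.2
    have h5 : (0 : ℝ) < n := by exact_mod_cast h3.1
    linarith [Real.log_le_log h5 h4]
  have h3 : Chebyshev.theta w = ∑ n ∈ R, Real.log n := rfl
  have h4 : (Nat.primeCounting ⌊w⌋₊ : ℝ) = R.card := by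
    rw [Nat.primeCounting, Nat.primeCounting', Nat.count_eq_card_filter_range]
    congr 2
    ext n
    simp only [hR, Finset.mem_filter, Finset.mem_range, Finset.mem_Icc, Nat.lt_succ_iff]
    constructor
    · exact fun h => ⟨⟨h.2.pos, h.1⟩, h.2⟩
    · exact fun h => ⟨h.1.2, h.2⟩
  rw [Finset.sum_sub_distrib, Finset.sum_sub_distrib, Finset.sum_const, Finset.sum_const,
    nsmul_eq_mul, nsmul_eq_mul] at h2
  rw [h4, h3]
  linarith

/-- The primes in `(y, y^{1+ε}]`. -/
noncomputable def sievePrimes (y ε : ℝ) : Finset ℕ :=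
  (Finset.Ioc ⌊y⌋₊ ⌊y ^ (1 + ε)⌋₊).filter Nat.Prime

lemma mem_sievePrimes {y ε : ℝ} (hy : 0 ≤ y) {q : ℕ} :
    q ∈ sievePrimes y ε ↔ q.Prime ∧ y < q ∧ (q : ℝ) ≤ y ^ (1 + ε) := by
  rw [sievePrimes, Finset.mem_filter, Finset.mem_Ioc, Nat.floor_lt hy,
    Nat.le_floor_iff (Real.rpow_nonneg hy _)]
  tauto

lemma exists_sum_sievePrimes : ∃ K : ℝ, 0 < K ∧ ∀ y ε : ℝ, 9 ≤ y → K ≤ Real.log y → 0 ≤ ε →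
    ε ≤ 1 / 4 → ∑ q ∈ sievePrimes y ε, 1 / (q.totient : ℝ) ≤ 1 ∧
      Real.log (1 + ε) - K / Real.log y ^ 2 ≤ ∑ q ∈ sievePrimes y ε, 1 / (q.totient : ℝ) := by
  obtain ⟨K, hK, H⟩ := abs_sum_inv_prime_sub_le
  refine ⟨K + 4, by positivity, fun y ε hy hKy hε0 hε => ?_⟩
  have hly : 4 ≤ Real.log y := by linarith
  have hly2 : (0 : ℝ) < Real.log y ^ 2 := by positivity
  have hyz : y ≤ y ^ (1 + ε) := by
    conv_lhs => rw [← Real.rpow_one y]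
    exact Real.rpow_le_rpow_of_exponent_le (by linarith) (by linarith)
  have h1 := abs_le.1 (H y (y ^ (1 + ε)) hy hyz)
  rw [Real.log_rpow (by linarith), Real.log_mul (by linarith) (by linarith),
    add_sub_cancel_right] at h1
  change _ ≤ ∑ q ∈ sievePrimes y ε, _ - _ ∧ ∑ q ∈ sievePrimes y ε, _ - _ ≤ _ at h1
  have hprime : ∀ q ∈ sievePrimes y ε, 1 / (q : ℝ) ≤ 1 / (q.totient : ℝ) ∧
      1 / (q.totient : ℝ) ≤ 2 * (1 / (q : ℝ)) := by
    intro q hq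
    have hp := ((mem_sievePrimes (by linarith)).1 hq).1
    have h2 : (2 : ℝ) ≤ q := by exact_mod_cast hp.two_le
    rw [Nat.totient_prime hp, Nat.cast_sub hp.one_le, Nat.cast_one]
    constructor
    · exact one_div_le_one_div_of_le (by linarith) (by linarith)
    · rw [← mul_div_assoc, div_le_div_iff₀ (by linarith) (by linarith)]
      linarith
  have hlo := Finset.sum_le_sum fun q hq => (hprime q hq).1
  have hhi := Finset.sum_le_sum fun q hq => (hprime q hq).2
  rw [← Finset.mul_sum] at hhi
  constructor
  · have h3 : Real.log (1 + ε) ≤ ε := by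
      have := Real.log_le_sub_one_of_pos (x := 1 + ε) (by linarith)
      linarith
    have h4 : K / Real.log y ^ 2 ≤ 1 / 4 := by
      rw [div_le_iff₀ hly2]
      nlinarith
    linarith
  · have h3 : K / Real.log y ^ 2 ≤ (K + 4) / Real.log y ^ 2 := by gcongr; linarith
    linarith

/-- The quadratic lower bound of the sieve main term. -/
lemma one_sub_add_sq_le {ε δ s : ℝ} (hε0 : 0 ≤ ε) (hδ0 : 0 ≤ δ) (hδ1 : δ ≤ 1)
    (hs1 : s ≤ 1) (hs : Real.log (1 + ε) - δ ≤ s) :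
    1 - s + s ^ 2 / 2 ≤ 1 - ε + ε ^ 2 + 2 * δ := by
  have h1 : Real.log (1 + ε) ≤ ε := by
    have := Real.log_le_sub_one_of_pos (x := 1 + ε) (by linarith)
    linarith
  have h2 := Real.le_log_one_add_of_nonneg hε0
  have h3 : ε - ε ^ 2 / 2 ≤ Real.log (1 + ε) := by
    refine le_trans ?_ h2
    rw [le_div_iff₀ (by linarith)]
    nlinarith [pow_nonneg hε0 3]
  have h0 : 0 ≤ Real.log (1 + ε) := Real.log_nonneg (by linarith)
  set L := Real.log (1 + ε)
  have h4 : L ^ 2 ≤ ε ^ 2 := by gcongr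
  have h5 : (1 - s) ^ 2 ≤ (1 - (L - δ)) ^ 2 := by
    have : 0 ≤ 1 - s := by linarith
    gcongr
  nlinarith [mul_nonneg h0 hδ0, mul_le_mul_of_nonneg_left hδ1 hδ0]

lemma exists_sum_vonMangoldt_sieve_le : ∃ K : ℝ, 0 < K ∧ ∀ y ε w : ℝ, 9 ≤ y →
    K ≤ Real.log y → 0 ≤ ε → ε ≤ 1 / 4 → y ^ 6 ≤ w →
    ∑ n ∈ (Finset.Icc 1 ⌊w⌋₊).filter (fun n => ∀ q ∈ sievePrimes y ε, ¬ q ∣ n - 1),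
        ArithmeticFunction.vonMangoldt n ≤
      w * (1 - ε + ε ^ 2) + K * (w / Real.log y ^ 2) := by
  obtain ⟨K₁, hK₁, H₁⟩ := exists_sum_norm_psiChar_le
  obtain ⟨K₂, hK₂, H₂⟩ := exists_sum_sievePrimes
  obtain ⟨C, hC, HC⟩ := abs_psi_sub_le 2
  set M : ℝ := (((3 : ℕ) + 1) / (1 / 2 : ℝ)) ^ 3 with hM
  have hM0 : 0 < M := by positivity
  refine ⟨3 * K₁ + 2 * K₂ + C + 4 * M + 1, by positivity, fun y ε w hy hKy hε0 hε hyw => ?_⟩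
  have hly : 1 ≤ Real.log y := one_le_log_of_three_le (by linarith)
  have hyw' : y ≤ w := (le_self_pow₀ (by linarith) (by norm_num)).trans hyw
  have hw0 : 0 < w := by linarith
  have hlyw : Real.log y ≤ Real.log w := Real.log_le_log (by linarith) hyw'
  have hy52 : (1 : ℝ) ≤ y ^ (5 / 2 : ℝ) := Real.one_le_rpow (by linarith) (by norm_num)
  set N := ⌊w⌋₊
  set Q := ⌊y ^ (5 / 2 : ℝ)⌋₊
  have hNw : (N : ℝ) ≤ w := Nat.floor_le hw0.le
  have hQy : (Q : ℝ) ≤ y ^ (5 / 2 : ℝ) := Nat.floor_le (by linarith)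
  have hN1 : 1 ≤ N := Nat.le_floor (by push_cast; linarith)
  have hB := H₁ y (by linarith) N Q (Nat.le_floor (by push_cast; exact hy52)) hQy
    (hyw.trans (Nat.lt_floor_add_one w).le)
  obtain ⟨hS1, hS2⟩ := H₂ y ε hy (by linarith) hε0 hε
  have hmem : ∀ q ∈ sievePrimes y ε, q.Prime ∧ y < q ∧ (q : ℝ) ≤ y ^ (1 + ε) := fun q hq =>
    (mem_sievePrimes (by linarith)).1 hq
  have hexp : ∀ a : ℝ, a ≤ 5 / 2 → y ^ a ≤ y ^ (5 / 2 : ℝ) := fun a ha =>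
    Real.rpow_le_rpow_of_exponent_le (by linarith) ha
  have hsieve := sum_vonMangoldt_sieve_le (P := sievePrimes y ε) (fun q hq => (hmem q hq).1)
    (y := y) (by linarith) (fun q hq => (hmem q hq).2.1)
    (fun q hq => Nat.le_floor ((hmem q hq).2.2.trans (hexp _ (by linarith))))
    (fun p hp => by
      obtain ⟨⟨h1, h2⟩, -⟩ := mem_ltPairs.1 hp
      refine Nat.le_floor ?_
      push_cast
      calc (p.1 : ℝ) * p.2 ≤ y ^ (1 + ε) * y ^ (1 + ε) := by
            gcongr
            · exact (hmem _ h1).2.2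
            · exact (hmem _ h2).2.2
        _ = y ^ ((1 + ε) + (1 + ε)) := (Real.rpow_add (by linarith) _ _).symm
        _ ≤ _ := hexp _ (by linarith)) hS1 hB
  set S := ∑ q ∈ sievePrimes y ε, 1 / (q.totient : ℝ) with hS
  have hS0 : 0 ≤ S := Finset.sum_nonneg fun q _ => by positivity
  set R := w / Real.log y ^ 2 with hR
  have hR0 : 0 ≤ R := by positivity
  have hδ : K₂ / Real.log y ^ 2 ≤ 1 := by
    rw [div_le_one (by positivity)]
    nlinarith
  have hmain := one_sub_add_sq_le hε0 (by positivity) hδ hS1 hS2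
  have hfac0 : 0 ≤ 1 - S + S ^ 2 / 2 := by nlinarith
  have hfac1 : 1 - S + S ^ 2 / 2 ≤ 1 := by nlinarith
  have hpsi : Chebyshev.psi N ≤ w + C * R := by
    have h1 : Chebyshev.psi N = Chebyshev.psi w := (Chebyshev.psi_eq_psi_coe_floor w).symm
    have h2 := (abs_le.1 (HC w (by linarith))).2
    have h3 : w / Real.log w ^ 2 ≤ R := by simp only [hR]; gcongr
    have h4 := mul_le_mul_of_nonneg_left h3 hC.le
    linarith
  have hprod : Chebyshev.psi N * (1 - S + S ^ 2 / 2) ≤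
      w * (1 - ε + ε ^ 2) + 2 * K₂ * R + C * R := by
    have h1 : w * (1 - S + S ^ 2 / 2) ≤ w * (1 - ε + ε ^ 2 + 2 * (K₂ / Real.log y ^ 2)) := by
      gcongr
    have h2 : w * (1 - ε + ε ^ 2 + 2 * (K₂ / Real.log y ^ 2)) =
        w * (1 - ε + ε ^ 2) + 2 * K₂ * R := by
      simp only [hR]
      ring
    have h3 : C * R * (1 - S + S ^ 2 / 2) ≤ C * R := mul_le_of_le_one_right (by positivity) hfac1
    have h4 := mul_le_mul_of_nonneg_right hpsi hfac0
    linarith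
  have hNR : (N : ℝ) / Real.log y ^ 2 ≤ R := by simp only [hR]; gcongr
  have hQN : (Q : ℝ) * Real.log N ≤ M * R := by
    have h1 : Real.log N ≤ Real.log w := Real.log_le_log (by exact_mod_cast hN1) hNw
    have h2 : (Q : ℝ) ≤ √w := by
      refine hQy.trans ((Real.rpow_le_rpow_of_exponent_le (by linarith)
        (by norm_num : (5 / 2 : ℝ) ≤ (3 : ℕ))).trans ?_)
      rw [Real.rpow_natCast]
      refine Real.le_sqrt_of_sq_le ?_
      rw [← pow_mul]
      exact hyw
    have h3 := log_pow_le_rpow 3 (x := w) (by linarith) (ε := 1 / 2) (by norm_num)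
    rw [← Real.sqrt_eq_rpow, ← hM] at h3
    rw [hR, ← mul_div_assoc, le_div_iff₀ (by positivity)]
    have hlw : 0 ≤ Real.log w := by linarith
    calc (Q : ℝ) * Real.log N * Real.log y ^ 2 ≤ √w * Real.log w * Real.log w ^ 2 := by gcongr
      _ = √w * Real.log w ^ 3 := by ring
      _ ≤ √w * (M * √w) := by gcongr
      _ = M * (√w * √w) := by ring
      _ = M * w := by rw [Real.mul_self_sqrt hw0.le]
  have h5 := mul_le_mul_of_nonneg_left hNR hK₁.le
  linarith

lemma sieve_numerics {ε L l K : ℝ} (hK : 0 < K) (hε : ε ≤ 1 / 4) (hl : 1000 * (K + 1) ≤ l)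
    (hlε : 1 / l ≤ ε) (hL : 6 * l ≤ L) :
    1 - ε + ε ^ 2 + K / l ^ 2 + 1.45 / L ≤ 1 - 2 * ε / 3 := by
  have hl0 : 0 < l := by linarith
  have hε0 : 0 < ε := lt_of_lt_of_le (by positivity) hlε
  have h1 : K / l ^ 2 ≤ ε / 1000 := by
    have h2 : K / l ≤ 1 / 1000 := by
      rw [div_le_iff₀ hl0]
      linarith
    calc K / l ^ 2 = K / l * (1 / l) := by field_simp
      _ ≤ 1 / 1000 * ε := by gcongr
      _ = _ := by ring
  have h3 : 1.45 / L ≤ 1.45 / 6 * (1 / l) := by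
    rw [← mul_div_assoc, div_le_div_iff₀ (by linarith) hl0]
    linarith
  have h4 : 1 / l ≤ 1 / 1000 := one_div_le_one_div_of_le (by norm_num) (by linarith)
  rcases le_total ε (1 / 12) with h | h
  · nlinarith
  · nlinarith

lemma exists_card_sieve_le : ∃ K : ℝ, 0 < K ∧ ∀ y ε w : ℝ, 0 < y → K ≤ Real.log y →
    1 / Real.log y ≤ ε → ε ≤ 1 / 4 → y ^ 6 ≤ w →
    (((Finset.Icc 1 ⌊w⌋₊).filter fun n => n.Prime ∧
      ∀ q ∈ sievePrimes y ε, ¬ q ∣ n - 1).card : ℝ) ≤ (1 - 2 * ε / 3) * w / Real.log w := by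
  obtain ⟨K, hK, H⟩ := exists_sum_vonMangoldt_sieve_le
  obtain ⟨W, hW⟩ := eventually_atTop.1 eventually_primeCounting_mul_log_sub_theta_le
  refine ⟨1000 * (K + 1) + |W|, by positivity, fun y ε w hy0 hKy hε1 hε hyw => ?_⟩
  have hW0 := abs_nonneg W
  have hl0 : 0 < Real.log y := by linarith
  have hylog : Real.log y + 1 ≤ y := by
    have := Real.log_le_sub_one_of_pos hy0
    linarith
  have hyw' : y ≤ w := (le_self_pow₀ (by linarith) (by norm_num)).trans hyw
  have hε0 : 0 < ε := lt_of_lt_of_le (by positivity) hε1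
  have hw0 : 0 < w := by linarith
  have hL : 6 * Real.log y ≤ Real.log w := by
    have := Real.log_le_log (by positivity) hyw
    rw [Real.log_pow] at this
    exact_mod_cast this
  have hL0 : 0 < Real.log w := by linarith
  have h1 := H y ε w (by linarith) (by linarith) hε0.le hε hyw
  have h2 := hW w (by linarith [le_abs_self W])
  have h3 := card_primes_mul_log_le (fun n => ∀ q ∈ sievePrimes y ε, ¬ q ∣ n - 1) (w := w)
    (by linarith)
  have h4 := mul_le_mul_of_nonneg_left
    (sieve_numerics hK hε (by linarith : 1000 * (K + 1) ≤ Real.log y) hε1 hL) hw0.le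
  rw [le_div_iff₀ hL0]
  calc _ ≤ w * (1 - ε + ε ^ 2) + K * (w / Real.log y ^ 2) + 1.45 * (w / Real.log w) := by
        linarith
    _ = w * (1 - ε + ε ^ 2 + K / Real.log y ^ 2 + 1.45 / Real.log w) := by ring
    _ ≤ _ := h4
    _ = _ := by ring

end PNTBV

open scoped Classical

open Filter

theorem stmt_14 : ∃ C : ℝ, 0 < C ∧ ∀ᶠ x : ℝ in atTop,
    ∀ g ε : ℝ, C / Real.log x ≤ g → g ≤ 1 / 10 →
      1 / (g * Real.log x) ≤ ε → ε ≤ 1 / 4 →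
      ∀ w : ℝ, x ^ (6 * g) ≤ w →
      (((Finset.Icc 1 ⌊w⌋₊).filter
        (fun p => p.Prime ∧ ¬ ∃ q : ℕ, q.Prime ∧ q ∣ (p - 1) ∧
          x ^ g < (q : ℝ) ∧ (q : ℝ) ≤ x ^ (g * (1 + ε)))).card : ℝ) ≤
        (1 - 2 * ε / 3) * w / Real.log w := by
  obtain ⟨K, hK, H⟩ := PNTBV.exists_card_sieve_le
  refine ⟨K, hK, ?_⟩
  filter_upwards [eventually_gt_atTop 1] with x hx g ε hg _ hε1 hε w hw
  have hx0 : 0 < x := by linarith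
  have hlx : 0 < Real.log x := Real.log_pos hx
  have hy0 : 0 < x ^ g := Real.rpow_pos_of_pos hx0 g
  have hly : Real.log (x ^ g) = g * Real.log x := Real.log_rpow hx0 g
  have hyw : (x ^ g) ^ 6 ≤ w := by
    rwa [← Real.rpow_natCast, ← Real.rpow_mul hx0.le, mul_comm, Nat.cast_ofNat]
  refine le_trans (le_of_eq ?_) (H (x ^ g) ε w hy0 (by rw [hly]; exact (div_le_iff₀ hlx).1 hg)
    (by rw [hly]; exact hε1) hε hyw)
  congr 2
  ext p
  simp only [Finset.mem_filter, PNTBV.mem_sievePrimes hy0.le, ← Real.rpow_mul hx0.le]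
  refine and_congr_right fun _ => and_congr_right fun _ => ?_
  push Not
  exact ⟨fun h q hq hd => absurd hq.2.2 (not_le.2 (h q hq.1 hd hq.2.1)),
    fun h q hq hd h1 => not_le.1 fun h2 => h q ⟨hq, h1, h2⟩ hd⟩
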